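/- Let 0 < q < p < ∞ and s defined by 1/s = 1/q − 1/p. If g ∈ H^s, then the generalized integration operator T_g^{n,k} : H^p → H^q is compact: for every bounded sequence {f_j} in H^p that converges to 0 uniformly on compact subsets of 𝔻, one has ‖T_g^{n,k} f_j‖_{H^q} → 0. -/

import Mathlib

open MeasureTheory ENNReal

/-- Point `e^{iθ}` of the unit circle. -/
noncomputable def circlePt (θ : ℝ) : ℂ := Complex.exp (θ * Complex.I)

/-- Hardy space (quasi)norm `‖f‖_{H^p}` as an extended nonnegative real. -/
noncomputable def hardyNorm (p : ℝ) (f : ℂ → ℂ) : ℝ≥0∞ :=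
  (⨆ r ∈ Set.Ico (0 : ℝ) 1,
      (∫⁻ θ in Set.Ioc (0 : ℝ) (2 * Real.pi),
        (‖f (r * circlePt θ)‖₊ : ℝ≥0∞) ^ p) / ENNReal.ofReal (2 * Real.pi)) ^ (1 / p)

/-- Integration operator `I f(z) = ∫_0^z f(t) dt` (along the segment from 0 to z). -/
noncomputable def Iop (f : ℂ → ℂ) (z : ℂ) : ℂ := z * ∫ t in (0 : ℝ)..1, f (t • z)

/-- Generalized integration operator `T_g^{n,k} f = I^n (f^{(k)} g^{(n-k)})`. -/
noncomputable def Tgnk (g : ℂ → ℂ) (n k : ℕ) (f : ℂ → ℂ) : ℂ → ℂ :=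
  Iop^[n] fun z => iteratedDeriv k f z * iteratedDeriv (n - k) g z

/-- A `2π`-periodic real function on the half-strip `{(x, t) : t > 0}`, bundled with the first and
pure second partial derivatives. -/
structure Jet where
  v : ℝ → ℝ → ℝ
  vx : ℝ → ℝ → ℝ
  vt : ℝ → ℝ → ℝ
  vxx : ℝ → ℝ → ℝ
  vtt : ℝ → ℝ → ℝ
  hx : ∀ x t, 0 < t → HasDerivAt (fun y => v y t) (vx x t) x
  ht : ∀ x t, 0 < t → HasDerivAt (fun s => v x s) (vt x t) t
  hxx : ∀ x t, 0 < t → HasDerivAt (fun y => vx y t) (vxx x t) x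
  htt : ∀ x t, 0 < t → HasDerivAt (fun s => vt x s) (vtt x t) t
  cv : ContinuousOn (Function.uncurry v) (Set.univ ×ˢ Set.Ioi 0)
  cvx : ContinuousOn (Function.uncurry vx) (Set.univ ×ˢ Set.Ioi 0)
  cvt : ContinuousOn (Function.uncurry vt) (Set.univ ×ˢ Set.Ioi 0)
  cvxx : ContinuousOn (Function.uncurry vxx) (Set.univ ×ˢ Set.Ioi 0)
  cvtt : ContinuousOn (Function.uncurry vtt) (Set.univ ×ˢ Set.Ioi 0)
  per : ∀ t, 0 < t → v (2 * Real.pi) t = v 0 t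
  perx : ∀ t, 0 < t → vx (2 * Real.pi) t = vx 0 t

/-- Continuity on horizontal lines of a function jointly continuous on the half-strip. -/
theorem continuous_slice {w : ℝ → ℝ → ℝ}
    (h : ContinuousOn (Function.uncurry w) (Set.univ ×ˢ Set.Ioi 0)) {t : ℝ} (ht : 0 < t) :
    Continuous (fun x => w x t) :=
  h.comp_continuous (f := fun x : ℝ => (x, t)) (by fun_prop) (fun x => by simpa using ht)

theorem hasDerivAt_integral_strip {w wt : ℝ → ℝ → ℝ} {a b : ℝ}
    (hw : ContinuousOn (Function.uncurry w) (Set.univ ×ˢ Set.Ioi 0))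
    (hwt : ContinuousOn (Function.uncurry wt) (Set.univ ×ˢ Set.Ioi 0))
    (hd : ∀ x t, 0 < t → HasDerivAt (fun s => w x s) (wt x t) t) {t : ℝ} (ht : 0 < t) :
    HasDerivAt (fun t => ∫ x in a..b, w x t) (∫ x in a..b, wt x t) t := by
  have hK : IsCompact (Set.uIcc a b ×ˢ Set.Icc (t / 2) (2 * t)) :=
    isCompact_uIcc.prod isCompact_Icc
  obtain ⟨C, hC⟩ := hK.exists_bound_of_continuousOn
    (hwt.mono (Set.prod_mono (Set.subset_univ _) fun s hs => lt_of_lt_of_le (by linarith) hs.1))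
  have hs : Set.Ioo (t / 2) (2 * t) ∈ nhds t := Ioo_mem_nhds (by linarith) (by linarith)
  refine (intervalIntegral.hasDerivAt_integral_of_dominated_loc_of_deriv_le
    (F := fun t x => w x t) (F' := fun t x => wt x t) (bound := fun _ => C) hs ?_ ?_ ?_ ?_ ?_ ?_).2
  · filter_upwards [hs] with s hs
    exact (continuous_slice hw (by linarith [hs.1])).aestronglyMeasurable
  · exact (continuous_slice hw ht).intervalIntegrable _ _
  · exact (continuous_slice hwt ht).aestronglyMeasurable
  · refine Filter.Eventually.of_forall fun x hx s hs => ?_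
    exact hC (x, s) ⟨Set.uIoc_subset_uIcc hx, hs.1.le, hs.2.le⟩
  · exact intervalIntegrable_const
  · exact Filter.Eventually.of_forall fun x _ s hs => hd x s (by linarith [hs.1])

namespace Jet

/-- The Laplacian. -/
def lap (J : Jet) (x t : ℝ) : ℝ := J.vxx x t + J.vtt x t

/-- The squared length of the gradient. -/
def grad2 (J : Jet) (x t : ℝ) : ℝ := J.vx x t ^ 2 + J.vt x t ^ 2

theorem grad2_nonneg (J : Jet) (x t : ℝ) : 0 ≤ J.grad2 x t := by unfold grad2; positivity

theorem integral_vxx (J : Jet) {t : ℝ} (ht : 0 < t) :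
    ∫ x in (0 : ℝ)..2 * Real.pi, J.vxx x t = 0 := by
  rw [intervalIntegral.integral_eq_sub_of_hasDerivAt (fun x _ => J.hxx x t ht)
    ((continuous_slice J.cvxx ht).intervalIntegrable _ _), J.perx t ht, sub_self]

theorem integral_lap (J : Jet) {t : ℝ} (ht : 0 < t) :
    ∫ x in (0 : ℝ)..2 * Real.pi, J.lap x t = ∫ x in (0 : ℝ)..2 * Real.pi, J.vtt x t := by
  unfold lap
  rw [intervalIntegral.integral_add ((continuous_slice J.cvxx ht).intervalIntegrable _ _)
    ((continuous_slice J.cvtt ht).intervalIntegrable _ _), J.integral_vxx ht, zero_add]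

/-- A convex function on `(0, ∞)` with a finite limit at infinity stays above that limit. -/
theorem _root_.ConvexOn.ge_of_tendsto_atTop {φ : ℝ → ℝ} (hφ : ConvexOn ℝ (Set.Ioi 0) φ) {l : ℝ}
    (hl : Filter.Tendsto φ Filter.atTop (nhds l)) {t : ℝ} (ht : 0 < t) : l ≤ φ t := by
  by_contra! hlt
  have h2 : Filter.Tendsto (fun u => 2 * φ (t + u) - φ (t + 2 * u)) Filter.atTop
      (nhds (2 * l - l)) := by
    refine Filter.Tendsto.sub (Filter.Tendsto.const_mul _ (hl.comp ?_)) (hl.comp ?_)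
    · exact Filter.tendsto_atTop_add_const_left _ _ Filter.tendsto_id
    · exact Filter.tendsto_atTop_add_const_left _ _
        (Filter.Tendsto.const_mul_atTop (by norm_num) Filter.tendsto_id)
  have h3 : 2 * l - l ≤ φ t := by
    refine le_of_tendsto h2 ?_
    filter_upwards [Filter.eventually_ge_atTop 0] with u hu
    have := hφ.2 ht (show (0 : ℝ) < t + 2 * u by linarith)
      (show (0 : ℝ) ≤ 1 / 2 by norm_num) (show (0 : ℝ) ≤ 1 / 2 by norm_num) (by norm_num)
    simp only [smul_eq_mul] at this
    rw [show 1 / 2 * t + 1 / 2 * (t + 2 * u) = t + u by ring] at this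
    linarith
  linarith

/-- If the circular means of the Laplacian are nonnegative, the circular means of the function
dominate its value at infinity. -/
theorem integral_ge_of_tendsto (J : Jet)
    (hlap : ∀ t, 0 < t → 0 ≤ ∫ x in (0 : ℝ)..2 * Real.pi, J.lap x t) {L : ℝ}
    (hL : TendstoUniformly (fun t x => J.v x t) (fun _ => L) Filter.atTop) {t : ℝ} (ht : 0 < t) :
    2 * Real.pi * L ≤ ∫ x in (0 : ℝ)..2 * Real.pi, J.v x t := by
  have d1 : ∀ t, 0 < t → HasDerivAt (fun t => ∫ x in (0 : ℝ)..2 * Real.pi, J.v x t)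
      (∫ x in (0 : ℝ)..2 * Real.pi, J.vt x t) t :=
    fun t ht => hasDerivAt_integral_strip J.cv J.cvt J.ht ht
  have d2 : ∀ t, 0 < t → HasDerivAt (fun t => ∫ x in (0 : ℝ)..2 * Real.pi, J.vt x t)
      (∫ x in (0 : ℝ)..2 * Real.pi, J.vtt x t) t :=
    fun t ht => hasDerivAt_integral_strip J.cvt J.cvtt J.htt ht
  have hconv : ConvexOn ℝ (Set.Ioi 0) (fun t => ∫ x in (0 : ℝ)..2 * Real.pi, J.v x t) := by
    refine convexOn_of_hasDerivWithinAt2_nonneg (convex_Ioi 0)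
      (f' := fun t => ∫ x in (0 : ℝ)..2 * Real.pi, J.vt x t)
      (f'' := fun t => ∫ x in (0 : ℝ)..2 * Real.pi, J.vtt x t)
      (fun t ht => (d1 t ht).continuousAt.continuousWithinAt) ?_ ?_ ?_
    · intro t ht; rw [interior_Ioi] at ht ⊢; exact (d1 t ht).hasDerivWithinAt
    · intro t ht; rw [interior_Ioi] at ht ⊢; exact (d2 t ht).hasDerivWithinAt
    · intro t ht; rw [interior_Ioi] at ht; rw [← J.integral_lap ht]; exact hlap t ht
  refine hconv.ge_of_tendsto_atTop ?_ ht
  rw [Metric.tendsto_atTop]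
  intro ε hε
  have hpi := Real.pi_pos
  obtain ⟨N, hN⟩ := Filter.eventually_atTop.1
    (Metric.tendstoUniformly_iff.1 hL (ε / (4 * Real.pi)) (by positivity))
  refine ⟨max N 1, fun s hs => ?_⟩
  have hs0 : 0 < s := lt_of_lt_of_le (by norm_num) ((le_max_right _ _).trans hs)
  have h1 : ∫ x in (0 : ℝ)..2 * Real.pi, (J.v x s - L) =
      (∫ x in (0 : ℝ)..2 * Real.pi, J.v x s) - 2 * Real.pi * L := by
    rw [intervalIntegral.integral_sub ((continuous_slice J.cv hs0).intervalIntegrable _ _)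
      intervalIntegrable_const]
    simp
  rw [Real.dist_eq, ← h1, ← Real.norm_eq_abs]
  refine (intervalIntegral.norm_integral_le_of_norm_le_const
    (C := ε / (4 * Real.pi)) fun x _ => ?_).trans_lt ?_
  · have := hN s ((le_max_left _ _).trans hs) x
    rw [dist_comm, Real.dist_eq] at this
    exact this.le
  · rw [sub_zero, abs_of_pos (by positivity)]
    field_simp
    linarith

/-- The constant jet. -/
def const (c : ℝ) : Jet where
  v _ _ := c
  vx _ _ := 0
  vt _ _ := 0
  vxx _ _ := 0
  vtt _ _ := 0
  hx _ _ _ := hasDerivAt_const _ _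
  ht _ _ _ := hasDerivAt_const _ _
  hxx _ _ _ := hasDerivAt_const _ _
  htt _ _ _ := hasDerivAt_const _ _
  cv := continuousOn_const
  cvx := continuousOn_const
  cvt := continuousOn_const
  cvxx := continuousOn_const
  cvtt := continuousOn_const
  per _ _ := rfl
  perx _ _ := rfl

/-- The sum of two jets. -/
def add (J K : Jet) : Jet where
  v x t := J.v x t + K.v x t
  vx x t := J.vx x t + K.vx x t
  vt x t := J.vt x t + K.vt x t
  vxx x t := J.vxx x t + K.vxx x t
  vtt x t := J.vtt x t + K.vtt x t
  hx x t h := (J.hx x t h).add (K.hx x t h)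
  ht x t h := (J.ht x t h).add (K.ht x t h)
  hxx x t h := (J.hxx x t h).add (K.hxx x t h)
  htt x t h := (J.htt x t h).add (K.htt x t h)
  cv := J.cv.add K.cv
  cvx := J.cvx.add K.cvx
  cvt := J.cvt.add K.cvt
  cvxx := J.cvxx.add K.cvxx
  cvtt := J.cvtt.add K.cvtt
  per t h := by rw [J.per t h, K.per t h]
  perx t h := by rw [J.perx t h, K.perx t h]

/-- A scalar multiple of a jet. -/
def smul (c : ℝ) (J : Jet) : Jet where
  v x t := c * J.v x t
  vx x t := c * J.vx x t
  vt x t := c * J.vt x t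
  vxx x t := c * J.vxx x t
  vtt x t := c * J.vtt x t
  hx x t h := (J.hx x t h).const_mul c
  ht x t h := (J.ht x t h).const_mul c
  hxx x t h := (J.hxx x t h).const_mul c
  htt x t h := (J.htt x t h).const_mul c
  cv := continuousOn_const.mul J.cv
  cvx := continuousOn_const.mul J.cvx
  cvt := continuousOn_const.mul J.cvt
  cvxx := continuousOn_const.mul J.cvxx
  cvtt := continuousOn_const.mul J.cvtt
  per t h := by rw [J.per t h]
  perx t h := by rw [J.perx t h]

/-- A real power of a positive jet. -/
noncomputable def rpow (J : Jet) (hJ : ∀ x t, 0 < t → 0 < J.v x t) (r : ℝ) : Jet where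
  v x t := J.v x t ^ r
  vx x t := r * J.v x t ^ (r - 1) * J.vx x t
  vt x t := r * J.v x t ^ (r - 1) * J.vt x t
  vxx x t := r * J.v x t ^ (r - 1) * J.vxx x t +
    r * (r - 1) * J.v x t ^ (r - 2) * J.vx x t ^ 2
  vtt x t := r * J.v x t ^ (r - 1) * J.vtt x t +
    r * (r - 1) * J.v x t ^ (r - 2) * J.vt x t ^ 2
  hx x t h := by
    exact ((J.hx x t h).rpow_const (p := r) (Or.inl (hJ x t h).ne')).congr_deriv (by ring)
  ht x t h := by
    exact ((J.ht x t h).rpow_const (p := r) (Or.inl (hJ x t h).ne')).congr_deriv (by ring)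
  hxx x t h := by
    have := (((J.hx x t h).rpow_const (p := r - 1) (Or.inl (hJ x t h).ne')).const_mul r).mul
      (J.hxx x t h)
    rw [show r - 1 - 1 = r - 2 by ring] at this
    exact this.congr_deriv (by ring)
  htt x t h := by
    have := (((J.ht x t h).rpow_const (p := r - 1) (Or.inl (hJ x t h).ne')).const_mul r).mul
      (J.htt x t h)
    rw [show r - 1 - 1 = r - 2 by ring] at this
    exact this.congr_deriv (by ring)
  cv := J.cv.rpow_const fun z hz => Or.inl (hJ z.1 z.2 hz.2).ne'
  cvx := (continuousOn_const.mul
    (J.cv.rpow_const fun z hz => Or.inl (hJ z.1 z.2 hz.2).ne')).mul J.cvx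
  cvt := (continuousOn_const.mul
    (J.cv.rpow_const fun z hz => Or.inl (hJ z.1 z.2 hz.2).ne')).mul J.cvt
  cvxx := ContinuousOn.fun_add ((continuousOn_const.mul
    (J.cv.rpow_const fun z hz => Or.inl (hJ z.1 z.2 hz.2).ne')).mul J.cvxx)
    ((continuousOn_const.mul
    (J.cv.rpow_const fun z hz => Or.inl (hJ z.1 z.2 hz.2).ne')).mul (ContinuousOn.fun_pow J.cvx 2))
  cvtt := ContinuousOn.fun_add ((continuousOn_const.mul
    (J.cv.rpow_const fun z hz => Or.inl (hJ z.1 z.2 hz.2).ne')).mul J.cvtt)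
    ((continuousOn_const.mul
    (J.cv.rpow_const fun z hz => Or.inl (hJ z.1 z.2 hz.2).ne')).mul (ContinuousOn.fun_pow J.cvt 2))
  per t h := by rw [J.per t h]
  perx t h := by rw [J.per t h, J.perx t h]

theorem lap_add (J K : Jet) (x t : ℝ) : (J.add K).lap x t = J.lap x t + K.lap x t := by
  simp only [lap, add]; ring

theorem lap_smul (c : ℝ) (J : Jet) (x t : ℝ) : (smul c J).lap x t = c * J.lap x t := by
  simp only [lap, smul]; ring

theorem lap_rpow (J : Jet) (hJ : ∀ x t, 0 < t → 0 < J.v x t) (r x t : ℝ) :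
    (J.rpow hJ r).lap x t = r * J.v x t ^ (r - 1) * J.lap x t +
      r * (r - 1) * J.v x t ^ (r - 2) * J.grad2 x t := by
  simp only [lap, rpow, grad2]; ring

theorem lap_continuous (J : Jet) {t : ℝ} (ht : 0 < t) : Continuous fun x => J.lap x t :=
  (continuous_slice J.cvxx ht).add (continuous_slice J.cvtt ht)

/-- `J` behaves like a sum of squared moduli of holomorphic functions, with `D` in the role of the
sum of the squared moduli of their derivatives. -/
structure Psh (J : Jet) (D : ℝ → ℝ → ℝ) : Prop where
  nonneg : ∀ x t, 0 < t → 0 ≤ J.v x t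
  dnonneg : ∀ x t, 0 < t → 0 ≤ D x t
  lap_eq : ∀ x t, 0 < t → J.lap x t = 4 * D x t
  grad_le : ∀ x t, 0 < t → J.grad2 x t ≤ 4 * J.v x t * D x t

theorem Psh.add {J K : Jet} {D E : ℝ → ℝ → ℝ} (hJ : J.Psh D) (hK : K.Psh E) :
    (J.add K).Psh (fun x t => D x t + E x t) where
  nonneg x t h := add_nonneg (hJ.nonneg x t h) (hK.nonneg x t h)
  dnonneg x t h := add_nonneg (hJ.dnonneg x t h) (hK.dnonneg x t h)
  lap_eq x t h := by rw [lap_add, hJ.lap_eq x t h, hK.lap_eq x t h]; ring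
  grad_le x t h := by
    have h1 := hJ.grad_le x t h
    have h2 := hK.grad_le x t h
    have a1 := hJ.nonneg x t h
    have a2 := hK.nonneg x t h
    have b1 := hJ.dnonneg x t h
    have b2 := hK.dnonneg x t h
    simp only [grad2, Jet.add] at *
    set a := J.vx x t
    set b := J.vt x t
    set c := K.vx x t
    set d := K.vt x t
    set U := J.v x t
    set V := K.v x t
    set p := D x t
    set q := E x t
    have hcs : (a * c + b * d) ^ 2 ≤ (a ^ 2 + b ^ 2) * (c ^ 2 + d ^ 2) := by
      nlinarith [sq_nonneg (a * d - b * c)]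
    have hle : (a ^ 2 + b ^ 2) * (c ^ 2 + d ^ 2) ≤ (4 * U * p) * (4 * V * q) := by gcongr
    have h3 : a * c + b * d ≤ 2 * (U * q + V * p) := by
      refine abs_le_of_sq_le_sq' ?_ (by positivity) |>.2
      nlinarith [sq_nonneg (U * q - V * p)]
    nlinarith

theorem Psh.smul {J : Jet} {D : ℝ → ℝ → ℝ} (hJ : J.Psh D) {c : ℝ} (hc : 0 ≤ c) :
    (Jet.smul c J).Psh (fun x t => c * D x t) where
  nonneg x t h := mul_nonneg hc (hJ.nonneg x t h)
  dnonneg x t h := mul_nonneg hc (hJ.dnonneg x t h)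
  lap_eq x t h := by rw [lap_smul, hJ.lap_eq x t h]; ring
  grad_le x t h := by
    have h1 := mul_le_mul_of_nonneg_left (hJ.grad_le x t h) (sq_nonneg c)
    simp only [grad2, Jet.smul] at *
    linarith

theorem Psh.const {c : ℝ} (hc : 0 ≤ c) : (Jet.const c).Psh (fun _ _ => 0) where
  nonneg _ _ _ := hc
  dnonneg _ _ _ := le_rfl
  lap_eq _ _ _ := by simp [lap, Jet.const]
  grad_le _ _ _ := by simp [grad2, Jet.const]

theorem rpow_sub_two_mul {a : ℝ} (ha : 0 < a) (r : ℝ) : a ^ (r - 2) * a = a ^ (r - 1) := by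
  rw [← Real.rpow_add_one ha.ne']; congr 1; ring

theorem Psh.lap_rpow_ge {J : Jet} {D : ℝ → ℝ → ℝ} (hJ : J.Psh D)
    (hpos : ∀ x t, 0 < t → 0 < J.v x t) {r : ℝ} (hr : 0 < r) {x t : ℝ} (ht : 0 < t) :
    4 * min r (r ^ 2) * J.v x t ^ (r - 1) * D x t ≤ (J.rpow hpos r).lap x t := by
  rw [lap_rpow, hJ.lap_eq x t ht]
  have h1 := hJ.grad_le x t ht
  have h2 := J.grad2_nonneg x t
  have hS := hpos x t ht
  have hD := hJ.dnonneg x t ht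
  have e := rpow_sub_two_mul hS r
  set S := J.v x t
  have p2 : 0 < S ^ (r - 2) := by positivity
  rw [← e]
  have hm : S ^ (r - 2) * J.grad2 x t ≤ S ^ (r - 2) * (4 * S * D x t) := by gcongr
  have hp : 0 ≤ S ^ (r - 2) * J.grad2 x t := by positivity
  have hq : 0 ≤ S ^ (r - 2) * S * D x t := by positivity
  rcases le_total 1 r with h | h
  · rw [min_eq_left (by nlinarith)]
    have : 0 ≤ r * (r - 1) * (S ^ (r - 2) * J.grad2 x t) :=
      mul_nonneg (mul_nonneg hr.le (by linarith)) hp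
    nlinarith
  · rw [min_eq_right (by nlinarith)]
    have := mul_le_mul_of_nonneg_left hm (mul_nonneg hr.le (sub_nonneg.2 h))
    nlinarith

theorem Psh.lap_rpow_le {J : Jet} {D : ℝ → ℝ → ℝ} (hJ : J.Psh D)
    (hpos : ∀ x t, 0 < t → 0 < J.v x t) {r : ℝ} (hr : 0 < r) {x t : ℝ} (ht : 0 < t) :
    (J.rpow hpos r).lap x t ≤ 4 * max r (r ^ 2) * J.v x t ^ (r - 1) * D x t := by
  rw [lap_rpow, hJ.lap_eq x t ht]
  have h1 := hJ.grad_le x t ht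
  have h2 := J.grad2_nonneg x t
  have hS := hpos x t ht
  have hD := hJ.dnonneg x t ht
  have e := rpow_sub_two_mul hS r
  set S := J.v x t
  have p2 : 0 < S ^ (r - 2) := by positivity
  rw [← e]
  have hm : S ^ (r - 2) * J.grad2 x t ≤ S ^ (r - 2) * (4 * S * D x t) := by gcongr
  have hp : 0 ≤ S ^ (r - 2) * J.grad2 x t := by positivity
  have hq : 0 ≤ S ^ (r - 2) * S * D x t := by positivity
  rcases le_total 1 r with h | h
  · rw [max_eq_right (by nlinarith)]
    have := mul_le_mul_of_nonneg_left hm (mul_nonneg hr.le (sub_nonneg.2 h))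
    nlinarith
  · rw [max_eq_left (by nlinarith)]
    have : 0 ≤ r * (1 - r) * (S ^ (r - 2) * J.grad2 x t) :=
      mul_nonneg (mul_nonneg hr.le (by linarith)) hp
    nlinarith

theorem lap_rpow_ge_of_one_le (J : Jet) (hpos : ∀ x t, 0 < t → 0 < J.v x t) {r : ℝ} (hr : 1 ≤ r)
    {x t : ℝ} (ht : 0 < t) :
    r * J.v x t ^ (r - 1) * J.lap x t ≤ (J.rpow hpos r).lap x t := by
  rw [lap_rpow]
  have hS := hpos x t ht
  have h2 := J.grad2_nonneg x t
  have h3 : 0 ≤ r * (r - 1) := mul_nonneg (by linarith) (by linarith)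
  have : 0 ≤ r * (r - 1) * J.v x t ^ (r - 2) * J.grad2 x t := by positivity
  linarith

theorem lap_rpow_le_of_le_one (J : Jet) (hpos : ∀ x t, 0 < t → 0 < J.v x t) {r : ℝ} (hr0 : 0 ≤ r)
    (hr : r ≤ 1) {x t : ℝ} (ht : 0 < t) :
    (J.rpow hpos r).lap x t ≤ r * J.v x t ^ (r - 1) * J.lap x t := by
  rw [lap_rpow]
  have hS := hpos x t ht
  have h2 := J.grad2_nonneg x t
  have h3 : 0 ≤ r * (1 - r) := mul_nonneg (by linarith) (by linarith)
  have : 0 ≤ r * (1 - r) * J.v x t ^ (r - 2) * J.grad2 x t := by positivity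
  linarith

end Jet

/-- A `2π`-periodic holomorphic function on the half-strip, in the variable `-t + i x`, with values
in a complex inner product space, bundled with its first two derivatives. -/
structure HolFamily (E : Type*) [NormedAddCommGroup E] [InnerProductSpace ℂ E] where
  h : ℝ → ℝ → E
  h1 : ℝ → ℝ → E
  h2 : ℝ → ℝ → E
  hx : ∀ x t, 0 < t → HasDerivAt (fun y => h y t) (Complex.I • h1 x t) x
  ht : ∀ x t, 0 < t → HasDerivAt (fun s => h x s) (-h1 x t) t
  h1x : ∀ x t, 0 < t → HasDerivAt (fun y => h1 y t) (Complex.I • h2 x t) x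
  h1t : ∀ x t, 0 < t → HasDerivAt (fun s => h1 x s) (-h2 x t) t
  ch : ContinuousOn (Function.uncurry h) (Set.univ ×ˢ Set.Ioi 0)
  ch1 : ContinuousOn (Function.uncurry h1) (Set.univ ×ˢ Set.Ioi 0)
  ch2 : ContinuousOn (Function.uncurry h2) (Set.univ ×ˢ Set.Ioi 0)
  per : ∀ t, 0 < t → h (2 * Real.pi) t = h 0 t
  per1 : ∀ t, 0 < t → h1 (2 * Real.pi) t = h1 0 t

namespace HolFamily
variable {E : Type*} [NormedAddCommGroup E] [InnerProductSpace ℂ E]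

/-- The real part of the inner product. -/
noncomputable def rin (a b : E) : ℝ := (inner ℂ a b).re

theorem rin_self (a : E) : rin a a = ‖a‖ ^ 2 := by
  simp [rin, inner_self_eq_norm_sq_to_K, ← Complex.ofReal_pow]

theorem rin_neg_right (a b : E) : rin a (-b) = -rin a b := by simp [rin]

theorem rin_neg_left (a b : E) : rin (-a) b = -rin a b := by simp [rin]

theorem rin_comm (a b : E) : rin a b = rin b a := by
  rw [rin, ← inner_conj_symm, Complex.conj_re, rin]

theorem rin_I_smul_I_smul (a b : E) : rin (Complex.I • a) (Complex.I • b) = rin a b := by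
  simp [rin, ← mul_assoc]

theorem hasDerivAt_rin {f g : ℝ → E} {f' g' : E} {x : ℝ} (hf : HasDerivAt f f' x)
    (hg : HasDerivAt g g' x) :
    HasDerivAt (fun y => rin (f y) (g y)) (rin (f x) g' + rin f' (g x)) x := by
  have := Complex.reCLM.hasFDerivAt.comp_hasDerivAt x (hf.inner ℂ hg)
  exact this.congr_deriv (by simp [rin])

theorem continuousOn_rin {X : Type*} [TopologicalSpace X] {f g : X → E} {s : Set X}
    (hf : ContinuousOn f s) (hg : ContinuousOn g s) : ContinuousOn (fun y => rin (f y) (g y)) s :=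
  Complex.continuous_re.comp_continuousOn (hf.inner hg)

theorem rin_I_smul_sq_add (a b : E) :
    rin a (Complex.I • b) ^ 2 + rin a b ^ 2 ≤ ‖a‖ ^ 2 * ‖b‖ ^ 2 := by
  have h1 : rin a (Complex.I • b) = -(inner ℂ a b).im := by simp [rin]
  have h3 := norm_inner_le_norm (𝕜 := ℂ) a b
  have h4 : ‖inner ℂ a b‖ ^ 2 = (inner ℂ a b).re ^ 2 + (inner ℂ a b).im ^ 2 := by
    rw [← Complex.normSq_eq_norm_sq, Complex.normSq_apply]; ring
  rw [h1, rin]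
  calc _ = ‖inner ℂ a b‖ ^ 2 := by rw [h4]; ring
    _ ≤ (‖a‖ * ‖b‖) ^ 2 := by gcongr
    _ = _ := by ring

/-- The squared norm of a holomorphic family. -/
noncomputable def normSq (H : HolFamily E) : Jet where
  v x t := ‖H.h x t‖ ^ 2
  vx x t := 2 * rin (H.h x t) (Complex.I • H.h1 x t)
  vt x t := -2 * rin (H.h x t) (H.h1 x t)
  vxx x t := 2 * ‖H.h1 x t‖ ^ 2 - 2 * rin (H.h x t) (H.h2 x t)
  vtt x t := 2 * ‖H.h1 x t‖ ^ 2 + 2 * rin (H.h x t) (H.h2 x t)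
  hx x t h := by
    simp only [← rin_self]
    refine (hasDerivAt_rin (H.hx x t h) (H.hx x t h)).congr_deriv ?_
    rw [rin_comm (Complex.I • _)]; ring
  ht x t h := by
    simp only [← rin_self]
    refine (hasDerivAt_rin (H.ht x t h) (H.ht x t h)).congr_deriv ?_
    rw [rin_neg_left, rin_neg_right, rin_comm (H.h1 x t)]; ring
  hxx x t h := by
    refine ((hasDerivAt_rin (H.hx x t h)
      ((H.h1x x t h).const_smul Complex.I)).const_mul 2).congr_deriv ?_
    rw [Pi.smul_apply, rin_I_smul_I_smul, rin_self, smul_smul, Complex.I_mul_I, neg_one_smul, rin_neg_right]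
    ring
  htt x t h := by
    refine ((hasDerivAt_rin (H.ht x t h) (H.h1t x t h)).const_mul (-2)).congr_deriv ?_
    rw [rin_neg_left, rin_neg_right, rin_self]
    ring
  cv := ContinuousOn.fun_pow H.ch.norm 2
  cvx := continuousOn_const.mul (continuousOn_rin H.ch (H.ch1.const_smul _))
  cvt := continuousOn_const.mul (continuousOn_rin H.ch H.ch1)
  cvxx := ContinuousOn.sub (continuousOn_const.mul (ContinuousOn.fun_pow H.ch1.norm 2))
    (continuousOn_const.mul (continuousOn_rin H.ch H.ch2))
  cvtt := ContinuousOn.fun_add (continuousOn_const.mul (ContinuousOn.fun_pow H.ch1.norm 2))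
    (continuousOn_const.mul (continuousOn_rin H.ch H.ch2))
  per t h := by rw [H.per t h]
  perx t h := by rw [H.per t h, H.per1 t h]

theorem psh_normSq (H : HolFamily E) : H.normSq.Psh (fun x t => ‖H.h1 x t‖ ^ 2) where
  nonneg x t _ := by simp only [normSq]; positivity
  dnonneg x t _ := by positivity
  lap_eq x t _ := by simp only [Jet.lap, normSq]; ring
  grad_le x t _ := by
    have := rin_I_smul_sq_add (H.h x t) (H.h1 x t)
    simp only [Jet.grad2, normSq]
    linarith

end HolFamily

theorem Real.add_rpow_le_two_rpow_mul {a b r : ℝ} (ha : 0 ≤ a) (hb : 0 ≤ b) (hr : 0 < r) :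
    (a + b) ^ r ≤ 2 ^ r * (a ^ r + b ^ r) := by
  rcases le_total a b with h | h
  · calc (a + b) ^ r ≤ (2 * b) ^ r := by gcongr; linarith
      _ = 2 ^ r * b ^ r := Real.mul_rpow (by norm_num) hb
      _ ≤ _ := by gcongr; linarith [Real.rpow_nonneg ha r]
  · calc (a + b) ^ r ≤ (2 * a) ^ r := by gcongr; linarith
      _ = 2 ^ r * a ^ r := Real.mul_rpow (by norm_num) ha
      _ ≤ _ := by gcongr; linarith [Real.rpow_nonneg hb r]

theorem intervalIntegral_mul_sub_mul {f g : ℝ → ℝ} (hf : Continuous f) (hg : Continuous g)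
    (a b u v : ℝ) : ∫ x in u..v, (a * f x - b * g x) =
      a * (∫ x in u..v, f x) - b * ∫ x in u..v, g x := by
  rw [intervalIntegral.integral_sub ((hf.intervalIntegrable _ _).const_mul a)
    ((hg.intervalIntegrable _ _).const_mul b), intervalIntegral.integral_const_mul,
    intervalIntegral.integral_const_mul]

namespace Jet

/-- `J.v x t` tends to `L` as `t → ∞`, uniformly in `x`. -/
def Lim (J : Jet) (L : ℝ) : Prop :=
  Filter.Tendsto (fun q : ℝ × ℝ => J.v q.2 q.1) (Filter.atTop ×ˢ ⊤) (nhds L)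

theorem integral_ge_of_lim (J : Jet)
    (hlap : ∀ t, 0 < t → 0 ≤ ∫ x in (0 : ℝ)..2 * Real.pi, J.lap x t) {L : ℝ}
    (hL : J.Lim L) {t : ℝ} (ht : 0 < t) :
    2 * Real.pi * L ≤ ∫ x in (0 : ℝ)..2 * Real.pi, J.v x t :=
  J.integral_ge_of_tendsto hlap (tendsto_prod_top_iff.1 hL) ht

/-- Abstract one-sided comparison: if the weighted means of `dY` are dominated by those of `dX`,
then the means of `Y ^ r` are dominated by those of `X ^ r`. -/
theorem integral_rpow_le_of_weighted {r C : ℝ} (hr : 0 < r) (hC : 0 ≤ C) :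
    ∃ C', 0 ≤ C' ∧ ∀ (X Y : Jet) (dX dY : ℝ → ℝ → ℝ), X.Psh dX → Y.Psh dY → X.Lim 0 → Y.Lim 0 →
      (∀ η, 0 < η → ∀ t, 0 < t →
        ∫ x in (0 : ℝ)..2 * Real.pi, (η + (X.v x t + Y.v x t)) ^ (r - 1) * dY x t ≤
        C * ∫ x in (0 : ℝ)..2 * Real.pi, (η + (X.v x t + Y.v x t)) ^ (r - 1) * dX x t) →
      ∀ t, 0 < t → ∫ x in (0 : ℝ)..2 * Real.pi, Y.v x t ^ r ≤
        C' * ∫ x in (0 : ℝ)..2 * Real.pi, X.v x t ^ r := by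
  set K : ℝ := 2 ^ r + 1 with hK
  set m : ℝ := min r (r ^ 2) with hm
  set M : ℝ := max r (r ^ 2) with hM
  have hm0 : 0 < m := lt_min hr (by positivity)
  have hM0 : 0 < M := lt_max_of_lt_left hr
  have hμ : 0 < min 1 r := lt_min one_pos hr
  obtain ⟨Λ, hΛ1, hΛ⟩ : ∃ Λ : ℝ, 1 ≤ Λ ∧ K * M * (1 + C) ≤ m * Λ ^ (min 1 r) := by
    have h1 := (tendsto_rpow_atTop hμ).const_mul_atTop hm0
    obtain ⟨Λ, h2, h3⟩ := ((Filter.eventually_ge_atTop 1).and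
      (h1.eventually_ge_atTop (K * M * (1 + C)))).exists
    exact ⟨Λ, h2, h3⟩
  have hΛ0 : 0 < Λ := by linarith
  refine ⟨2 ^ r * Λ ^ r, by positivity, fun X Y dX dY hX hY lX lY hw t ht => ?_⟩
  have hπ := Real.pi_pos
  have key : ∀ η : ℝ, 0 < η → ∫ x in (0 : ℝ)..2 * Real.pi, Y.v x t ^ r ≤
      2 ^ r * Λ ^ r * (∫ x in (0 : ℝ)..2 * Real.pi, X.v x t ^ r) + 2 * Real.pi * 2 ^ r * η ^ r := by
    intro η hη
    let S : Jet := (Jet.const η).add (X.add Y)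
    let T : Jet := (Jet.const η).add ((Jet.smul Λ X).add Y)
    have pS : S.Psh _ := (Psh.const hη.le).add (hX.add hY)
    have pT : T.Psh _ := (Psh.const hη.le).add ((hX.smul hΛ0.le).add hY)
    have S0 : ∀ x t, 0 < t → 0 < S.v x t := fun x t h => by
      have := hX.nonneg x t h; have := hY.nonneg x t h
      simp only [S, Jet.add, Jet.const]; positivity
    have T0 : ∀ x t, 0 < t → 0 < T.v x t := fun x t h => by
      have := hX.nonneg x t h; have := hY.nonneg x t h
      simp only [T, Jet.add, Jet.const, Jet.smul]; positivity
    let V : Jet := (T.rpow T0 r).add (Jet.smul (-K) (S.rpow S0 r))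
    have hdX : ∀ t, 0 < t → Continuous fun x => dX x t := fun t h => by
      have : (fun x => dX x t) = fun x => X.lap x t / 4 := by
        ext x; rw [hX.lap_eq x t h]; ring
      rw [this]; exact (X.lap_continuous h).div_const 4
    have hdY : ∀ t, 0 < t → Continuous fun x => dY x t := fun t h => by
      have : (fun x => dY x t) = fun x => Y.lap x t / 4 := by
        ext x; rw [hY.lap_eq x t h]; ring
      rw [this]; exact (Y.lap_continuous h).div_const 4
    have cSr : ∀ t, 0 < t → Continuous fun x => S.v x t ^ (r - 1) := fun t h =>
      (continuous_slice S.cv h).rpow_const fun x => Or.inl (S0 x t h).ne'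
    have hlap : ∀ t, 0 < t → 0 ≤ ∫ x in (0 : ℝ)..2 * Real.pi, V.lap x t := by
      intro t h
      have hpt : ∀ x, 4 * (K * M * C) * (S.v x t ^ (r - 1) * dX x t) -
          4 * (K * M) * (S.v x t ^ (r - 1) * dY x t) ≤ V.lap x t := by
        intro x
        have a1 := pT.lap_rpow_ge T0 hr (x := x) h
        have a2 := pS.lap_rpow_le S0 hr (x := x) h
        have x0 := hX.nonneg x t h
        have y0 := hY.nonneg x t h
        have dx0 := hX.dnonneg x t h
        have dy0 := hY.dnonneg x t h
        have sp := S0 x t h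
        have tp := T0 x t h
        have st : S.v x t ≤ T.v x t := by
          simp only [S, T, Jet.add, Jet.const, Jet.smul]; nlinarith
        have ts : T.v x t ≤ Λ * S.v x t := by
          simp only [S, T, Jet.add, Jet.const, Jet.smul]; nlinarith
        have hrel : Λ ^ (min 1 r) * S.v x t ^ (r - 1) ≤ T.v x t ^ (r - 1) * Λ := by
          rcases le_total 1 r with h1 | h1
          · rw [min_eq_left h1, Real.rpow_one, mul_comm]
            gcongr
          · rw [min_eq_right h1]
            calc Λ ^ r * S.v x t ^ (r - 1) = (Λ * S.v x t) ^ (r - 1) * Λ := by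
                  rw [Real.mul_rpow hΛ0.le sp.le, mul_right_comm, ← Real.rpow_add_one hΛ0.ne',
                    sub_add_cancel]
              _ ≤ T.v x t ^ (r - 1) * Λ := by
                  refine mul_le_mul_of_nonneg_right ?_ hΛ0.le
                  exact Real.rpow_le_rpow_of_nonpos tp ts (by linarith)
        simp only [V, lap_add, lap_smul]
        have sr0 : 0 < S.v x t ^ (r - 1) := by positivity
        have tr0 : 0 < T.v x t ^ (r - 1) := by positivity
        have b1 : 4 * (m * Λ ^ (min 1 r)) * (S.v x t ^ (r - 1) * dX x t) ≤
            4 * m * T.v x t ^ (r - 1) * (0 + (Λ * dX x t + dY x t)) := by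
          have : (Λ ^ (min 1 r) * S.v x t ^ (r - 1)) * (4 * m * dX x t) ≤
            (T.v x t ^ (r - 1) * Λ) * (4 * m * dX x t) := by gcongr
          have : 0 ≤ 4 * m * T.v x t ^ (r - 1) * dY x t := by positivity
          linarith
        have b2 : (K * M * (1 + C)) * (S.v x t ^ (r - 1) * dX x t) ≤
            (m * Λ ^ (min 1 r)) * (S.v x t ^ (r - 1) * dX x t) := by gcongr
        have b3 := mul_le_mul_of_nonneg_left a2 (show 0 ≤ K by positivity)
        linarith
      have hi : ∀ f : ℝ → ℝ, Continuous f → IntervalIntegrable f volume 0 (2 * Real.pi) :=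
        fun f hf => hf.intervalIntegrable _ _
      have h3 : 0 ≤ ∫ x in (0 : ℝ)..2 * Real.pi,
          (4 * (K * M * C) * (S.v x t ^ (r - 1) * dX x t) -
            4 * (K * M) * (S.v x t ^ (r - 1) * dY x t)) := by
        have c1 : Continuous fun x => S.v x t ^ (r - 1) * dX x t := (cSr t h).mul (hdX t h)
        have c2 : Continuous fun x => S.v x t ^ (r - 1) * dY x t := (cSr t h).mul (hdY t h)
        rw [intervalIntegral_mul_sub_mul c1 c2]
        have h4 := mul_le_mul_of_nonneg_left (hw η hη t h) (show 0 ≤ 4 * (K * M) by positivity)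
        simp only [S, Jet.add, Jet.const]
        linarith
      refine h3.trans (intervalIntegral.integral_mono_on (by positivity)
        (hi _ ((continuous_const.mul ((cSr t h).mul (hdX t h))).sub
          (continuous_const.mul ((cSr t h).mul (hdY t h))))) (hi _ (V.lap_continuous h))
        fun x _ => hpt x)
    have hlim : V.Lim ((1 - K) * η ^ r) := by
      have e : ∀ q : ℝ × ℝ, V.v q.2 q.1 = (η + (Λ * X.v q.2 q.1 + Y.v q.2 q.1)) ^ r +
        (-K) * (η + (X.v q.2 q.1 + Y.v q.2 q.1)) ^ r := fun q => rfl
      have l1 : Filter.Tendsto (fun q : ℝ × ℝ => (η + (Λ * X.v q.2 q.1 + Y.v q.2 q.1)) ^ r +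
        (-K) * (η + (X.v q.2 q.1 + Y.v q.2 q.1)) ^ r) (Filter.atTop ×ˢ ⊤)
          (nhds ((η + (Λ * 0 + 0)) ^ r + (-K) * (η + (0 + 0)) ^ r)) := by
        refine Filter.Tendsto.add ?_ (Filter.Tendsto.const_mul _ ?_)
        · exact (tendsto_const_nhds.add ((lX.const_mul _).add lY)).rpow_const (Or.inr hr.le)
        · exact (tendsto_const_nhds.add (lX.add lY)).rpow_const (Or.inr hr.le)
      unfold Lim
      simp only [e]
      convert l1 using 2
      simp only [mul_zero, add_zero]; ring
    have hV := V.integral_ge_of_lim hlap hlim ht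
    have cX : Continuous fun x => X.v x t ^ r :=
      (continuous_slice X.cv ht).rpow_const fun x => Or.inr hr.le
    have cY : Continuous fun x => Y.v x t ^ r :=
      (continuous_slice Y.cv ht).rpow_const fun x => Or.inr hr.le
    have hVle : ∫ x in (0 : ℝ)..2 * Real.pi, V.v x t ≤
        ∫ x in (0 : ℝ)..2 * Real.pi, (2 ^ r * Λ ^ r * X.v x t ^ r - 1 * Y.v x t ^ r) := by
      refine intervalIntegral.integral_mono_on (by positivity)
        ((continuous_slice V.cv ht).intervalIntegrable _ _)
        (((continuous_const.mul cX).sub (continuous_const.mul cY)).intervalIntegrable _ _) fun x _ => ?_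
      have x0 := hX.nonneg x t ht
      have y0 := hY.nonneg x t ht
      have e : V.v x t = (η + (Λ * X.v x t + Y.v x t)) ^ r +
        (-K) * (η + (X.v x t + Y.v x t)) ^ r := rfl
      rw [e]
      have i1 : (η + (Λ * X.v x t + Y.v x t)) ^ r ≤
          2 ^ r * ((Λ * X.v x t) ^ r + (η + Y.v x t) ^ r) := by
        rw [show η + (Λ * X.v x t + Y.v x t) = Λ * X.v x t + (η + Y.v x t) by ring]
        exact Real.add_rpow_le_two_rpow_mul (by positivity) (by positivity) hr
      rw [Real.mul_rpow hΛ0.le x0] at i1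
      have i2 : (η + Y.v x t) ^ r ≤ (η + (X.v x t + Y.v x t)) ^ r := by gcongr; linarith
      have i3 : Y.v x t ^ r ≤ (η + (X.v x t + Y.v x t)) ^ r := by gcongr; linarith
      have i4 := mul_le_mul_of_nonneg_left i2 (show (0 : ℝ) ≤ 2 ^ r by positivity)
      rw [hK]
      linarith
    rw [intervalIntegral_mul_sub_mul cX cY] at hVle
    have e : 2 * Real.pi * ((1 - K) * η ^ r) = -(2 * Real.pi * 2 ^ r * η ^ r) := by rw [hK]; ring
    rw [e] at hV
    linarith
  have hl : Filter.Tendsto (fun η : ℝ => 2 ^ r * Λ ^ r *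
      (∫ x in (0 : ℝ)..2 * Real.pi, X.v x t ^ r) + 2 * Real.pi * 2 ^ r * η ^ r)
      (nhdsWithin 0 (Set.Ioi 0)) (nhds (2 ^ r * Λ ^ r *
      (∫ x in (0 : ℝ)..2 * Real.pi, X.v x t ^ r) + 2 * Real.pi * 2 ^ r * 0 ^ r)) := by
    refine Filter.Tendsto.const_add _ (Filter.Tendsto.const_mul _ ?_)
    exact (Real.continuousAt_rpow_const _ _ (Or.inr hr.le)).tendsto.mono_left nhdsWithin_le_nhds
  rw [Real.zero_rpow hr.ne', mul_zero, add_zero] at hl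
  exact ge_of_tendsto hl (eventually_mem_nhdsWithin.mono key)

theorem weighted_pointwise_lower {r S d D x X m ε : ℝ} (hS : 0 < S) (hd : 0 ≤ d)
    (hD : 0 ≤ D) (hx : x ^ 2 ≤ 4 * S * d) (hX : X ^ 2 ≤ 4 * S * D) (hm : m = min 1 r)
    (hε : 0 < ε) (hε1 : |1 - r| * ε ≤ m / 2) :
    S * (2 * m * d - (1 + |1 - r| / ε) * D) ≤ S * (4 * d - D) + (r - 1) * (X + x) * x := by
  have hc : (1 - r) * (X * x) ≤ |1 - r| * (ε * x ^ 2 + X ^ 2 / (4 * ε)) := by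
    have h1 : |X * x| ≤ ε * x ^ 2 + X ^ 2 / (4 * ε) := by
      have e : ε * x ^ 2 + X ^ 2 / (4 * ε) - |X * x| = (2 * ε * |x| - |X|) ^ 2 / (4 * ε) := by
        rw [abs_mul, ← sq_abs x, ← sq_abs X]; field_simp; ring
      have : 0 ≤ (2 * ε * |x| - |X|) ^ 2 / (4 * ε) := by positivity
      linarith
    calc (1 - r) * (X * x) ≤ |(1 - r) * (X * x)| := le_abs_self _
      _ = |1 - r| * |X * x| := abs_mul _ _
      _ ≤ _ := by gcongr
  have h2 : (1 - r) * x ^ 2 ≤ (1 - m) * (4 * S * d) := by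
    have hm1 : 0 ≤ 1 - m := by rw [hm]; linarith [min_le_left 1 r]
    have : 1 - r ≤ 1 - m := by rw [hm]; linarith [min_le_right 1 r]
    nlinarith [sq_nonneg x]
  have h3 : |1 - r| * (ε * x ^ 2) ≤ m / 2 * (4 * S * d) := by
    have : 0 ≤ |1 - r| * ε := by positivity
    nlinarith [sq_nonneg x, mul_nonneg hS.le hd]
  have h4 : |1 - r| * (X ^ 2 / (4 * ε)) ≤ |1 - r| / ε * (S * D) := by
    have : X ^ 2 / (4 * ε) ≤ (4 * S * D) / (4 * ε) := by gcongr
    calc _ ≤ |1 - r| * ((4 * S * D) / (4 * ε)) := by gcongr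
      _ = _ := by field_simp
  nlinarith

theorem weighted_pointwise_upper {r S d D x X ε : ℝ} (hS : 0 < S) (hd : 0 ≤ d)
    (hD : 0 ≤ D) (hx : x ^ 2 ≤ 4 * S * d) (hX : X ^ 2 ≤ 4 * S * D)
    (hε : 0 < ε) (hε1 : |r - 1| * (4 * ε) ≤ 1 / 2) :
    S * (4 * d - D) + (r - 1) * (X + x) * x ≤
      S * ((4 + |r - 1| * (4 + 1 / ε)) * d - D / 2) := by
  have hc : (r - 1) * ((X + x) * x) ≤ |r - 1| * ((1 + 1 / (4 * ε)) * x ^ 2 + ε * X ^ 2) := by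
    have h1 : |X * x| ≤ x ^ 2 / (4 * ε) + ε * X ^ 2 := by
      have e : x ^ 2 / (4 * ε) + ε * X ^ 2 - |X * x| = (2 * ε * |X| - |x|) ^ 2 / (4 * ε) := by
        rw [abs_mul, ← sq_abs x, ← sq_abs X]; field_simp; ring
      have : 0 ≤ (2 * ε * |X| - |x|) ^ 2 / (4 * ε) := by positivity
      linarith
    have h2 : |(X + x) * x| ≤ (1 + 1 / (4 * ε)) * x ^ 2 + ε * X ^ 2 := by
      calc |(X + x) * x| = |X * x + x ^ 2| := by ring_nf
        _ ≤ |X * x| + |x ^ 2| := abs_add_le _ _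
        _ ≤ x ^ 2 / (4 * ε) + ε * X ^ 2 + x ^ 2 := by
          rw [abs_of_nonneg (sq_nonneg x)]; gcongr
        _ = _ := by ring
    calc _ ≤ |(r - 1) * ((X + x) * x)| := le_abs_self _
      _ = |r - 1| * |(X + x) * x| := abs_mul _ _
      _ ≤ _ := by gcongr
  have h3 : |r - 1| * ((1 + 1 / (4 * ε)) * x ^ 2) ≤ |r - 1| * (4 + 1 / ε) * (S * d) := by
    calc _ ≤ |r - 1| * ((1 + 1 / (4 * ε)) * (4 * S * d)) := by gcongr
      _ = _ := by field_simp
  have h4 : |r - 1| * (ε * X ^ 2) ≤ 1 / 2 * (S * D) := by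
    calc _ ≤ |r - 1| * (ε * (4 * S * D)) := by gcongr
      _ = (|r - 1| * (4 * ε)) * (S * D) := by ring
      _ ≤ _ := by gcongr
  nlinarith

/-- The Littlewood–Paley comparison, in the form of a two-sided bound between the means of
`u ^ r` and of `U ^ r` when `∂²u/∂t²` is the density of `U`. -/
theorem integral_rpow_comparable {r : ℝ} (hr : 0 < r) :
    ∃ C, 0 ≤ C ∧ ∀ (U u : Jet) (D d : ℝ → ℝ → ℝ), U.Psh D → u.Psh d → U.Lim 0 → u.Lim 0 →
      (∀ x t, 0 < t → u.vtt x t = D x t) →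
      ∀ t, 0 < t →
        (∫ x in (0 : ℝ)..2 * Real.pi, u.v x t ^ r ≤
          C * ∫ x in (0 : ℝ)..2 * Real.pi, U.v x t ^ r) ∧
        (∫ x in (0 : ℝ)..2 * Real.pi, U.v x t ^ r ≤
          C * ∫ x in (0 : ℝ)..2 * Real.pi, u.v x t ^ r) := by
  set m : ℝ := min 1 r with hm
  have hm0 : 0 < m := lt_min one_pos hr
  set ε₁ : ℝ := m / (2 * (|1 - r| + 1)) with hε₁
  set ε₂ : ℝ := 1 / (8 * (|r - 1| + 1)) with hε₂
  have e1 : 0 < ε₁ := by positivity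
  have e2 : 0 < ε₂ := by positivity
  have e1' : |1 - r| * ε₁ ≤ m / 2 := by
    rw [hε₁, mul_div_assoc', div_le_div_iff₀ (by positivity) (by positivity)]
    nlinarith [abs_nonneg (1 - r)]
  have e2' : |r - 1| * (4 * ε₂) ≤ 1 / 2 := by
    rw [hε₂, mul_one_div, mul_div_assoc', div_le_div_iff₀ (by positivity) (by positivity)]
    nlinarith [abs_nonneg (r - 1)]
  set C1 : ℝ := 1 + |1 - r| / ε₁
  set C2 : ℝ := 4 + |r - 1| * (4 + 1 / ε₂)
  have hC1 : 0 ≤ C1 := by positivity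
  have hC2 : 0 ≤ C2 := by positivity
  obtain ⟨A, hA0, hA⟩ := integral_rpow_le_of_weighted (r := r) (C := C1 / (2 * m)) hr
    (by positivity)
  obtain ⟨B, hB0, hB⟩ := integral_rpow_le_of_weighted (r := r) (C := 2 * C2) hr (by positivity)
  refine ⟨max A B, hA0.trans (le_max_left _ _), fun U u D d hU hu lU lu hrel t ht => ?_⟩
  have hπ := Real.pi_pos
  have key : ∀ η : ℝ, 0 < η → ∀ t, 0 < t →
      (2 * m * ∫ x in (0 : ℝ)..2 * Real.pi, (η + (U.v x t + u.v x t)) ^ (r - 1) * d x t ≤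
        C1 * ∫ x in (0 : ℝ)..2 * Real.pi, (η + (U.v x t + u.v x t)) ^ (r - 1) * D x t) ∧
      (∫ x in (0 : ℝ)..2 * Real.pi, (η + (U.v x t + u.v x t)) ^ (r - 1) * D x t ≤
        2 * C2 * ∫ x in (0 : ℝ)..2 * Real.pi, (η + (U.v x t + u.v x t)) ^ (r - 1) * d x t) := by
    intro η hη t h
    let S : Jet := (Jet.const η).add (U.add u)
    have S0 : ∀ x t, 0 < t → 0 < S.v x t := fun x t h => by
      have := hU.nonneg x t h; have := hu.nonneg x t h
      simp only [S, Jet.add, Jet.const]; positivity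
    have hdD : Continuous fun x => D x t := by
      have : (fun x => D x t) = fun x => U.lap x t / 4 := by
        ext x; rw [hU.lap_eq x t h]; ring
      rw [this]; exact (U.lap_continuous h).div_const 4
    have hdd : Continuous fun x => d x t := by
      have : (fun x => d x t) = fun x => u.lap x t / 4 := by
        ext x; rw [hu.lap_eq x t h]; ring
      rw [this]; exact (u.lap_continuous h).div_const 4
    have cS : ∀ p : ℝ, Continuous fun x => S.v x t ^ p := fun p =>
      (continuous_slice S.cv h).rpow_const fun x => Or.inl (S0 x t h).ne'
    let G : ℝ → ℝ := fun x => S.v x t ^ (r - 1) * (4 * d x t - D x t) +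
      (r - 1) * S.v x t ^ (r - 2) * S.vx x t * u.vx x t
    have cG : Continuous G := ((cS _).mul ((continuous_const.mul hdd).sub hdD)).add
      (((continuous_const.mul (cS _)).mul (continuous_slice S.cvx h)).mul
        (continuous_slice u.cvx h))
    have hG : ∫ x in (0 : ℝ)..2 * Real.pi, G x = 0 := by
      have hd : ∀ x, HasDerivAt (fun y => S.v y t ^ (r - 1) * u.vx y t) (G x) x := by
        intro x
        have a := ((S.hx x t h).rpow_const (p := r - 1) (Or.inl (S0 x t h).ne')).mul (u.hxx x t h)
        refine a.congr_deriv ?_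
        have e : u.vxx x t = 4 * d x t - D x t := by
          have := hu.lap_eq x t h
          rw [lap, hrel x t h] at this
          linarith
        rw [e, show r - 1 - 1 = r - 2 by ring]
        simp only [G]
        ring
      rw [intervalIntegral.integral_eq_sub_of_hasDerivAt (fun x _ => hd x)
        (cG.intervalIntegrable _ _), S.per t h, u.perx t h, sub_self]
    have hpt : ∀ x, (2 * m) * (S.v x t ^ (r - 1) * d x t) - C1 * (S.v x t ^ (r - 1) * D x t) ≤
        G x ∧ G x ≤ C2 * (S.v x t ^ (r - 1) * d x t) - 1 / 2 * (S.v x t ^ (r - 1) * D x t) := by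
      intro x
      have sp := S0 x t h
      have d0 := hu.dnonneg x t h
      have D0 := hU.dnonneg x t h
      have u0 := hu.nonneg x t h
      have U0 := hU.nonneg x t h
      have sU : U.v x t ≤ S.v x t := by simp only [S, Jet.add, Jet.const]; linarith
      have su : u.v x t ≤ S.v x t := by simp only [S, Jet.add, Jet.const]; linarith
      have gx : u.vx x t ^ 2 ≤ 4 * S.v x t * d x t := by
        have := hu.grad_le x t h
        simp only [grad2] at this
        have : 4 * u.v x t * d x t ≤ 4 * S.v x t * d x t := by gcongr
        nlinarith [sq_nonneg (u.vt x t)]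
      have gX : U.vx x t ^ 2 ≤ 4 * S.v x t * D x t := by
        have := hU.grad_le x t h
        simp only [grad2] at this
        have : 4 * U.v x t * D x t ≤ 4 * S.v x t * D x t := by gcongr
        nlinarith [sq_nonneg (U.vt x t)]
      have p0 : 0 ≤ S.v x t ^ (r - 2) := by positivity
      have l := mul_le_mul_of_nonneg_left
        (weighted_pointwise_lower sp d0 D0 gx gX hm e1 e1') p0
      have l2 := mul_le_mul_of_nonneg_left
        (weighted_pointwise_upper (r := r) sp d0 D0 gx gX e2 e2') p0
      have eS : S.vx x t = U.vx x t + u.vx x t := by simp [S, Jet.add, Jet.const]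
      simp only [G, ← rpow_sub_two_mul sp r, eS]
      constructor
      · linarith
      · linarith
    have hi : ∀ f : ℝ → ℝ, Continuous f → IntervalIntegrable f volume 0 (2 * Real.pi) :=
      fun f hf => hf.intervalIntegrable _ _
    have c1 : Continuous fun x => S.v x t ^ (r - 1) * d x t := (cS _).mul hdd
    have c2 : Continuous fun x => S.v x t ^ (r - 1) * D x t := (cS _).mul hdD
    have i1 := intervalIntegral.integral_mono_on (show (0 : ℝ) ≤ 2 * Real.pi by positivity)
      (hi _ ((continuous_const.mul c1).sub (continuous_const.mul c2))) (hi _ cG)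
      fun x _ => (hpt x).1
    have i2 := intervalIntegral.integral_mono_on (show (0 : ℝ) ≤ 2 * Real.pi by positivity)
      (hi _ cG) (hi _ ((continuous_const.mul c1).sub (continuous_const.mul c2)))
      fun x _ => (hpt x).2
    rw [hG] at i1 i2
    erw [intervalIntegral_mul_sub_mul c1 c2] at i1 i2
    simp only [S, Jet.add, Jet.const] at i1 i2
    constructor <;> linarith
  have posU : 0 ≤ ∫ x in (0 : ℝ)..2 * Real.pi, U.v x t ^ r :=
    intervalIntegral.integral_nonneg (by positivity)
      fun x _ => Real.rpow_nonneg (hU.nonneg x t ht) _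
  have posu : 0 ≤ ∫ x in (0 : ℝ)..2 * Real.pi, u.v x t ^ r :=
    intervalIntegral.integral_nonneg (by positivity)
      fun x _ => Real.rpow_nonneg (hu.nonneg x t ht) _
  constructor
  · refine (hA U u D d hU hu lU lu (fun η hη t h => ?_) t ht).trans
      (mul_le_mul_of_nonneg_right (le_max_left _ _) posU)
    have := (key η hη t h).1
    rw [div_mul_eq_mul_div, le_div_iff₀ (by positivity)]
    linarith
  · refine (hB u U d D hu hU lu lU (fun η hη t h => ?_) t ht).trans
      (mul_le_mul_of_nonneg_right (le_max_right _ _) posu)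
    simp only [add_comm (u.v _ t)]
    exact (key η hη t h).2

end Jet

theorem Real.add_add_rpow_le_three_rpow_mul {a b c r : ℝ} (ha : 0 ≤ a) (hb : 0 ≤ b) (hc : 0 ≤ c)
    (hr : 0 < r) : (a + b + c) ^ r ≤ 3 ^ r * (a ^ r + b ^ r + c ^ r) := by
  have hm : a + b + c ≤ 3 * max (max a b) c := by
    have := le_max_left a b
    have := le_max_right a b
    have := le_max_left (max a b) c
    have := le_max_right (max a b) c
    linarith
  have a0 := Real.rpow_nonneg ha r
  have b0 := Real.rpow_nonneg hb r
  have c0 := Real.rpow_nonneg hc r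
  calc (a + b + c) ^ r ≤ (3 * max (max a b) c) ^ r := by gcongr
    _ = 3 ^ r * (max (max a b) c) ^ r := Real.mul_rpow (by norm_num) (le_max_of_le_right hc)
    _ ≤ _ := by
      gcongr
      rcases max_choice (max a b) c with h | h <;> rw [h]
      · rcases max_choice a b with h | h <;> rw [h] <;> linarith
      · linarith

theorem Real.rpow_eq_rpow_rpow_div {s a : ℝ} (hs : 0 < s) (ha : a ≠ 0) (e : ℝ) :
    s ^ e = (s ^ a) ^ (e / a) := by
  rw [← Real.rpow_mul hs.le]; congr 1; field_simp

namespace Jet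

theorem bellman_lower {SA SB SG P : Jet} {dA dB dG : ℝ → ℝ → ℝ} {a b c M Λ m x t : ℝ}
    (pA : SA.Psh dA) (pB : SB.Psh dB) (pG : SG.Psh dG)
    (A0 : ∀ x t, 0 < t → 0 < SA.v x t) (B0 : ∀ x t, 0 < t → 0 < SB.v x t)
    (G0 : ∀ x t, 0 < t → 0 < SG.v x t) (ha : 0 < a) (hb : 0 < b) (hc : 0 < c)
    (hM1 : 1 ≤ M) (hMa : a ≤ M) (hMb : b ≤ M) (hΛ1 : 1 ≤ Λ)
    (P0 : ∀ x t, 0 < t → 0 < P.v x t) (h : 0 < t)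
    (eP : P.v x t = SG.v x t ^ (c / M) + Λ * (SA.v x t ^ (a / M) + SB.v x t ^ (b / M)))
    (eL : P.lap x t = (SG.rpow G0 (c / M)).lap x t +
      Λ * ((SA.rpow A0 (a / M)).lap x t + (SB.rpow B0 (b / M)).lap x t))
    (mA : SA.v x t ^ a ≤ m) (mB : SB.v x t ^ b ≤ m)
    (hm : m = SA.v x t ^ a ∨ m = SB.v x t ^ b ∨ m = SG.v x t ^ c) :
    Λ * (M * (4 * min (min (a / M) ((a / M) ^ 2)) (min (b / M) ((b / M) ^ 2)))) *
      (m ^ (1 - 1 / a) * dA x t + m ^ (1 - 1 / b) * dB x t) ≤ (P.rpow P0 M).lap x t := by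
  have hM0 : 0 < M := by linarith
  have hΛ0 : 0 < Λ := by linarith
  have sa := A0 x t h
  have sb := B0 x t h
  have sg := G0 x t h
  have p0 := P0 x t h
  have da := pA.dnonneg x t h
  have db := pB.dnonneg x t h
  have dg := pG.dnonneg x t h
  have m0 : 0 < m := lt_of_lt_of_le (Real.rpow_pos_of_pos sa _) mA
  have κpos : ∀ r : ℝ, 0 < r → 0 < min r (r ^ 2) := fun r hr => lt_min hr (by positivity)
  have ka := κpos (a / M) (by positivity)
  have kb := κpos (b / M) (by positivity)
  have k00 := lt_min ka kb
  have hgA : 0 < SA.v x t ^ (a / M) := by positivity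
  have hgB : 0 < SB.v x t ^ (b / M) := by positivity
  have hgG : 0 < SG.v x t ^ (c / M) := by positivity
  have epow : ∀ s : ℝ, 0 < s → ∀ e T : ℝ, 0 < T → s ^ e = (s ^ (e / T)) ^ T :=
    fun s hs e T hT => by rw [← Real.rpow_mul hs.le]; congr 1; field_simp
  have mP : m ≤ P.v x t ^ M := by
    rcases hm with hm | hm | hm <;> rw [hm]
    · rw [epow _ sa a M hM0, eP]
      gcongr
      nlinarith
    · rw [epow _ sb b M hM0, eP]
      gcongr
      nlinarith
    · rw [epow _ sg c M hM0, eP]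
      gcongr
      have : 0 < Λ * (SA.v x t ^ (a / M) + SB.v x t ^ (b / M)) := by positivity
      linarith
  have low : ∀ s α : ℝ, 0 < s → 0 < α → α ≤ M → s ^ α ≤ m →
      m ^ (1 - 1 / α) ≤ P.v x t ^ (M - 1) * s ^ (α / M - 1) := by
    intro s α hs hα hαM hsm
    have h1 : m ^ ((M - 1) / M) ≤ P.v x t ^ (M - 1) := by
      rw [Real.rpow_eq_rpow_rpow_div p0 hM0.ne' (M - 1)]
      exact Real.rpow_le_rpow m0.le mP (div_nonneg (by linarith) hM0.le)
    have h2 : m ^ ((α / M - 1) / α) ≤ s ^ (α / M - 1) := by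
      rw [Real.rpow_eq_rpow_rpow_div hs hα.ne' (α / M - 1)]
      refine Real.rpow_le_rpow_of_nonpos (by positivity) hsm ?_
      exact div_nonpos_of_nonpos_of_nonneg
        (by rw [sub_nonpos, div_le_one hM0]; exact hαM) hα.le
    calc m ^ (1 - 1 / α) = m ^ ((M - 1) / M) * m ^ ((α / M - 1) / α) := by
          rw [← Real.rpow_add m0]; congr 1; field_simp; ring
      _ ≤ _ := by gcongr
  set k := min (min (a / M) ((a / M) ^ 2)) (min (b / M) ((b / M) ^ 2)) with hk
  have X0 : 0 ≤ m ^ (1 - 1 / a) * dA x t := by positivity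
  have Y0 : 0 ≤ m ^ (1 - 1 / b) * dB x t := by positivity
  generalize hX : m ^ (1 - 1 / a) * dA x t = X at *
  generalize hY : m ^ (1 - 1 / b) * dB x t = Y at *
  refine le_trans ?_ (P.lap_rpow_ge_of_one_le P0 hM1 h)
  have l1 := pA.lap_rpow_ge A0 (r := a / M) (by positivity) (x := x) h
  have l2 := pB.lap_rpow_ge B0 (r := b / M) (by positivity) (x := x) h
  have l3 := pG.lap_rpow_ge G0 (r := c / M) (by positivity) (x := x) h
  have l3' : 0 ≤ (SG.rpow G0 (c / M)).lap x t := by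
    refine le_trans ?_ l3
    have : 0 < min (c / M) ((c / M) ^ 2) := κpos (c / M) (by positivity)
    positivity
  have b1 := low _ a sa ha hMa mA
  have b2 := low _ b sb hb hMb mB
  have q0 : 0 < P.v x t ^ (M - 1) := by positivity
  have c1 : (M * (4 * k)) * X ≤ M * P.v x t ^ (M - 1) * (SA.rpow A0 (a / M)).lap x t := by
    calc (M * (4 * k)) * X ≤ (M * (4 * min (a / M) ((a / M) ^ 2))) *
        ((P.v x t ^ (M - 1) * SA.v x t ^ (a / M - 1)) * dA x t) := by
          rw [← hX]; gcongr; exact min_le_left _ _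
      _ = M * P.v x t ^ (M - 1) *
        (4 * min (a / M) ((a / M) ^ 2) * SA.v x t ^ (a / M - 1) * dA x t) := by ring
      _ ≤ _ := by gcongr
  have c2 : (M * (4 * k)) * Y ≤ M * P.v x t ^ (M - 1) * (SB.rpow B0 (b / M)).lap x t := by
    calc (M * (4 * k)) * Y ≤ (M * (4 * min (b / M) ((b / M) ^ 2))) *
        ((P.v x t ^ (M - 1) * SB.v x t ^ (b / M - 1)) * dB x t) := by
          rw [← hY]; gcongr; exact min_le_right _ _
      _ = M * P.v x t ^ (M - 1) *
        (4 * min (b / M) ((b / M) ^ 2) * SB.v x t ^ (b / M - 1) * dB x t) := by ring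
      _ ≤ _ := by gcongr
  have c3 : 0 ≤ M * P.v x t ^ (M - 1) * (SG.rpow G0 (c / M)).lap x t := by positivity
  rw [eL]
  have := mul_le_mul_of_nonneg_left (add_le_add c1 c2) hΛ0.le
  linarith

theorem bellman_upper {SA SB SG R : Jet} {dA dB dG : ℝ → ℝ → ℝ} {a b c N m x t : ℝ}
    (pA : SA.Psh dA) (pB : SB.Psh dB) (pG : SG.Psh dG)
    (A0 : ∀ x t, 0 < t → 0 < SA.v x t) (B0 : ∀ x t, 0 < t → 0 < SB.v x t)
    (G0 : ∀ x t, 0 < t → 0 < SG.v x t) (ha : 0 < a) (hb : 0 < b) (hc : 0 < c)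
    (hN0 : 0 < N) (hN1 : N ≤ 1) (hNc : N ≤ c) (hca : c ≤ a) (hcb : c ≤ b)
    (habc : 1 / c = 1 / a + 1 / b)
    (R0 : ∀ x t, 0 < t → 0 < R.v x t) (h : 0 < t)
    (eR : R.v x t = SG.v x t ^ (c / N) + SA.v x t ^ (a / N) + SB.v x t ^ (b / N))
    (eL : R.lap x t = (SG.rpow G0 (c / N)).lap x t + (SA.rpow A0 (a / N)).lap x t +
      (SB.rpow B0 (b / N)).lap x t)
    (mA : SA.v x t ^ a ≤ m) (mB : SB.v x t ^ b ≤ m) (mG : SG.v x t ^ c ≤ m)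
    (hm : m = SA.v x t ^ a ∨ m = SB.v x t ^ b ∨ m = SG.v x t ^ c)
    (hrel : dG x t ≤ SA.v x t * dB x t) :
    (R.rpow R0 N).lap x t ≤ N * (4 * (max (a / N) ((a / N) ^ 2) + max (b / N) ((b / N) ^ 2) +
      max (c / N) ((c / N) ^ 2))) * (m ^ (1 - 1 / a) * dA x t + m ^ (1 - 1 / b) * dB x t) := by
  have sa := A0 x t h
  have sb := B0 x t h
  have sg := G0 x t h
  have r0 := R0 x t h
  have da := pA.dnonneg x t h
  have db := pB.dnonneg x t h
  have dg := pG.dnonneg x t h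
  have m0 : 0 < m := lt_of_lt_of_le (Real.rpow_pos_of_pos sa _) mA
  have K'pos : ∀ r : ℝ, 0 < r → 0 < max r (r ^ 2) := fun r hr => lt_max_of_lt_left hr
  have Ka := K'pos (a / N) (by positivity)
  have Kb := K'pos (b / N) (by positivity)
  have Kc := K'pos (c / N) (by positivity)
  have hrA : 0 < SA.v x t ^ (a / N) := by positivity
  have hrB : 0 < SB.v x t ^ (b / N) := by positivity
  have hrG : 0 < SG.v x t ^ (c / N) := by positivity
  have epow : ∀ s : ℝ, 0 < s → ∀ e T : ℝ, 0 < T → s ^ e = (s ^ (e / T)) ^ T :=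
    fun s hs e T hT => by rw [← Real.rpow_mul hs.le]; congr 1; field_simp
  have mR : m ≤ R.v x t ^ N := by
    rcases hm with hm | hm | hm <;> rw [hm]
    · rw [epow _ sa a N hN0, eR]
      gcongr
      linarith
    · rw [epow _ sb b N hN0, eR]
      gcongr
      linarith
    · rw [epow _ sg c N hN0, eR]
      gcongr
      linarith
  have up : ∀ s α : ℝ, 0 < s → 0 < α → N ≤ α → s ^ α ≤ m →
      R.v x t ^ (N - 1) * s ^ (α / N - 1) ≤ m ^ (1 - 1 / α) := by
    intro s α hs hα hαM hsm
    have h1 : R.v x t ^ (N - 1) ≤ m ^ ((N - 1) / N) := by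
      rw [Real.rpow_eq_rpow_rpow_div r0 hN0.ne' (N - 1)]
      exact Real.rpow_le_rpow_of_nonpos m0 mR
        (div_nonpos_of_nonpos_of_nonneg (by linarith) hN0.le)
    have h2 : s ^ (α / N - 1) ≤ m ^ ((α / N - 1) / α) := by
      rw [Real.rpow_eq_rpow_rpow_div hs hα.ne' (α / N - 1)]
      refine Real.rpow_le_rpow (by positivity) hsm ?_
      exact div_nonneg (by rw [sub_nonneg, one_le_div hN0]; exact hαM) hα.le
    calc _ ≤ m ^ ((N - 1) / N) * m ^ ((α / N - 1) / α) := by gcongr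
      _ = m ^ (1 - 1 / α) := by
          rw [← Real.rpow_add m0]; congr 1; field_simp; ring
  have X0 : 0 ≤ m ^ (1 - 1 / a) * dA x t := by positivity
  have Y0 : 0 ≤ m ^ (1 - 1 / b) * dB x t := by positivity
  generalize hX : m ^ (1 - 1 / a) * dA x t = X at *
  generalize hY : m ^ (1 - 1 / b) * dB x t = Y at *
  refine (R.lap_rpow_le_of_le_one R0 hN0.le hN1 h).trans ?_
  have l1 := pA.lap_rpow_le A0 (r := a / N) (by positivity) (x := x) h
  have l2 := pB.lap_rpow_le B0 (r := b / N) (by positivity) (x := x) h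
  have l3 := pG.lap_rpow_le G0 (r := c / N) (by positivity) (x := x) h
  have b1 := up _ a sa ha (by linarith) mA
  have b2 := up _ b sb hb (by linarith) mB
  have b3 := up _ c sg hc hNc mG
  have q0 : 0 < R.v x t ^ (N - 1) := by positivity
  have c1 : N * R.v x t ^ (N - 1) * (SA.rpow A0 (a / N)).lap x t ≤
      N * (4 * max (a / N) ((a / N) ^ 2)) * X := by
    calc _ ≤ N * R.v x t ^ (N - 1) *
        (4 * max (a / N) ((a / N) ^ 2) * SA.v x t ^ (a / N - 1) * dA x t) := by gcongr
      _ = N * (4 * max (a / N) ((a / N) ^ 2)) *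
        ((R.v x t ^ (N - 1) * SA.v x t ^ (a / N - 1)) * dA x t) := by ring
      _ ≤ _ := by rw [← hX]; gcongr
  have c2 : N * R.v x t ^ (N - 1) * (SB.rpow B0 (b / N)).lap x t ≤
      N * (4 * max (b / N) ((b / N) ^ 2)) * Y := by
    calc _ ≤ N * R.v x t ^ (N - 1) *
        (4 * max (b / N) ((b / N) ^ 2) * SB.v x t ^ (b / N - 1) * dB x t) := by gcongr
      _ = N * (4 * max (b / N) ((b / N) ^ 2)) *
        ((R.v x t ^ (N - 1) * SB.v x t ^ (b / N - 1)) * dB x t) := by ring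
      _ ≤ _ := by rw [← hY]; gcongr
  have dGle : m ^ (1 - 1 / c) * dG x t ≤ Y := by
    have h1 : SA.v x t ≤ m ^ (1 / a) := by
      calc SA.v x t = (SA.v x t ^ a) ^ (1 / a) := by
            rw [← Real.rpow_mul sa.le, mul_one_div_cancel ha.ne', Real.rpow_one]
        _ ≤ _ := by gcongr
    rw [← hY]
    calc m ^ (1 - 1 / c) * dG x t ≤ m ^ (1 - 1 / c) * (SA.v x t * dB x t) := by gcongr
      _ ≤
        m ^ (1 - 1 / c) * (m ^ (1 / a) * dB x t) := by gcongr
      _ = _ := by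
        rw [← mul_assoc, ← Real.rpow_add m0]
        congr 2; rw [habc]; ring
  have c3 : N * R.v x t ^ (N - 1) * (SG.rpow G0 (c / N)).lap x t ≤
      N * (4 * max (c / N) ((c / N) ^ 2)) * Y := by
    calc _ ≤ N * R.v x t ^ (N - 1) *
        (4 * max (c / N) ((c / N) ^ 2) * SG.v x t ^ (c / N - 1) * dG x t) := by gcongr
      _ = N * (4 * max (c / N) ((c / N) ^ 2)) *
        ((R.v x t ^ (N - 1) * SG.v x t ^ (c / N - 1)) * dG x t) := by ring
      _ ≤ N * (4 * max (c / N) ((c / N) ^ 2)) * (m ^ (1 - 1 / c) * dG x t) := by gcongr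
      _ ≤ _ := by gcongr
  rw [eL]
  have z1 : 0 ≤ N * (4 * max (a / N) ((a / N) ^ 2)) * Y := by positivity
  have z2 : 0 ≤ N * (4 * max (b / N) ((b / N) ^ 2)) * X := by positivity
  have z3 : 0 ≤ N * (4 * max (c / N) ((c / N) ^ 2)) * X := by positivity
  linarith

/-- Bellman function estimate: the means of `G ^ c` are controlled by those of `A ^ a` and `B ^ b`,
`1 / c = 1 / a + 1 / b`, when the density of `G` is `A` times that of `B`. -/
theorem integral_rpow_le_add {a b c : ℝ} (ha : 0 < a) (hb : 0 < b) (hc : 0 < c)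
    (habc : 1 / c = 1 / a + 1 / b) :
    ∃ C, 0 ≤ C ∧ ∀ (A B G : Jet) (dA dB dG : ℝ → ℝ → ℝ), A.Psh dA → B.Psh dB → G.Psh dG →
      A.Lim 0 → B.Lim 0 → G.Lim 0 → (∀ x t, 0 < t → dG x t = A.v x t * dB x t) →
      ∀ t, 0 < t → ∫ x in (0 : ℝ)..2 * Real.pi, G.v x t ^ c ≤
        C * ((∫ x in (0 : ℝ)..2 * Real.pi, A.v x t ^ a) +
          ∫ x in (0 : ℝ)..2 * Real.pi, B.v x t ^ b) := by
  have hca : c < a := by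
    refine lt_of_one_div_lt_one_div ha ?_
    rw [habc]; linarith [one_div_pos.2 hb]
  have hcb : c < b := by
    refine lt_of_one_div_lt_one_div hb ?_
    rw [habc]; linarith [one_div_pos.2 ha]
  obtain ⟨M, hM1, hMa, hMb⟩ : ∃ M : ℝ, 1 ≤ M ∧ a ≤ M ∧ b ≤ M :=
    ⟨max 1 (max a b), le_max_left _ _, (le_max_left _ _).trans (le_max_right _ _),
      (le_max_right _ _).trans (le_max_right _ _)⟩
  obtain ⟨N, hN0, hN1, hNc⟩ : ∃ N : ℝ, 0 < N ∧ N ≤ 1 ∧ N ≤ c :=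
    ⟨min 1 c, lt_min one_pos hc, min_le_left _ _, min_le_right _ _⟩
  have hM0 : 0 < M := by linarith
  set κ : ℝ → ℝ := fun r => min r (r ^ 2) with hκ
  set K' : ℝ → ℝ := fun r => max r (r ^ 2) with hK'
  have κpos : ∀ r, 0 < r → 0 < κ r := fun r hr => lt_min hr (by positivity)
  have K'pos : ∀ r, 0 < r → 0 < K' r := fun r hr => lt_max_of_lt_left hr
  have ka := κpos (a / M) (by positivity)
  have kb := κpos (b / M) (by positivity)
  have Ka := K'pos (a / N) (by positivity)
  have Kb := K'pos (b / N) (by positivity)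
  have Kc := K'pos (c / N) (by positivity)
  set k0 : ℝ := M * (4 * min (κ (a / M)) (κ (b / M))) with hk0
  have k00 : 0 < k0 := by have := lt_min ka kb; positivity
  set K1 : ℝ := N * (4 * (K' (a / N) + K' (b / N) + K' (c / N))) with hK1
  set K : ℝ := 3 ^ M + 1 with hK
  have K10 : 0 < K1 := by positivity
  have K0 : 0 < K := by positivity
  obtain ⟨Λ, hΛ1, hΛ⟩ : ∃ Λ : ℝ, 1 ≤ Λ ∧ K * K1 ≤ Λ * k0 :=
    ⟨max 1 (K * K1 / k0), le_max_left _ _, by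
      rw [← div_le_iff₀ k00]; exact le_max_right _ _⟩
  have hΛ0 : 0 < Λ := by linarith
  set C0 : ℝ := 3 ^ M * Λ ^ M * (2 ^ a + 2 ^ b) with hC0
  refine ⟨C0, by positivity, fun A B G dA dB dG hA hB hG lA lB lG hrel t ht => ?_⟩
  have hπ := Real.pi_pos
  have key : ∀ η : ℝ, 0 < η → ∫ x in (0 : ℝ)..2 * Real.pi, G.v x t ^ c ≤
      C0 * ((∫ x in (0 : ℝ)..2 * Real.pi, A.v x t ^ a) +
          ∫ x in (0 : ℝ)..2 * Real.pi, B.v x t ^ b) +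
      2 * Real.pi * (C0 * (η ^ a + η ^ b) + K * (3 ^ N * (η ^ c + η ^ a + η ^ b))) := by
    intro η hη
    let SA : Jet := (Jet.const η).add A
    let SB : Jet := (Jet.const η).add B
    let SG : Jet := (Jet.const η).add G
    have pA : SA.Psh _ := (Psh.const hη.le).add hA
    have pB : SB.Psh _ := (Psh.const hη.le).add hB
    have pG : SG.Psh _ := (Psh.const hη.le).add hG
    have A0 : ∀ x t, 0 < t → 0 < SA.v x t := fun x t h => by
      have := hA.nonneg x t h
      simp only [SA, Jet.add, Jet.const]; positivity
    have B0 : ∀ x t, 0 < t → 0 < SB.v x t := fun x t h => by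
      have := hB.nonneg x t h
      simp only [SB, Jet.add, Jet.const]; positivity
    have G0 : ∀ x t, 0 < t → 0 < SG.v x t := fun x t h => by
      have := hG.nonneg x t h
      simp only [SG, Jet.add, Jet.const]; positivity
    let P : Jet := (SG.rpow G0 (c / M)).add
      (Jet.smul Λ ((SA.rpow A0 (a / M)).add (SB.rpow B0 (b / M))))
    let R : Jet := ((SG.rpow G0 (c / N)).add (SA.rpow A0 (a / N))).add (SB.rpow B0 (b / N))
    have eP : ∀ x t, P.v x t =
      SG.v x t ^ (c / M) + Λ * (SA.v x t ^ (a / M) + SB.v x t ^ (b / M)) := fun _ _ => rfl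
    have eR : ∀ x t, R.v x t =
      SG.v x t ^ (c / N) + SA.v x t ^ (a / N) + SB.v x t ^ (b / N) := fun _ _ => rfl
    have P0 : ∀ x t, 0 < t → 0 < P.v x t := fun x t h => by
      have := A0 x t h; have := B0 x t h; have := G0 x t h
      rw [eP]; positivity
    have R0 : ∀ x t, 0 < t → 0 < R.v x t := fun x t h => by
      have := A0 x t h; have := B0 x t h; have := G0 x t h
      rw [eR]; positivity
    let V : Jet := (P.rpow P0 M).add (Jet.smul (-K) (R.rpow R0 N))
    have eV : ∀ x t, V.v x t =
      (SG.v x t ^ (c / M) + Λ * (SA.v x t ^ (a / M) + SB.v x t ^ (b / M))) ^ M +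
      (-K) * (SG.v x t ^ (c / N) + SA.v x t ^ (a / N) + SB.v x t ^ (b / N)) ^ N := fun _ _ => rfl
    have hlap : ∀ x t, 0 < t → 0 ≤ V.lap x t := by
      intro x t h
      have sa := A0 x t h
      have sb := B0 x t h
      have sg := G0 x t h
      have da := pA.dnonneg x t h
      have db := pB.dnonneg x t h
      obtain ⟨m, mA, mB, mG⟩ : ∃ m : ℝ, SA.v x t ^ a ≤ m ∧ SB.v x t ^ b ≤ m ∧ SG.v x t ^ c ≤ m ∧
          (m = SA.v x t ^ a ∨ m = SB.v x t ^ b ∨ m = SG.v x t ^ c) := by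
        rcases le_total (SA.v x t ^ a) (SB.v x t ^ b) with h1 | h1
        · rcases le_total (SB.v x t ^ b) (SG.v x t ^ c) with h2 | h2
          · exact ⟨_, h1.trans h2, h2, le_rfl, Or.inr (Or.inr rfl)⟩
          · exact ⟨_, h1, le_rfl, h2, Or.inr (Or.inl rfl)⟩
        · rcases le_total (SA.v x t ^ a) (SG.v x t ^ c) with h2 | h2
          · exact ⟨_, h2, h1.trans h2, le_rfl, Or.inr (Or.inr rfl)⟩
          · exact ⟨_, le_rfl, h1, h2, Or.inl rfl⟩
      have hlow := bellman_lower pA pB pG A0 B0 G0 ha hb hc hM1 hMa hMb hΛ1 P0 h (x := x)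
        (eP x t) (by simp only [P, lap_add, lap_smul]) mA mB mG.2
      have hup := bellman_upper pA pB pG A0 B0 G0 ha hb hc hN0 hN1 hNc hca.le hcb.le habc R0 h
        (x := x) (eR x t) (by simp only [R, lap_add]) mA mB mG.1 mG.2 (by
          simp only [zero_add]
          rw [hrel x t h]
          have : A.v x t ≤ SA.v x t := by simp only [SA, Jet.add, Jet.const]; linarith
          exact mul_le_mul_of_nonneg_right this (hB.dnonneg x t h))
      have m0 : 0 < m := lt_of_lt_of_le (Real.rpow_pos_of_pos sa _) mA
      have X0 : 0 ≤ m ^ (1 - 1 / a) * (0 + dA x t) :=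
        mul_nonneg (Real.rpow_nonneg m0.le _) da
      have Y0 : 0 ≤ m ^ (1 - 1 / b) * (0 + dB x t) :=
        mul_nonneg (Real.rpow_nonneg m0.le _) db
      have eV' : V.lap x t = (P.rpow P0 M).lap x t + (-K) * (R.rpow R0 N).lap x t := by
        simp only [V, lap_add, lap_smul]
      rw [eV']
      have h1 := mul_le_mul_of_nonneg_left hup K0.le
      have h2 := mul_le_mul_of_nonneg_right hΛ (add_nonneg X0 Y0)
      have h3 : K * (K1 * (m ^ (1 - 1 / a) * (0 + dA x t) + m ^ (1 - 1 / b) * (0 + dB x t))) =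
        K * K1 * (m ^ (1 - 1 / a) * (0 + dA x t) + m ^ (1 - 1 / b) * (0 + dB x t)) := by ring
      linarith
    set L : ℝ := (η ^ (c / M) + Λ * (η ^ (a / M) + η ^ (b / M))) ^ M +
      (-K) * (η ^ (c / N) + η ^ (a / N) + η ^ (b / N)) ^ N with hL
    have hlim : V.Lim L := by
      have l1 : Filter.Tendsto (fun q : ℝ × ℝ => SA.v q.2 q.1) (Filter.atTop ×ˢ ⊤) (nhds η) := by
        simpa [SA, Jet.add, Jet.const] using lA.const_add η
      have l2 : Filter.Tendsto (fun q : ℝ × ℝ => SB.v q.2 q.1) (Filter.atTop ×ˢ ⊤) (nhds η) := by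
        simpa [SB, Jet.add, Jet.const] using lB.const_add η
      have l3 : Filter.Tendsto (fun q : ℝ × ℝ => SG.v q.2 q.1) (Filter.atTop ×ˢ ⊤) (nhds η) := by
        simpa [SG, Jet.add, Jet.const] using lG.const_add η
      have hp : ∀ e : ℝ, η ≠ 0 ∨ 0 ≤ e := fun _ => Or.inl hη.ne'
      unfold Lim
      simp only [eV]
      exact (((l3.rpow_const (hp _)).add (((l1.rpow_const (hp _)).add
        (l2.rpow_const (hp _))).const_mul Λ)).rpow_const (Or.inr hM0.le)).add
        ((((l3.rpow_const (hp _)).add (l1.rpow_const (hp _))).add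
        (l2.rpow_const (hp _))).rpow_const (Or.inr hN0.le) |>.const_mul _)
    have epow : ∀ s : ℝ, 0 ≤ s → ∀ e T : ℝ, 0 < T → (s ^ (e / T)) ^ T = s ^ e :=
      fun s hs e T hT => by rw [← Real.rpow_mul hs]; congr 1; field_simp
    have hLge : -(K * (3 ^ N * (η ^ c + η ^ a + η ^ b))) ≤ L := by
      have h1 : 0 ≤ (η ^ (c / M) + Λ * (η ^ (a / M) + η ^ (b / M))) ^ M := by positivity
      have h2 := Real.add_add_rpow_le_three_rpow_mul (a := η ^ (c / N)) (b := η ^ (a / N))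
        (c := η ^ (b / N)) (by positivity) (by positivity) (by positivity) hN0
      rw [epow _ hη.le _ _ hN0, epow _ hη.le _ _ hN0, epow _ hη.le _ _ hN0] at h2
      have := mul_le_mul_of_nonneg_left h2 K0.le
      rw [hL]; linarith
    have hV := V.integral_ge_of_lim (fun t h => intervalIntegral.integral_nonneg (by positivity)
      fun x _ => hlap x t h) hlim ht
    have cA : Continuous fun x => A.v x t ^ a :=
      (continuous_slice A.cv ht).rpow_const fun x => Or.inr ha.le
    have cB : Continuous fun x => B.v x t ^ b :=
      (continuous_slice B.cv ht).rpow_const fun x => Or.inr hb.le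
    have cG : Continuous fun x => G.v x t ^ c :=
      (continuous_slice G.cv ht).rpow_const fun x => Or.inr hc.le
    have cAB : Continuous fun x => A.v x t ^ a + B.v x t ^ b + (η ^ a + η ^ b) :=
      (cA.add cB).add continuous_const
    have hVle : ∫ x in (0 : ℝ)..2 * Real.pi, V.v x t ≤ ∫ x in (0 : ℝ)..2 * Real.pi,
        (C0 * (A.v x t ^ a + B.v x t ^ b + (η ^ a + η ^ b)) - 1 * G.v x t ^ c) := by
      refine intervalIntegral.integral_mono_on (by positivity)
        ((continuous_slice V.cv ht).intervalIntegrable _ _)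
        (((continuous_const.mul cAB).sub (continuous_const.mul cG)).intervalIntegrable _ _)
        fun x _ => ?_
      have sa := A0 x t ht
      have sb := B0 x t ht
      have sg := G0 x t ht
      have a0 := hA.nonneg x t ht
      have b0 := hB.nonneg x t ht
      have g0 := hG.nonneg x t ht
      rw [eV]
      have i1 : (SG.v x t ^ (c / M) + Λ * (SA.v x t ^ (a / M) + SB.v x t ^ (b / M))) ^ M ≤
          3 ^ M * (SG.v x t ^ c + Λ ^ M * SA.v x t ^ a + Λ ^ M * SB.v x t ^ b) := by
        have := Real.add_add_rpow_le_three_rpow_mul (a := SG.v x t ^ (c / M))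
          (b := Λ * SA.v x t ^ (a / M)) (c := Λ * SB.v x t ^ (b / M)) (by positivity)
          (by positivity) (by positivity) hM0
        rw [Real.mul_rpow hΛ0.le (by positivity), Real.mul_rpow hΛ0.le (by positivity),
          epow _ sg.le _ _ hM0, epow _ sa.le _ _ hM0, epow _ sb.le _ _ hM0] at this
        rwa [mul_add, ← add_assoc]
      have i2 : SG.v x t ^ c ≤
          (SG.v x t ^ (c / N) + SA.v x t ^ (a / N) + SB.v x t ^ (b / N)) ^ N := by
        rw [← epow _ sg.le c N hN0]
        have : 0 < SA.v x t ^ (a / N) := by positivity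
        have : 0 < SB.v x t ^ (b / N) := by positivity
        gcongr
        linarith
      have i3 : G.v x t ^ c ≤ SG.v x t ^ c := by
        gcongr; simp only [SG, Jet.add, Jet.const]; linarith
      have i4 : SA.v x t ^ a ≤ 2 ^ a * (η ^ a + A.v x t ^ a) :=
        Real.add_rpow_le_two_rpow_mul hη.le a0 ha
      have i5 : SB.v x t ^ b ≤ 2 ^ b * (η ^ b + B.v x t ^ b) :=
        Real.add_rpow_le_two_rpow_mul hη.le b0 hb
      have i6 := mul_le_mul_of_nonneg_left i2 K0.le
      have T0 : 0 ≤ (3 : ℝ) ^ M * Λ ^ M := by positivity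
      have i7 := mul_le_mul_of_nonneg_left (add_le_add i4 i5) T0
      have i8 : 2 ^ a * (η ^ a + A.v x t ^ a) + 2 ^ b * (η ^ b + B.v x t ^ b) ≤
          (2 ^ a + 2 ^ b) * (A.v x t ^ a + B.v x t ^ b + (η ^ a + η ^ b)) := by
        have j1 : 0 ≤ 2 ^ b * (η ^ a + A.v x t ^ a) := by positivity
        have j2 : 0 ≤ 2 ^ a * (η ^ b + B.v x t ^ b) := by positivity
        linarith
      have i9 := mul_le_mul_of_nonneg_left i8 T0
      rw [hC0]
      rw [hK] at i6 ⊢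
      linarith
    have cAB' : Continuous fun x => A.v x t ^ a + B.v x t ^ b := cA.add cB
    rw [intervalIntegral_mul_sub_mul cAB cG, intervalIntegral.integral_add
      (cAB'.intervalIntegrable _ _) intervalIntegrable_const,
      intervalIntegral.integral_add (cA.intervalIntegrable _ _) (cB.intervalIntegrable _ _),
      intervalIntegral.integral_const, smul_eq_mul, sub_zero] at hVle
    have := mul_le_mul_of_nonneg_left hLge (show 0 ≤ 2 * Real.pi by positivity)
    linarith
  have hl : Filter.Tendsto (fun η : ℝ => C0 * ((∫ x in (0 : ℝ)..2 * Real.pi, A.v x t ^ a) +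
          ∫ x in (0 : ℝ)..2 * Real.pi, B.v x t ^ b) +
      2 * Real.pi * (C0 * (η ^ a + η ^ b) + K * (3 ^ N * (η ^ c + η ^ a + η ^ b))))
      (nhdsWithin 0 (Set.Ioi 0)) (nhds (C0 * ((∫ x in (0 : ℝ)..2 * Real.pi, A.v x t ^ a) +
          ∫ x in (0 : ℝ)..2 * Real.pi, B.v x t ^ b) +
      2 * Real.pi * (C0 * (0 ^ a + 0 ^ b) + K * (3 ^ N * (0 ^ c + 0 ^ a + 0 ^ b))))) := by
    have z : ∀ e : ℝ, 0 < e → Filter.Tendsto (fun η : ℝ => η ^ e) (nhdsWithin 0 (Set.Ioi 0))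
        (nhds (0 ^ e)) := fun e he =>
      (Real.continuousAt_rpow_const _ _ (Or.inr he.le)).tendsto.mono_left nhdsWithin_le_nhds
    exact (((((z a ha).add (z b hb)).const_mul _).add
      (((((z c hc).add (z a ha)).add (z b hb)).const_mul _).const_mul _)).const_mul _).const_add _
  rw [Real.zero_rpow ha.ne', Real.zero_rpow hb.ne', Real.zero_rpow hc.ne'] at hl
  simp only [add_zero, mul_zero] at hl
  exact ge_of_tendsto hl (eventually_mem_nhdsWithin.mono key)

end Jet

/-- Logarithmic polar coordinates on the punctured disc. -/
noncomputable def pt (x t : ℝ) : ℂ := Complex.exp (-t + x * Complex.I)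

/-- The Euler derivative `z f'(z)`. -/
noncomputable def Dz (f : ℂ → ℂ) (z : ℂ) : ℂ := z * deriv f z

theorem norm_pt (x t : ℝ) : ‖pt x t‖ = Real.exp (-t) := by
  simp [pt, Complex.norm_exp]

theorem pt_mem_ball (x : ℝ) {t : ℝ} (ht : 0 < t) : pt x t ∈ Metric.ball (0 : ℂ) 1 := by
  rw [mem_ball_zero_iff, norm_pt]; exact Real.exp_lt_one_iff.mpr (by linarith)

theorem continuous_pt : Continuous (Function.uncurry pt) := by
  unfold Function.uncurry pt; fun_prop

theorem pt_two_pi (t : ℝ) : pt (2 * Real.pi) t = pt 0 t := by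
  unfold pt
  rw [Complex.exp_add]
  push_cast
  rw [Complex.exp_two_pi_mul_I]
  simp

theorem hasDerivAt_pt_left (x t : ℝ) :
    HasDerivAt (fun y => pt y t) (Complex.I * pt x t) x := by
  have h1 : HasDerivAt (fun y : ℝ => (-t + y * Complex.I : ℂ)) Complex.I x := by
    simpa using ((Complex.ofRealCLM.hasDerivAt (x := x)).mul_const Complex.I).const_add (-(t : ℂ))
  have := h1.cexp
  exact this.congr_deriv (by unfold pt; ring)

theorem hasDerivAt_pt_right (x t : ℝ) :
    HasDerivAt (fun s => pt x s) (-pt x t) t := by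
  have h1 : HasDerivAt (fun s : ℝ => (-s + x * Complex.I : ℂ)) (-1) t := by
    simpa using ((Complex.ofRealCLM.hasDerivAt (x := t)).neg).add_const (x * Complex.I : ℂ)
  have := h1.cexp
  exact this.congr_deriv (by unfold pt; ring)

theorem DifferentiableOn.Dz {f : ℂ → ℂ} (hf : DifferentiableOn ℂ f (Metric.ball 0 1)) :
    DifferentiableOn ℂ (Dz f) (Metric.ball 0 1) :=
  differentiableOn_id.mul (hf.deriv Metric.isOpen_ball)

theorem hasDerivAt_comp_pt_left {f : ℂ → ℂ} (hf : DifferentiableOn ℂ f (Metric.ball 0 1))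
    (x : ℝ) {t : ℝ} (ht : 0 < t) :
    HasDerivAt (fun y => f (pt y t)) (Complex.I • Dz f (pt x t)) x := by
  have h1 := (hf.differentiableAt (Metric.isOpen_ball.mem_nhds (pt_mem_ball x ht))).hasDerivAt
  have := h1.comp x (hasDerivAt_pt_left x t)
  exact this.congr_deriv (by rw [smul_eq_mul, Dz]; ring)

theorem hasDerivAt_comp_pt_right {f : ℂ → ℂ} (hf : DifferentiableOn ℂ f (Metric.ball 0 1))
    (x : ℝ) {t : ℝ} (ht : 0 < t) :
    HasDerivAt (fun s => f (pt x s)) (-Dz f (pt x t)) t := by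
  have h1 := (hf.differentiableAt (Metric.isOpen_ball.mem_nhds (pt_mem_ball x ht))).hasDerivAt
  have := h1.comp t (hasDerivAt_pt_right x t)
  exact this.congr_deriv (by rw [Dz]; ring)

theorem continuousOn_comp_pt {f : ℂ → ℂ} (hf : DifferentiableOn ℂ f (Metric.ball 0 1)) :
    ContinuousOn (Function.uncurry fun x t => f (pt x t)) (Set.univ ×ˢ Set.Ioi 0) :=
  hf.continuousOn.comp continuous_pt.continuousOn fun q hq => pt_mem_ball q.1 hq.2

theorem continuous_comp_pt {f : ℂ → ℂ} (hf : DifferentiableOn ℂ f (Metric.ball 0 1))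
    {t : ℝ} (ht : 0 < t) : Continuous fun x => f (pt x t) :=
  hf.continuousOn.comp_continuous (continuous_pt.comp (by fun_prop : Continuous fun x : ℝ => (x, t)))
    fun x => pt_mem_ball x ht

/-- A holomorphic function on the disc, in logarithmic coordinates. -/
noncomputable def HolFamily.ofHol (f : ℂ → ℂ) (hf : DifferentiableOn ℂ f (Metric.ball 0 1)) :
    HolFamily ℂ where
  h x t := f (pt x t)
  h1 x t := Dz f (pt x t)
  h2 x t := Dz (Dz f) (pt x t)
  hx x _ ht := hasDerivAt_comp_pt_left hf x ht
  ht x _ ht := hasDerivAt_comp_pt_right hf x ht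
  h1x x _ ht := hasDerivAt_comp_pt_left hf.Dz x ht
  h1t x _ ht := hasDerivAt_comp_pt_right hf.Dz x ht
  ch := continuousOn_comp_pt hf
  ch1 := continuousOn_comp_pt hf.Dz
  ch2 := continuousOn_comp_pt hf.Dz.Dz
  per t _ := by simp only [pt_two_pi]
  per1 t _ := by simp only [pt_two_pi]

theorem tendsto_pt : Filter.Tendsto (fun q : ℝ × ℝ => pt q.2 q.1) (Filter.atTop ×ˢ ⊤) (nhds 0) := by
  rw [tendsto_zero_iff_norm_tendsto_zero]
  simp only [norm_pt]
  exact (Real.tendsto_exp_neg_atTop_nhds_zero).comp Filter.tendsto_fst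

theorem HolFamily.lim_ofHol {f : ℂ → ℂ} (hf : DifferentiableOn ℂ f (Metric.ball 0 1))
    (h0 : f 0 = 0) : (HolFamily.ofHol f hf).normSq.Lim 0 := by
  have hc : ContinuousAt f 0 :=
    (hf.differentiableAt (Metric.isOpen_ball.mem_nhds (by simp))).continuousAt
  have h1 : Filter.Tendsto (fun q : ℝ × ℝ => f (pt q.2 q.1)) (Filter.atTop ×ˢ ⊤) (nhds (f 0)) :=
    hc.tendsto.comp tendsto_pt
  have := h1.norm.pow 2
  rw [h0, norm_zero, zero_pow two_ne_zero] at this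
  exact this

/-- Angular integral of `w`. -/
noncomputable def circ (w : ℝ → ℝ≥0∞) : ℝ≥0∞ := ∫⁻ x in Set.Ioc (0 : ℝ) (2 * Real.pi), w x

theorem circ_ofReal {w : ℝ → ℝ} (hw : Continuous w) (h0 : ∀ x, 0 ≤ w x) :
    circ (fun x => ENNReal.ofReal (w x)) = ENNReal.ofReal (∫ x in (0 : ℝ)..2 * Real.pi, w x) := by
  rw [intervalIntegral.integral_of_le (by positivity), circ, ofReal_integral_eq_lintegral_ofReal]
  · exact (hw.integrableOn_Icc (a := 0) (b := 2 * Real.pi)).mono_set Set.Ioc_subset_Icc_self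
  · exact Filter.Eventually.of_forall h0

theorem ofReal_norm_sq_rpow {E : Type*} [NormedAddCommGroup E] (a : E) {r : ℝ} (hr : 0 ≤ r) :
    ENNReal.ofReal ((‖a‖ ^ 2) ^ r) = ‖a‖ₑ ^ (2 * r) := by
  rw [← Real.rpow_natCast, ← Real.rpow_mul (norm_nonneg _),
    ← ENNReal.ofReal_rpow_of_nonneg (norm_nonneg _) (by positivity), ofReal_norm]
  norm_num

theorem HolFamily.circ_normSq_rpow {E : Type*} [NormedAddCommGroup E] [InnerProductSpace ℂ E]
    (H : HolFamily E) {r : ℝ} (hr : 0 < r) {t : ℝ} (ht : 0 < t) :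
    circ (fun x => ‖H.h x t‖ₑ ^ (2 * r)) =
      ENNReal.ofReal (∫ x in (0 : ℝ)..2 * Real.pi, H.normSq.v x t ^ r) := by
  rw [← circ_ofReal]
  · congr 1; ext x
    rw [← ofReal_norm_sq_rpow _ hr.le]; rfl
  · exact (continuous_slice H.normSq.cv ht).rpow_const fun x => Or.inr hr.le
  · exact fun x => Real.rpow_nonneg (H.psh_normSq.nonneg x t ht) r

/-- The means of a primitive of `f g'` are controlled by those of `f` and `g`. -/
theorem circ_primitive_le {p s q : ℝ} (hp : 0 < p) (hs : 0 < s) (hq : 0 < q)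
    (hpsq : 1 / q = 1 / p + 1 / s) : ∃ C : ℝ≥0∞, C ≠ ∞ ∧ ∀ f g F : ℂ → ℂ,
      DifferentiableOn ℂ f (Metric.ball 0 1) → DifferentiableOn ℂ g (Metric.ball 0 1) →
      DifferentiableOn ℂ F (Metric.ball 0 1) → f 0 = 0 → g 0 = 0 → F 0 = 0 →
      (∀ z ∈ Metric.ball (0 : ℂ) 1, deriv F z = f z * deriv g z) → ∀ t : ℝ, 0 < t →
      circ (fun x => ‖F (pt x t)‖ₑ ^ q) ≤
        C * (circ (fun x => ‖f (pt x t)‖ₑ ^ p) + circ (fun x => ‖g (pt x t)‖ₑ ^ s)) := by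
  obtain ⟨C, hC, h⟩ := Jet.integral_rpow_le_add (a := p / 2) (b := s / 2) (c := q / 2)
    (by positivity) (by positivity) (by positivity) (by
      rw [one_div_div, one_div_div, one_div_div]
      have : 2 / q = 2 * (1 / q) := by ring
      rw [this, hpsq]; ring)
  refine ⟨ENNReal.ofReal C, ofReal_ne_top, fun f g F hf hg hF f0 g0 F0 hFd t ht => ?_⟩
  have key := h _ _ _ _ _ _ (HolFamily.ofHol f hf).psh_normSq (HolFamily.ofHol g hg).psh_normSq
    (HolFamily.ofHol F hF).psh_normSq (HolFamily.lim_ofHol hf f0) (HolFamily.lim_ofHol hg g0)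
    (HolFamily.lim_ofHol hF F0) (fun x t ht => by
      change ‖Dz F (pt x t)‖ ^ 2 = ‖f (pt x t)‖ ^ 2 * ‖Dz g (pt x t)‖ ^ 2
      rw [← mul_pow, ← norm_mul, Dz, hFd _ (pt_mem_ball x ht), Dz]
      congr 2; ring) t ht
  have e : ∀ (f : ℂ → ℂ) (hf : DifferentiableOn ℂ f (Metric.ball 0 1)) (p : ℝ), 0 < p →
      circ (fun x => ‖f (pt x t)‖ₑ ^ p) = ENNReal.ofReal (∫ x in (0 : ℝ)..2 * Real.pi,
        (HolFamily.ofHol f hf).normSq.v x t ^ (p / 2)) := by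
    intro f hf p hp
    rw [← HolFamily.circ_normSq_rpow _ (by positivity) ht, mul_div_cancel₀ _ two_ne_zero]
    rfl
  rw [e f hf p hp, e g hg s hs, e F hF q hq, ← ofReal_add, ← ofReal_mul hC]
  · exact ofReal_le_ofReal key
  · exact intervalIntegral.integral_nonneg (by positivity) fun x _ =>
      Real.rpow_nonneg ((HolFamily.psh_normSq _).nonneg x t ht) _
  · exact intervalIntegral.integral_nonneg (by positivity) fun x _ =>
      Real.rpow_nonneg ((HolFamily.psh_normSq _).nonneg x t ht) _

theorem integrableOn_pow_mul_exp_neg_mul (m : ℕ) {r : ℝ} (hr : 0 < r) :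
    IntegrableOn (fun c : ℝ => c ^ m * Real.exp (-(r * c))) (Set.Ioi 0) := by
  have := integrableOn_rpow_mul_exp_neg_mul_rpow (p := 1) (s := m) (b := r)
    (by have : (0 : ℝ) ≤ m := m.cast_nonneg
        linarith) one_pos hr
  simpa using this

theorem integral_pow_mul_exp_neg_mul (m : ℕ) {r : ℝ} (hr : 0 < r) :
    ∫ c in Set.Ioi (0 : ℝ), c ^ m * Real.exp (-(r * c)) = m.factorial / r ^ (m + 1) := by
  have := Real.integral_rpow_mul_exp_neg_mul_Ioi (a := m + 1) (r := r) (by positivity) hr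
  rw [Real.Gamma_nat_eq_factorial] at this
  simp only [add_sub_cancel_right, Real.rpow_natCast] at this
  rw [this, one_div, Real.inv_rpow hr.le]
  norm_cast
  rw [mul_comm, ← div_eq_mul_inv]


/-- Weighted exponentials in `L²(0, ∞)`. -/
noncomputable def expVec (k n : ℕ) (c : ℝ) : ℂ :=
  (Real.sqrt (c ^ (2 * k + 1)) * Real.exp (-((n + 1) * c)) : ℝ)

theorem inner_expVec (k m n : ℕ) {c : ℝ} (hc : 0 < c) :
    inner ℂ (expVec k m c) (expVec k n c) =
      ((c ^ (2 * k + 1) * Real.exp (-((m + n + 2) * c)) : ℝ) : ℂ) := by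
  rw [expVec, expVec, RCLike.inner_apply, Complex.conj_ofReal, ← Complex.ofReal_mul]
  congr 1
  have h : -((m + n + 2) * c) = -((m + 1) * c) + -((n + 1) * c) := by ring
  have h2 := Real.mul_self_sqrt (show 0 ≤ c ^ (2 * k + 1) by positivity)
  rw [h, Real.exp_add]
  linear_combination (Real.exp (-((n + 1) * c)) * Real.exp (-((m + 1) * c))) * h2

theorem continuous_expVec (k n : ℕ) : Continuous (expVec k n) := by
  unfold expVec; fun_prop

theorem memLp_expVec (k n : ℕ) : MemLp (expVec k n) 2 (volume.restrict (Set.Ioi 0)) := by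
  rw [memLp_two_iff_integrable_sq_norm (continuous_expVec k n).aestronglyMeasurable]
  have h := integrableOn_pow_mul_exp_neg_mul (2 * k + 1) (r := n + n + 2) (by positivity)
  refine h.congr_fun (fun c hc => ?_) measurableSet_Ioi
  have h1 := inner_expVec k n n (Set.mem_Ioi.1 hc)
  rw [inner_self_eq_norm_sq_to_K] at h1
  refine Complex.ofReal_injective ?_
  rw [Complex.ofReal_pow]
  exact h1.symm

/-- The vectors `expVec k n` as elements of `L²(0, ∞)`. -/
noncomputable def gramVec (k n : ℕ) : Lp ℂ 2 (volume.restrict (Set.Ioi (0 : ℝ))) :=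
  (memLp_expVec k n).toLp

theorem inner_gramVec (k m n : ℕ) : inner ℂ (gramVec k m) (gramVec k n) =
    (((2 * k + 1).factorial / (m + n + 2) ^ (2 * k + 2) : ℝ) : ℂ) := by
  rw [← integral_pow_mul_exp_neg_mul (2 * k + 1) (r := m + n + 2) (by positivity), L2.inner_def,
    ← integral_complex_ofReal]
  refine integral_congr_ae ?_
  filter_upwards [(memLp_expVec k m).coeFn_toLp, (memLp_expVec k n).coeFn_toLp,
    ae_restrict_mem measurableSet_Ioi] with c h1 h2 hc
  rw [gramVec, gramVec, h1, h2, inner_expVec k m n hc]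

theorem enorm_sum_gramVec_sq (k N : ℕ) (b : ℕ → ℂ) :
    ‖∑ n ∈ Finset.range N, b n • gramVec k n‖ₑ ^ (2 : ℝ) =
      ∫⁻ c in Set.Ioi (0 : ℝ), ENNReal.ofReal (c ^ (2 * k + 1)) *
        ‖∑ n ∈ Finset.range N, b n * Real.exp (-((n + 1) * c))‖ₑ ^ (2 : ℝ) := by
  rw [Lp.enorm_def, eLpNorm_eq_lintegral_rpow_enorm_toReal two_ne_zero ofNat_ne_top,
    ENNReal.toReal_ofNat, ← ENNReal.rpow_mul, one_div_mul_cancel two_ne_zero, ENNReal.rpow_one]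
  refine lintegral_congr_ae ?_
  have h1 : ∀ n, ∀ᵐ c ∂(volume.restrict (Set.Ioi (0 : ℝ))),
      (b n • gramVec k n : Lp ℂ 2 _) c = b n * expVec k n c := fun n => by
    filter_upwards [Lp.coeFn_smul (b n) (gramVec k n), (memLp_expVec k n).coeFn_toLp] with c h1 h2
    rw [h1, Pi.smul_apply, smul_eq_mul, gramVec, h2]
  filter_upwards [Lp.coeFn_fun_finsetSum (Finset.range N) (fun n => b n • gramVec k n),
    ae_all_iff.2 h1, ae_restrict_mem measurableSet_Ioi] with c h2 h3 hc
  have hc : 0 < c := hc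
  rw [h2, Finset.sum_congr rfl fun n _ => h3 n]
  have : ∑ n ∈ Finset.range N, b n * expVec k n c = (Real.sqrt (c ^ (2 * k + 1)) : ℂ) *
      ∑ n ∈ Finset.range N, b n * Real.exp (-((n + 1) * c)) := by
    rw [Finset.mul_sum]
    refine Finset.sum_congr rfl fun n _ => ?_
    rw [expVec, Complex.ofReal_mul]; ring
  rw [this, enorm_mul, ENNReal.mul_rpow_of_nonneg _ _ zero_le_two]
  congr 1
  rw [← ofReal_norm, Complex.norm_real, Real.norm_of_nonneg (Real.sqrt_nonneg _),
    ENNReal.ofReal_rpow_of_nonneg (Real.sqrt_nonneg _) zero_le_two, Real.rpow_two,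
    Real.sq_sqrt (by positivity)]

section PolySum

variable {E : Type*} [NormedAddCommGroup E] [InnerProductSpace ℂ E]

/-- The vector polynomial `∑ aₙ (n + 1)ᵏ zⁿ⁺¹ eₙ` in logarithmic coordinates. -/
noncomputable def polySum (e : ℕ → E) (a : ℕ → ℂ) (N k : ℕ) (x t : ℝ) : E :=
  ∑ n ∈ Finset.range N, (a n * (n + 1) ^ k * pt x t ^ (n + 1)) • e n

theorem continuous_polySum (e : ℕ → E) (a : ℕ → ℂ) (N k : ℕ) :
    Continuous (Function.uncurry (polySum e a N k)) := by
  have h := continuous_pt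
  have : Function.uncurry (polySum e a N k) = fun q : ℝ × ℝ => ∑ n ∈ Finset.range N,
      (a n * (n + 1) ^ k * Function.uncurry pt q ^ (n + 1)) • e n := rfl
  rw [this]
  fun_prop

theorem hasDerivAt_polySum_left (e : ℕ → E) (a : ℕ → ℂ) (N k : ℕ) (x t : ℝ) :
    HasDerivAt (fun y => polySum e a N k y t) (Complex.I • polySum e a N (k + 1) x t) x := by
  unfold polySum
  rw [Finset.smul_sum]
  refine HasDerivAt.fun_sum fun n _ => ?_
  have := (((hasDerivAt_pt_left x t).fun_pow (n + 1)).const_mul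
    (a n * (n + 1) ^ k)).smul_const (e n)
  refine this.congr_deriv ?_
  rw [smul_smul]; congr 1; push_cast; ring

theorem hasDerivAt_polySum_right (e : ℕ → E) (a : ℕ → ℂ) (N k : ℕ) (x t : ℝ) :
    HasDerivAt (fun s => polySum e a N k x s) (-polySum e a N (k + 1) x t) t := by
  unfold polySum
  rw [← Finset.sum_neg_distrib]
  refine HasDerivAt.fun_sum fun n _ => ?_
  have := (((hasDerivAt_pt_right x t).fun_pow (n + 1)).const_mul
    (a n * (n + 1) ^ k)).smul_const (e n)
  refine this.congr_deriv ?_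
  rw [← neg_smul]; congr 1; push_cast; ring

theorem polySum_two_pi (e : ℕ → E) (a : ℕ → ℂ) (N k : ℕ) (t : ℝ) :
    polySum e a N k (2 * Real.pi) t = polySum e a N k 0 t := by
  simp only [polySum, pt_two_pi]

/-- The holomorphic family of a vector polynomial. -/
noncomputable def HolFamily.ofPoly (e : ℕ → E) (a : ℕ → ℂ) (N k : ℕ) : HolFamily E where
  h := polySum e a N k
  h1 := polySum e a N (k + 1)
  h2 := polySum e a N (k + 2)
  hx x t _ := hasDerivAt_polySum_left e a N k x t
  ht x t _ := hasDerivAt_polySum_right e a N k x t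
  h1x x t _ := hasDerivAt_polySum_left e a N (k + 1) x t
  h1t x t _ := hasDerivAt_polySum_right e a N (k + 1) x t
  ch := (continuous_polySum e a N k).continuousOn
  ch1 := (continuous_polySum e a N (k + 1)).continuousOn
  ch2 := (continuous_polySum e a N (k + 2)).continuousOn
  per t _ := polySum_two_pi e a N k t
  per1 t _ := polySum_two_pi e a N (k + 1) t

theorem HolFamily.lim_ofPoly (e : ℕ → E) (a : ℕ → ℂ) (N k : ℕ) :
    (HolFamily.ofPoly e a N k).normSq.Lim 0 := by
  have h1 : Filter.Tendsto (fun q : ℝ × ℝ => polySum e a N k q.2 q.1) (Filter.atTop ×ˢ ⊤)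
      (nhds (∑ n ∈ Finset.range N, (a n * (n + 1) ^ k * 0 ^ (n + 1)) • e n)) :=
    tendsto_finsetSum _ fun n _ => ((tendsto_pt.pow (n + 1)).const_mul _).smul_const _
  have := h1.norm.pow 2
  change Filter.Tendsto (fun q : ℝ × ℝ => ‖polySum e a N k q.2 q.1‖ ^ 2) _ _
  simpa using this

variable {E' : Type*} [NormedAddCommGroup E'] [InnerProductSpace ℂ E']

theorem inner_polySum (e : ℕ → E) (a : ℕ → ℂ) (N k l : ℕ) (x t : ℝ) :
    inner ℂ (polySum e a N k x t) (polySum e a N l x t) =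
      ∑ m ∈ Finset.range N, ∑ n ∈ Finset.range N,
        (starRingEnd ℂ (a m * pt x t ^ (m + 1)) * (a n * pt x t ^ (n + 1))) *
          ((m + 1) ^ k * (n + 1) ^ l) * inner ℂ (e m) (e n) := by
  unfold polySum
  rw [sum_inner]
  refine Finset.sum_congr rfl fun m _ => ?_
  rw [inner_sum]
  refine Finset.sum_congr rfl fun n _ => ?_
  rw [inner_smul_left, inner_smul_right]
  simp only [map_mul, map_pow, map_add, map_one, map_natCast]
  ring

/-- The second normal derivative of one square function is the density of another. -/
theorem vtt_ofPoly {e : ℕ → E} {e' : ℕ → E'} {κ : ℝ}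
    (hG : ∀ m n : ℕ, ((m : ℂ) + n + 2) ^ 2 * inner ℂ (e' m) (e' n) = κ * inner ℂ (e m) (e n))
    (a : ℕ → ℂ) (N k : ℕ) (x t : ℝ) :
    (HolFamily.ofPoly e' a N (k + 1)).normSq.vtt x t =
      κ * ‖(HolFamily.ofPoly e a N k).h1 x t‖ ^ 2 := by
  change 2 * ‖polySum e' a N (k + 2) x t‖ ^ 2 +
    2 * HolFamily.rin (polySum e' a N (k + 1) x t) (polySum e' a N (k + 3) x t) =
    κ * ‖polySum e a N (k + 1) x t‖ ^ 2
  have h : 2 * inner ℂ (polySum e' a N (k + 2) x t) (polySum e' a N (k + 2) x t) +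
      inner ℂ (polySum e' a N (k + 1) x t) (polySum e' a N (k + 3) x t) +
      inner ℂ (polySum e' a N (k + 3) x t) (polySum e' a N (k + 1) x t) =
      κ * inner ℂ (polySum e a N (k + 1) x t) (polySum e a N (k + 1) x t) := by
    simp only [inner_polySum, Finset.mul_sum, ← Finset.sum_add_distrib]
    refine Finset.sum_congr rfl fun m _ => Finset.sum_congr rfl fun n _ => ?_
    linear_combination (starRingEnd ℂ (a m * pt x t ^ (m + 1)) * (a n * pt x t ^ (n + 1))) *
          ((m + 1) ^ (k + 1) * (n + 1) ^ (k + 1)) * hG m n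
  have h2 := congrArg Complex.re h
  simp only [Complex.add_re, Complex.re_ofReal_mul] at h2
  rw [← HolFamily.rin_self, ← HolFamily.rin_self, two_mul (HolFamily.rin _ (polySum e' a N (k + 3) x t))]
  nth_rewrite 3 [HolFamily.rin_comm]
  have h3 : ∀ z : ℂ, (2 * z).re = 2 * z.re := fun z => by simp
  rw [h3] at h2
  unfold HolFamily.rin
  linarith

theorem circ_polySum_comparable {e : ℕ → E} {e' : ℕ → E'} {κ : ℝ} (hκ : 0 < κ)
    (hG : ∀ m n : ℕ, ((m : ℂ) + n + 2) ^ 2 * inner ℂ (e' m) (e' n) = κ * inner ℂ (e m) (e n))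
    (k : ℕ) {r : ℝ} (hr : 0 < r) :
    ∃ C : ℝ≥0∞, C ≠ ∞ ∧ ∀ (a : ℕ → ℂ) (N : ℕ) (t : ℝ), 0 < t →
      circ (fun x => ‖polySum e' a N (k + 1) x t‖ₑ ^ (2 * r)) ≤
        C * circ (fun x => ‖polySum e a N k x t‖ₑ ^ (2 * r)) ∧
      circ (fun x => ‖polySum e a N k x t‖ₑ ^ (2 * r)) ≤
        C * circ (fun x => ‖polySum e' a N (k + 1) x t‖ₑ ^ (2 * r)) := by
  obtain ⟨C, hC, h⟩ := Jet.integral_rpow_comparable hr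
  refine ⟨ENNReal.ofReal (C * κ ^ r + C / κ ^ r), ofReal_ne_top, fun a N t ht => ?_⟩
  have key := h (Jet.smul κ (HolFamily.ofPoly e a N k).normSq)
    (HolFamily.ofPoly e' a N (k + 1)).normSq _ _
    ((HolFamily.ofPoly e a N k).psh_normSq.smul hκ.le) (HolFamily.psh_normSq _)
    (by simpa [Jet.Lim, Jet.smul] using (HolFamily.lim_ofPoly e a N k).const_mul κ)
    (HolFamily.lim_ofPoly _ _ _ _) (fun x t _ => vtt_ofPoly hG a N k x t) t ht
  have e1 := (HolFamily.ofPoly e a N k).circ_normSq_rpow hr ht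
  have e2 := (HolFamily.ofPoly e' a N (k + 1)).circ_normSq_rpow hr ht
  have e3 : ∫ x in (0 : ℝ)..2 * Real.pi,
      (Jet.smul κ (HolFamily.ofPoly e a N k).normSq).v x t ^ r =
      κ ^ r * ∫ x in (0 : ℝ)..2 * Real.pi, (HolFamily.ofPoly e a N k).normSq.v x t ^ r := by
    rw [← intervalIntegral.integral_const_mul]
    congr 1; ext x
    exact Real.mul_rpow hκ.le ((HolFamily.psh_normSq _).nonneg x t ht)
  have n1 : 0 ≤ ∫ x in (0 : ℝ)..2 * Real.pi, (HolFamily.ofPoly e a N k).normSq.v x t ^ r :=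
    intervalIntegral.integral_nonneg (by positivity) fun x _ =>
      Real.rpow_nonneg ((HolFamily.psh_normSq _).nonneg x t ht) _
  have n2 : 0 ≤ ∫ x in (0 : ℝ)..2 * Real.pi,
      (HolFamily.ofPoly e' a N (k + 1)).normSq.v x t ^ r :=
    intervalIntegral.integral_nonneg (by positivity) fun x _ =>
      Real.rpow_nonneg ((HolFamily.psh_normSq _).nonneg x t ht) _
  have hp : 0 < κ ^ r := Real.rpow_pos_of_pos hκ r
  have hd : 0 ≤ C / κ ^ r := by positivity
  have hm : 0 ≤ C * κ ^ r := by positivity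
  change circ (fun x => ‖polySum e a N k x t‖ₑ ^ (2 * r)) = _ at e1
  change circ (fun x => ‖polySum e' a N (k + 1) x t‖ₑ ^ (2 * r)) = _ at e2
  rw [e1, e2, ← ofReal_mul (by positivity), ← ofReal_mul (by positivity)]
  rw [e3] at key
  refine ⟨ofReal_le_ofReal ?_, ofReal_le_ofReal ?_⟩
  · have := mul_nonneg hd n1
    linarith [key.1]
  · have h1 := key.2
    rw [← le_div_iff₀' hp] at h1
    have h2 := mul_nonneg hm n2
    refine h1.trans ?_
    rw [add_mul, div_mul_eq_mul_div]
    linarith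

end PolySum

/-- Polynomials without constant term and their Euler derivatives. -/
noncomputable def polyP (a : ℕ → ℂ) (N k : ℕ) (z : ℂ) : ℂ :=
  ∑ n ∈ Finset.range N, a n * (n + 1) ^ k * z ^ (n + 1)

theorem Dz_polyP (a : ℕ → ℂ) (N k : ℕ) : Dz (polyP a N k) = polyP a N (k + 1) := by
  ext z
  have : HasDerivAt (polyP a N k)
      (∑ n ∈ Finset.range N, a n * (n + 1) ^ k * ((n + 1 : ℕ) * z ^ n)) z :=
    HasDerivAt.fun_sum fun n _ => (hasDerivAt_pow (n + 1) z).const_mul _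
  rw [Dz, this.deriv, polyP, Finset.mul_sum]
  refine Finset.sum_congr rfl fun n _ => ?_
  push_cast; ring

theorem iterate_Dz_polyP (a : ℕ → ℂ) (N k j : ℕ) : Dz^[j] (polyP a N k) = polyP a N (k + j) := by
  induction j with
  | zero => rfl
  | succ j ih => rw [Function.iterate_succ_apply', ih, Dz_polyP, add_assoc]

theorem differentiable_polyP (a : ℕ → ℂ) (N k : ℕ) : Differentiable ℂ (polyP a N k) := by
  unfold polyP; fun_prop

theorem polyP_zero (a : ℕ → ℂ) (N k : ℕ) : polyP a N k 0 = 0 := by simp [polyP]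

/-- Square functions on the half-lines `x = const`. -/
noncomputable def sqfn : ℕ → (ℂ → ℂ) → ℝ → ℝ → ℝ≥0∞
  | 0, f, x, t => ‖f (pt x t)‖ₑ ^ (2 : ℝ)
  | k + 1, f, x, t => ∫⁻ c in Set.Ioi (0 : ℝ), ENNReal.ofReal (c ^ (2 * k + 1)) *
      ‖Dz^[k + 1] f (pt x (t + c))‖ₑ ^ (2 : ℝ)

theorem pt_add (x t c : ℝ) : pt x (t + c) = pt x t * Real.exp (-c) := by
  rw [pt, pt, Complex.ofReal_exp, ← Complex.exp_add]; congr 1; push_cast; ring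

theorem sqfn_zero_polyP (a : ℕ → ℂ) (N : ℕ) (x t : ℝ) :
    sqfn 0 (polyP a N 0) x t = ‖polySum (fun _ => (1 : ℂ)) a N 0 x t‖ₑ ^ (2 : ℝ) := by
  simp [sqfn, polyP, polySum]

theorem sqfn_succ_polyP (k : ℕ) (a : ℕ → ℂ) (N : ℕ) (x t : ℝ) :
    sqfn (k + 1) (polyP a N 0) x t = ‖polySum (gramVec k) a N (k + 1) x t‖ₑ ^ (2 : ℝ) := by
  rw [sqfn, polySum, enorm_sum_gramVec_sq, iterate_Dz_polyP, zero_add]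
  congr 1; ext c; congr 3
  refine Finset.sum_congr rfl fun n _ => ?_
  rw [pt_add, mul_pow, ← Complex.ofReal_pow, ← Real.exp_nat_mul]
  push_cast
  ring_nf

theorem circ_sqfn_polyP_comparable (k : ℕ) {r : ℝ} (hr : 0 < r) :
    ∃ C : ℝ≥0∞, C ≠ ∞ ∧ ∀ (a : ℕ → ℂ) (N : ℕ) (t : ℝ), 0 < t →
      circ (fun x => sqfn (k + 1) (polyP a N 0) x t ^ r) ≤
        C * circ (fun x => sqfn k (polyP a N 0) x t ^ r) ∧
      circ (fun x => sqfn k (polyP a N 0) x t ^ r) ≤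
        C * circ (fun x => sqfn (k + 1) (polyP a N 0) x t ^ r) := by
  cases k with
  | zero =>
    simp only [sqfn_zero_polyP, sqfn_succ_polyP, ← ENNReal.rpow_mul]
    refine circ_polySum_comparable one_pos (fun m n => ?_) 0 hr
    have h : (m : ℂ) + n + 2 ≠ 0 := by exact_mod_cast (m + n + 1).succ_ne_zero
    rw [inner_gramVec]
    push_cast
    simp [h]
  | succ k =>
    simp only [sqfn_succ_polyP, ← ENNReal.rpow_mul]
    refine circ_polySum_comparable (κ := (2 * k + 3) * (2 * k + 2)) (by positivity)
      (fun m n => ?_) (k + 1) hr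
    have h : (m : ℂ) + n + 2 ≠ 0 := by exact_mod_cast (m + n + 1).succ_ne_zero
    rw [inner_gramVec, inner_gramVec, show 2 * (k + 1) + 1 = 2 * k + 1 + 1 + 1 by ring,
      Nat.factorial_succ, Nat.factorial_succ]
    push_cast
    field_simp
    ring

theorem ENNReal.add_rpow_le_two_rpow_mul (a b : ℝ≥0∞) {r : ℝ} (hr : 0 ≤ r) :
    (a + b) ^ r ≤ 2 ^ r * (a ^ r + b ^ r) := by
  have h : a + b ≤ 2 * max a b := by
    rw [two_mul]; exact add_le_add (le_max_left _ _) (le_max_right _ _)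
  refine (ENNReal.rpow_le_rpow h hr).trans ?_
  rw [ENNReal.mul_rpow_of_nonneg _ _ hr]
  gcongr
  rcases max_choice a b with h | h <;> rw [h]
  · exact le_self_add
  · exact le_add_self

theorem enorm_sq_le_add {E : Type*} [NormedAddCommGroup E] (a b : E) :
    ‖a‖ₑ ^ (2 : ℝ) ≤ 4 * (‖b‖ₑ ^ (2 : ℝ) + ‖a - b‖ₑ ^ (2 : ℝ)) := by
  have h : ‖a‖ₑ ≤ ‖b‖ₑ + ‖a - b‖ₑ := by
    simpa using enorm_add_le b (a - b)
  refine (ENNReal.rpow_le_rpow h zero_le_two).trans ?_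
  refine (ENNReal.add_rpow_le_two_rpow_mul _ _ zero_le_two).trans (le_of_eq ?_)
  norm_num

/-- Locally uniform convergence to zero on the unit disc. -/
def LU (F : ℕ → ℂ → ℂ) : Prop :=
  ∀ ρ : ℝ, ρ < 1 → ∀ ε : ℝ, 0 < ε → ∀ᶠ j in Filter.atTop, ∀ z : ℂ, ‖z‖ ≤ ρ → ‖F j z‖ ≤ ε

theorem LU.deriv {F : ℕ → ℂ → ℂ} (h : LU F)
    (hF : ∀ j, DifferentiableOn ℂ (F j) (Metric.ball 0 1)) : LU fun j => deriv (F j) := by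
  intro ρ hρ ε hε
  set R := (1 - ρ) / 2 with hR
  have hR0 : 0 < R := by rw [hR]; linarith
  filter_upwards [h (ρ + R) (by rw [hR]; linarith) (ε * R) (by positivity)] with j hj z hz
  have hsub : Metric.closedBall z R ⊆ Metric.ball 0 1 := fun w hw => by
    rw [mem_ball_zero_iff]
    rw [mem_closedBall_iff_norm] at hw
    have := norm_add_le z (w - z)
    rw [add_sub_cancel] at this
    linarith
  have := Complex.norm_deriv_le_of_forall_mem_sphere_norm_le (C := ε * R) hR0
    (DifferentiableOn.diffContOnCl ((hF j).mono (Metric.closure_ball_subset_closedBall.trans hsub)))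
    (fun w hw => hj w (by
      have := norm_add_le z (w - z)
      rw [add_sub_cancel, mem_sphere_iff_norm.1 hw] at this
      linarith))
  rwa [mul_div_cancel_right₀ _ hR0.ne'] at this

theorem LU.le_mul_norm {F : ℕ → ℂ → ℂ} (h : LU F)
    (hF : ∀ j, DifferentiableOn ℂ (F j) (Metric.ball 0 1)) (h0 : ∀ j, F j 0 = 0)
    {ρ : ℝ} (hρ : ρ < 1) {ε : ℝ} (hε : 0 < ε) :
    ∀ᶠ j in Filter.atTop, ∀ z : ℂ, ‖z‖ ≤ ρ → ‖F j z‖ ≤ ε * ‖z‖ := by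
  filter_upwards [h.deriv hF ρ hρ ε hε] with j hj z hz
  have := Convex.norm_image_sub_le_of_norm_deriv_le (f := F j) (C := ε)
    (s := Metric.closedBall 0 ρ) (x := 0) (y := z)
    (fun w hw => (hF j).differentiableAt (Metric.isOpen_ball.mem_nhds
      (Metric.closedBall_subset_ball hρ hw)))
    (fun w hw => hj w (mem_closedBall_zero_iff.1 hw)) (convex_closedBall _ _)
    (by simpa using (norm_nonneg z).trans hz) (by simpa using hz)
  simpa [h0] using this

theorem LU.mul_left {F : ℕ → ℂ → ℂ} (h : LU F) {g : ℂ → ℂ} (hg : ContinuousOn g (Metric.ball 0 1)) :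
    LU fun j z => g z * F j z := by
  intro ρ hρ ε hε
  obtain ⟨C, hC⟩ := (isCompact_closedBall (0 : ℂ) ρ).exists_bound_of_continuousOn
    (hg.mono (Metric.closedBall_subset_ball hρ))
  have hC' : 0 < |C| + 1 := by positivity
  filter_upwards [h ρ hρ (ε / (|C| + 1)) (by positivity)] with j hj z hz
  rw [norm_mul]
  calc ‖g z‖ * ‖F j z‖ ≤ (|C| + 1) * (ε / (|C| + 1)) := by
        gcongr
        · exact (hC z (by simpa using hz)).trans (by linarith [le_abs_self C])
        · exact hj z hz
    _ = ε := by field_simp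

theorem LU.Dz {F : ℕ → ℂ → ℂ} (h : LU F)
    (hF : ∀ j, DifferentiableOn ℂ (F j) (Metric.ball 0 1)) : LU fun j => Dz (F j) :=
  (h.deriv hF).mul_left continuousOn_id

theorem DifferentiableOn.iterate_Dz {f : ℂ → ℂ} (hf : DifferentiableOn ℂ f (Metric.ball 0 1))
    (k : ℕ) : DifferentiableOn ℂ (_root_.Dz^[k] f) (Metric.ball 0 1) := by
  induction k with
  | zero => exact hf
  | succ k ih => rw [Function.iterate_succ_apply']; exact ih.Dz

theorem LU.iterate_Dz {F : ℕ → ℂ → ℂ} (h : LU F)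
    (hF : ∀ j, DifferentiableOn ℂ (F j) (Metric.ball 0 1)) (k : ℕ) :
    LU fun j => _root_.Dz^[k] (F j) := by
  induction k with
  | zero => exact h
  | succ k ih =>
    simp only [Function.iterate_succ_apply']
    exact ih.Dz fun j => (hF j).iterate_Dz k

theorem iterate_Dz_apply_zero (f : ℂ → ℂ) (k : ℕ) (h0 : f 0 = 0) : Dz^[k] f 0 = 0 := by
  cases k with
  | zero => exact h0
  | succ k => rw [Function.iterate_succ_apply', Dz, zero_mul]

theorem iterate_Dz_sub {f g : ℂ → ℂ} (hf : DifferentiableOn ℂ f (Metric.ball 0 1))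
    (hg : DifferentiableOn ℂ g (Metric.ball 0 1)) (k : ℕ) :
    Set.EqOn (Dz^[k] fun z => f z - g z) (fun z => Dz^[k] f z - Dz^[k] g z)
      (Metric.ball 0 1) := by
  induction k with
  | zero => exact fun z _ => rfl
  | succ k ih =>
    intro z hz
    have hn := Metric.isOpen_ball.mem_nhds hz
    simp only [Function.iterate_succ_apply']
    rw [Dz, (ih.eventuallyEq_of_mem hn).deriv_eq, deriv_fun_sub
      ((hf.iterate_Dz k).differentiableAt hn) ((hg.iterate_Dz k).differentiableAt hn), Dz, Dz]
    ring

/-- Taylor coefficients, without the constant one. -/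
noncomputable def taylorCoeff (f : ℂ → ℂ) (n : ℕ) : ℂ :=
  ((n + 1).factorial : ℂ)⁻¹ * iteratedDeriv (n + 1) f 0

theorem lu_sub_taylor {f : ℂ → ℂ} (hf : DifferentiableOn ℂ f (Metric.ball 0 1)) (h0 : f 0 = 0) :
    LU fun N z => f z - polyP (taylorCoeff f) N 0 z := by
  have hs : ∀ z ∈ Metric.ball (0 : ℂ) 1, HasSum (fun n => taylorCoeff f n * z ^ (n + 1)) (f z) := by
    intro z hz
    have := Complex.hasSum_taylorSeries_on_ball hf hz
    rw [hasSum_nat_add_iff' 1 |>.symm] at this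
    simp only [Finset.range_one, Finset.sum_singleton, pow_zero, iteratedDeriv_zero, h0,
      smul_eq_mul, mul_zero, sub_zero] at this
    have he : (fun n => taylorCoeff f n * z ^ (n + 1)) = fun n =>
        ((n + 1).factorial : ℂ)⁻¹ * ((z - 0) ^ (n + 1) * iteratedDeriv (n + 1) f 0) := by
      ext n; rw [taylorCoeff, sub_zero]; ring
    rw [he]
    simpa using this
  intro ρ hρ ε hε
  rcases lt_or_ge ρ 0 with h | hρ0
  · exact Filter.Eventually.of_forall fun N z hz => absurd (norm_nonneg z) (by linarith)
  have hsum : Summable fun n => ‖taylorCoeff f n‖ * ρ ^ (n + 1) := by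
    have := (hs (ρ : ℂ) (by simpa [abs_of_nonneg hρ0] using hρ)).summable.norm
    simpa [abs_of_nonneg hρ0] using this
  have hu := tendstoUniformlyOn_tsum_nat (f := fun n z => taylorCoeff f n * z ^ (n + 1))
    (s := Metric.closedBall (0 : ℂ) ρ) hsum (fun n z hz => by
      rw [norm_mul, norm_pow]
      gcongr
      simpa using hz)
  rw [Metric.tendstoUniformlyOn_iff] at hu
  filter_upwards [hu ε hε] with N hN z hz
  have hz' : z ∈ Metric.closedBall (0 : ℂ) ρ := by simpa using hz
  have := hN z hz'
  rw [(hs z (Metric.closedBall_subset_ball hρ hz')).tsum_eq, dist_eq_norm] at this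
  refine le_trans (le_of_eq ?_) this.le
  simp [polyP]

theorem exists_ofReal_sq_mul_le {K : ℝ} (hK : 0 < K) {δ : ℝ≥0∞} (hδ : δ ≠ 0) :
    ∃ ε : ℝ, 0 < ε ∧ ENNReal.ofReal (ε ^ 2 * K) ≤ δ := by
  by_cases h : δ = ∞
  · exact ⟨1, one_pos, h ▸ le_top⟩
  · have := ENNReal.toReal_pos hδ h
    refine ⟨√(δ.toReal / K), by positivity, ?_⟩
    rw [Real.sq_sqrt (by positivity), div_mul_cancel₀ _ hK.ne', ENNReal.ofReal_toReal h]

theorem enorm_sq_le_ofReal {E : Type*} [SeminormedAddCommGroup E] {a : E} {b : ℝ} (h : ‖a‖ ≤ b) :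
    ‖a‖ₑ ^ (2 : ℝ) ≤ ENNReal.ofReal (b ^ 2) := by
  rw [ENNReal.ofReal_pow ((norm_nonneg a).trans h), ← ENNReal.rpow_natCast]
  refine ENNReal.rpow_le_rpow ?_ (by norm_num)
  rw [← ofReal_norm]
  exact ENNReal.ofReal_le_ofReal h

theorem norm_pt_le (x : ℝ) {Y t : ℝ} (h : Y ≤ t) : ‖pt x t‖ ≤ Real.exp (-Y) := by
  rw [norm_pt]; gcongr

theorem setLIntegral_pow_mul_le (k : ℕ) {w : ℂ → ℂ} {ε Y t : ℝ} (ht : 0 ≤ t)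
    (hw : ∀ z, ‖z‖ ≤ Real.exp (-Y) → ‖w z‖ ≤ ε * ‖z‖) (x : ℝ) {S : Set ℝ} (hS : S ⊆ Set.Ioi 0)
    (hSm : MeasurableSet S) (hSY : ∀ c ∈ S, Y ≤ t + c) :
    ∫⁻ c in S, ENNReal.ofReal (c ^ (2 * k + 1)) * ‖w (pt x (t + c))‖ₑ ^ (2 : ℝ) ≤
      ENNReal.ofReal (ε ^ 2 * ((2 * k + 1).factorial / 2 ^ (2 * k + 2))) := by
  calc ∫⁻ c in S, ENNReal.ofReal (c ^ (2 * k + 1)) * ‖w (pt x (t + c))‖ₑ ^ (2 : ℝ)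
      ≤ ∫⁻ c in S, ENNReal.ofReal (ε ^ 2 * (c ^ (2 * k + 1) * Real.exp (-(2 * c)))) := by
        refine setLIntegral_mono' hSm fun c hc => ?_
        have hc0 : 0 < c := hS hc
        have h1 := enorm_sq_le_ofReal (hw _ (norm_pt_le x (hSY c hc)))
        have h2 : (ε * ‖pt x (t + c)‖) ^ 2 ≤ ε ^ 2 * Real.exp (-(2 * c)) := by
          rw [mul_pow, norm_pt, ← Real.exp_nat_mul]
          gcongr
          push_cast; linarith
        calc _ ≤ ENNReal.ofReal (c ^ (2 * k + 1)) *
              ENNReal.ofReal (ε ^ 2 * Real.exp (-(2 * c))) := by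
              gcongr
              exact h1.trans (ENNReal.ofReal_le_ofReal h2)
          _ = _ := by
              rw [← ENNReal.ofReal_mul (by positivity)]; congr 1; ring
    _ ≤ ∫⁻ c in Set.Ioi 0, ENNReal.ofReal (ε ^ 2 * (c ^ (2 * k + 1) * Real.exp (-(2 * c)))) :=
        lintegral_mono_set hS
    _ = _ := by
        rw [← ofReal_integral_eq_lintegral_ofReal, integral_const_mul,
          integral_pow_mul_exp_neg_mul _ two_pos]
        · exact (integrableOn_pow_mul_exp_neg_mul _ two_pos).const_mul _
        · refine (ae_restrict_iff' measurableSet_Ioi).2 (Filter.Eventually.of_forall fun c hc => ?_)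
          have hc0 : 0 < c := hc
          simp only [Pi.zero_apply]
          positivity

theorem LU.sqfn_le {Q : ℕ → ℂ → ℂ} (h : LU Q)
    (hQ : ∀ j, DifferentiableOn ℂ (Q j) (Metric.ball 0 1)) (h0 : ∀ j, Q j 0 = 0) (k : ℕ)
    {Y : ℝ} (hY : 0 < Y) {δ : ℝ≥0∞} (hδ : δ ≠ 0) :
    ∀ᶠ j in Filter.atTop, ∀ x t, Y ≤ t → sqfn k (Q j) x t ≤ δ := by
  have hY1 : Real.exp (-Y) < 1 := by simpa using hY
  cases k with
  | zero =>
    obtain ⟨ε, hε, h1⟩ := exists_ofReal_sq_mul_le one_pos hδ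
    filter_upwards [h _ hY1 ε hε] with j hj x t ht
    rw [mul_one] at h1
    exact (enorm_sq_le_ofReal (hj _ (norm_pt_le x ht))).trans h1
  | succ k =>
    obtain ⟨ε, hε, h1⟩ := exists_ofReal_sq_mul_le
      (K := (2 * k + 1).factorial / 2 ^ (2 * k + 2)) (by positivity) hδ
    filter_upwards [(h.iterate_Dz hQ (k + 1)).le_mul_norm (fun j => (hQ j).iterate_Dz _)
      (fun j => iterate_Dz_apply_zero _ _ (h0 j)) hY1 hε] with j hj x t ht
    exact (setLIntegral_pow_mul_le k (hY.le.trans ht) hj x subset_rfl measurableSet_Ioi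
      fun c hc => by have : 0 < c := hc
                     linarith).trans h1

theorem measurable_iterate_Dz_succ (f : ℂ → ℂ) (k : ℕ) : Measurable (Dz^[k + 1] f) := by
  rw [Function.iterate_succ']
  exact measurable_id.mul (measurable_deriv _)

theorem measurable_pt : Measurable (Function.uncurry pt) := continuous_pt.measurable

theorem measurable_sqfn_integrand (f : ℂ → ℂ) (k : ℕ) (t : ℝ) :
    Measurable fun y : ℝ × ℝ => ENNReal.ofReal (y.2 ^ (2 * k + 1)) *
      ‖Dz^[k + 1] f (pt y.1 (t + y.2))‖ₑ ^ (2 : ℝ) := by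
  have h : Measurable fun y : ℝ × ℝ => pt y.1 (t + y.2) :=
    measurable_pt.comp (measurable_fst.prodMk (measurable_snd.const_add t))
  have := ((measurable_iterate_Dz_succ f k).comp h).enorm.pow_const (2 : ℝ)
  exact (by fun_prop : Measurable fun y : ℝ × ℝ => ENNReal.ofReal (y.2 ^ (2 * k + 1))).mul this

theorem measurable_sqfn_succ (f : ℂ → ℂ) (k : ℕ) (t : ℝ) :
    Measurable fun x => sqfn (k + 1) f x t :=
  (measurable_sqfn_integrand f k t).lintegral_prod_right'

theorem sqfn_le_add {f g : ℂ → ℂ} (hf : DifferentiableOn ℂ f (Metric.ball 0 1))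
    (hg : DifferentiableOn ℂ g (Metric.ball 0 1)) (k : ℕ) (x : ℝ) {t : ℝ} (ht : 0 ≤ t) :
    sqfn k f x t ≤ 4 * (sqfn k g x t + sqfn k (fun z => f z - g z) x t) := by
  cases k with
  | zero => exact enorm_sq_le_add _ _
  | succ k =>
    have hm : ∀ f, Measurable fun c => ENNReal.ofReal (c ^ (2 * k + 1)) *
        ‖Dz^[k + 1] f (pt x (t + c))‖ₑ ^ (2 : ℝ) := fun f =>
      (measurable_sqfn_integrand f k t).comp measurable_prodMk_left
    rw [sqfn, sqfn, sqfn, ← lintegral_add_left (hm g),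
      ← lintegral_const_mul' _ _ (by finiteness)]
    refine setLIntegral_mono' measurableSet_Ioi fun c hc => ?_
    have hc0 : 0 < c := hc
    rw [iterate_Dz_sub hf hg (k + 1) (pt_mem_ball x (by linarith))]
    calc _ ≤ ENNReal.ofReal (c ^ (2 * k + 1)) * (4 * _) := by
          gcongr
          exact enorm_sq_le_add _ (Dz^[k + 1] g (pt x (t + c)))
      _ = _ := by ring

theorem circ_mono {u v : ℝ → ℝ≥0∞} (h : ∀ x, u x ≤ v x) : circ u ≤ circ v := lintegral_mono h

theorem circ_const (a : ℝ≥0∞) : circ (fun _ => a) = ENNReal.ofReal (2 * Real.pi) * a := by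
  rw [circ, setLIntegral_const, Real.volume_Ioc, sub_zero, mul_comm]

theorem circ_const_mul {a : ℝ≥0∞} (ha : a ≠ ∞) (u : ℝ → ℝ≥0∞) :
    circ (fun x => a * u x) = a * circ u := lintegral_const_mul' _ _ ha

theorem circ_rpow_le_of_le {u v : ℝ → ℝ≥0∞} {δ : ℝ≥0∞} {r : ℝ} (hr : 0 ≤ r)
    (h : ∀ x, u x ≤ 4 * (v x + δ)) :
    circ (fun x => u x ^ r) ≤
      8 ^ r * (circ (fun x => v x ^ r) + ENNReal.ofReal (2 * Real.pi) * δ ^ r) := by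
  rw [← circ_const]
  unfold circ
  rw [← lintegral_add_right _ measurable_const, ← lintegral_const_mul' _ _ (by finiteness)]
  refine lintegral_mono fun x => (ENNReal.rpow_le_rpow (h x) hr).trans ?_
  rw [show (8 : ℝ≥0∞) = 4 * 2 by norm_num, ENNReal.mul_rpow_of_nonneg _ _ hr,
    ENNReal.mul_rpow_of_nonneg _ _ hr, mul_assoc]
  gcongr
  exact ENNReal.add_rpow_le_two_rpow_mul _ _ hr

theorem ENNReal.le_of_forall_le_add_rpow {A B b : ℝ≥0∞} {r : ℝ} (hr : 0 < r) (hb : b ≠ ∞)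
    (h : ∀ δ : ℝ≥0∞, δ ≠ 0 → A ≤ B + b * δ ^ r) : A ≤ B := by
  have h1 : Filter.Tendsto (fun n : ℕ => B + b * ((n : ℝ≥0∞)⁻¹) ^ r) Filter.atTop
      (nhds (B + b * 0 ^ r)) :=
    (ENNReal.Tendsto.const_mul ((ENNReal.continuous_rpow_const.tendsto 0).comp
      ENNReal.tendsto_inv_nat_nhds_zero) (Or.inr hb)).const_add B
  rw [ENNReal.zero_rpow_of_pos hr, mul_zero, add_zero] at h1
  exact ge_of_tendsto' h1 fun n => h _ (by simp)

theorem circ_sqfn_transfer {i j : ℕ} {r : ℝ} (hr : 0 < r) {C : ℝ≥0∞} (hC : C ≠ ∞)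
    (h : ∀ (a : ℕ → ℂ) (N : ℕ) (t : ℝ), 0 < t →
      circ (fun x => sqfn i (polyP a N 0) x t ^ r) ≤
        C * circ (fun x => sqfn j (polyP a N 0) x t ^ r))
    {f : ℂ → ℂ} (hf : DifferentiableOn ℂ f (Metric.ball 0 1)) (h0 : f 0 = 0) {t : ℝ}
    (ht : 0 < t) :
    circ (fun x => sqfn i f x t ^ r) ≤
      (8 ^ r * (C * 8 ^ r)) * circ (fun x => sqfn j f x t ^ r) := by
  have hP : ∀ N, DifferentiableOn ℂ (polyP (taylorCoeff f) N 0) (Metric.ball 0 1) := fun N =>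
    (differentiable_polyP _ _ _).differentiableOn
  have hlu := lu_sub_taylor hf h0
  have hlu' : LU fun N z => polyP (taylorCoeff f) N 0 z - f z := fun ρ hρ ε hε =>
    (hlu ρ hρ ε hε).mono fun N hN z hz => by rw [norm_sub_rev]; exact hN z hz
  refine ENNReal.le_of_forall_le_add_rpow (r := r)
    (b := 8 ^ r * (C * (8 ^ r * ENNReal.ofReal (2 * Real.pi)) + ENNReal.ofReal (2 * Real.pi)))
    hr (by finiteness) fun δ hδ => ?_
  obtain ⟨N, h1, h2⟩ := ((hlu.sqfn_le (fun N => hf.sub (hP N)) (by simp [h0, polyP_zero]) i ht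
    hδ).and (hlu'.sqfn_le (fun N => (hP N).sub hf) (by simp [h0, polyP_zero]) j ht hδ)).exists
  have e1 := circ_rpow_le_of_le hr.le fun x => (sqfn_le_add hf (hP N) i x ht.le).trans
    (mul_le_mul_right (add_le_add_right (h1 x t le_rfl) _) _)
  have e2 := circ_rpow_le_of_le hr.le fun x => (sqfn_le_add (hP N) hf j x ht.le).trans
    (mul_le_mul_right (add_le_add_right (h2 x t le_rfl) _) _)
  refine e1.trans ((mul_le_mul_right (add_le_add_left ((h _ N t ht).trans
    (mul_le_mul_right e2 _)) _) _).trans (le_of_eq ?_))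
  ring

/-- Consecutive square functions have comparable means. -/
theorem circ_sqfn_comparable (k : ℕ) {r : ℝ} (hr : 0 < r) :
    ∃ C : ℝ≥0∞, C ≠ ∞ ∧ ∀ f : ℂ → ℂ, DifferentiableOn ℂ f (Metric.ball 0 1) → f 0 = 0 →
      ∀ t : ℝ, 0 < t →
      circ (fun x => sqfn (k + 1) f x t ^ r) ≤ C * circ (fun x => sqfn k f x t ^ r) ∧
      circ (fun x => sqfn k f x t ^ r) ≤ C * circ (fun x => sqfn (k + 1) f x t ^ r) := by
  obtain ⟨C, hC, h⟩ := circ_sqfn_polyP_comparable k hr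
  exact ⟨8 ^ r * (C * 8 ^ r), by finiteness, fun f hf h0 t ht =>
    ⟨circ_sqfn_transfer hr hC (fun a N t ht => (h a N t ht).1) hf h0 ht,
      circ_sqfn_transfer hr hC (fun a N t ht => (h a N t ht).2) hf h0 ht⟩⟩

/-- The `p`-means of `f` over circles in the unit disc are at most `B`. -/
def Bd (p : ℝ) (f : ℂ → ℂ) (B : ℝ≥0∞) : Prop :=
  ∀ t : ℝ, 0 < t → circ (fun x => ‖f (pt x t)‖ₑ ^ p) ≤ B

/-- `F j → 0` in the Hardy space of exponent `q`. -/
def HSmall (q : ℝ) (F : ℕ → ℂ → ℂ) : Prop :=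
  ∀ ε : ℝ≥0∞, ε ≠ 0 → ∀ᶠ j in Filter.atTop, Bd q (F j) ε

theorem circ_sqfn_zero_index (f : ℂ → ℂ) (r t : ℝ) :
    circ (fun x => sqfn 0 f x t ^ r) = circ fun x => ‖f (pt x t)‖ₑ ^ (2 * r) := by
  simp only [sqfn, ← ENNReal.rpow_mul]

theorem sqfn_succ_le_zero (k : ℕ) (f : ℂ → ℂ) (x : ℝ) {t : ℝ} (ht : 0 ≤ t) :
    sqfn (k + 1) f x t ≤ sqfn (k + 1) f x 0 := by
  let H : ℝ → ℝ≥0∞ := fun c => ENNReal.ofReal (c ^ (2 * k + 1)) *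
    ‖Dz^[k + 1] f (pt x c)‖ₑ ^ (2 : ℝ)
  have h1 : ∫⁻ c in Set.Ioi (0 : ℝ), H (t + c) = ∫⁻ c in Set.Ioi t, H c := by
    have := (measurePreserving_add_left volume t).setLIntegral_comp_preimage_emb
      (MeasurableEquiv.addLeft t).measurableEmbedding H (Set.Ioi t)
    rwa [show (t + ·) ⁻¹' Set.Ioi t = Set.Ioi 0 by ext c; simp] at this
  calc sqfn (k + 1) f x t ≤ ∫⁻ c in Set.Ioi (0 : ℝ), H (t + c) := by
        refine setLIntegral_mono' measurableSet_Ioi fun c hc => ?_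
        have hc0 : 0 < c := hc
        simp only [H]
        gcongr
        linarith
    _ = ∫⁻ c in Set.Ioi t, H c := h1
    _ ≤ ∫⁻ c in Set.Ioi 0, H c := lintegral_mono_set (Set.Ioi_subset_Ioi ht)
    _ = sqfn (k + 1) f x 0 := by simp [sqfn, H]

theorem sqfn_succ_zero_le_liminf (k : ℕ) {f : ℂ → ℂ}
    (hf : DifferentiableOn ℂ f (Metric.ball 0 1)) (x : ℝ) :
    sqfn (k + 1) f x 0 ≤
      Filter.liminf (fun n : ℕ => sqfn (k + 1) f x (1 / ((n : ℝ) + 1))) Filter.atTop := by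
  have hm : ∀ t, Measurable fun c => ENNReal.ofReal (c ^ (2 * k + 1)) *
      ‖Dz^[k + 1] f (pt x (t + c))‖ₑ ^ (2 : ℝ) := fun t =>
    (measurable_sqfn_integrand f k t).comp measurable_prodMk_left
  simp only [sqfn]
  refine le_trans ?_ (lintegral_liminf_le fun n : ℕ => hm (1 / ((n : ℝ) + 1)))
  refine setLIntegral_mono' measurableSet_Ioi fun c hc => ?_
  have hc0 : 0 < c := hc
  refine le_of_eq (Filter.Tendsto.liminf_eq ?_).symm
  refine ENNReal.Tendsto.const_mul ?_ (Or.inr ENNReal.ofReal_ne_top)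
  refine (ENNReal.continuous_rpow_const.tendsto _).comp (Filter.Tendsto.enorm ?_)
  have hc1 : ContinuousAt (Dz^[k + 1] f) (pt x (0 + c)) :=
    ((hf.iterate_Dz (k + 1)).differentiableAt
      (Metric.isOpen_ball.mem_nhds (pt_mem_ball x (by linarith)))).continuousAt
  refine hc1.tendsto.comp ?_
  have hc2 : Continuous fun t => pt x (t + c) :=
    continuous_pt.comp (continuous_const.prodMk (continuous_add_const c))
  exact (hc2.tendsto 0).comp tendsto_one_div_add_atTop_nhds_zero_nat

theorem circ_sqfn_succ_zero_le (k : ℕ) {r : ℝ} (hr : 0 < r) {f : ℂ → ℂ}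
    (hf : DifferentiableOn ℂ f (Metric.ball 0 1)) {B : ℝ≥0∞}
    (hB : ∀ t, 0 < t → circ (fun x => sqfn (k + 1) f x t ^ r) ≤ B) :
    circ (fun x => sqfn (k + 1) f x 0 ^ r) ≤ B := by
  calc circ (fun x => sqfn (k + 1) f x 0 ^ r)
      ≤ circ fun x => Filter.liminf
          (fun n : ℕ => sqfn (k + 1) f x (1 / ((n : ℝ) + 1)) ^ r) Filter.atTop := by
        refine circ_mono fun x => ?_
        refine (ENNReal.rpow_le_rpow (sqfn_succ_zero_le_liminf k hf x) hr.le).trans (le_of_eq ?_)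
        exact (ENNReal.orderIsoRpow r hr).liminf_apply
    _ ≤ Filter.liminf (fun n : ℕ => circ fun x => sqfn (k + 1) f x (1 / ((n : ℝ) + 1)) ^ r)
          Filter.atTop :=
        lintegral_liminf_le fun n => (measurable_sqfn_succ f k _).pow_const r
    _ ≤ B := by
        refine Filter.liminf_le_of_le (by isBoundedDefault) fun b hb => ?_
        obtain ⟨n, hn⟩ := hb.exists
        exact hn.trans (hB _ (by positivity))

/-- Square functions up to the boundary are controlled by the Hardy means. -/
theorem circ_sqfn_succ_zero_le_of_bd (k : ℕ) {p : ℝ} (hp : 0 < p) :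
    ∃ C : ℝ≥0∞, C ≠ ∞ ∧ ∀ f : ℂ → ℂ, DifferentiableOn ℂ f (Metric.ball 0 1) → f 0 = 0 →
      ∀ B, Bd p f B → circ (fun x => sqfn (k + 1) f x 0 ^ (p / 2)) ≤ C * B := by
  have hr : 0 < p / 2 := by positivity
  have key : ∃ C : ℝ≥0∞, C ≠ ∞ ∧ ∀ f : ℂ → ℂ, DifferentiableOn ℂ f (Metric.ball 0 1) → f 0 = 0 →
      ∀ B, Bd p f B → ∀ t, 0 < t → circ (fun x => sqfn k f x t ^ (p / 2)) ≤ C * B := by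
    induction k with
    | zero =>
      refine ⟨1, by simp, fun f hf h0 B hB t ht => ?_⟩
      rw [circ_sqfn_zero_index, mul_div_cancel₀ _ two_ne_zero, one_mul]
      exact hB t ht
    | succ k ih =>
      obtain ⟨C, hC, h⟩ := ih
      obtain ⟨D, hD, h'⟩ := circ_sqfn_comparable k hr
      refine ⟨D * C, by finiteness, fun f hf h0 B hB t ht => ?_⟩
      refine (h' f hf h0 t ht).1.trans ?_
      rw [mul_assoc]
      exact mul_le_mul_right (h f hf h0 B hB t ht) _
  obtain ⟨C, hC, h⟩ := key
  obtain ⟨D, hD, h'⟩ := circ_sqfn_comparable k hr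
  refine ⟨D * C, by finiteness, fun f hf h0 B hB => circ_sqfn_succ_zero_le k hr hf fun t ht => ?_⟩
  refine (h' f hf h0 t ht).1.trans ?_
  rw [mul_assoc]
  exact mul_le_mul_right (h f hf h0 B hB t ht) _

/-- The part of a square function near the boundary. -/
noncomputable def tsq (k : ℕ) (f : ℂ → ℂ) (x Y : ℝ) : ℝ≥0∞ :=
  ∫⁻ c in Set.Ioo (0 : ℝ) Y, ENNReal.ofReal (c ^ (2 * k + 1)) *
      ‖Dz^[k + 1] f (pt x c)‖ₑ ^ (2 : ℝ)

theorem tsq_mono (k : ℕ) (f : ℂ → ℂ) (x : ℝ) {Y Z : ℝ} (h : Y ≤ Z) : tsq k f x Y ≤ tsq k f x Z :=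
  lintegral_mono_set (Set.Ioo_subset_Ioo_right h)

theorem tsq_le_sqfn (k : ℕ) (f : ℂ → ℂ) (x Y : ℝ) : tsq k f x Y ≤ sqfn (k + 1) f x 0 := by
  simp only [sqfn, zero_add]
  exact lintegral_mono_set Set.Ioo_subset_Ioi_self

theorem measurable_tsq (k : ℕ) (f : ℂ → ℂ) (Y : ℝ) : Measurable fun x => tsq k f x Y := by
  have := (measurable_sqfn_integrand f k 0).lintegral_prod_right'
    (ν := volume.restrict (Set.Ioo 0 Y))
  simpa only [zero_add, tsq] using this

theorem LU.circ_sqfn_small {Q : ℕ → ℂ → ℂ} (h : LU Q)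
    (hQ : ∀ j, DifferentiableOn ℂ (Q j) (Metric.ball 0 1)) (h0 : ∀ j, Q j 0 = 0) (k : ℕ)
    {r : ℝ} (hr : 0 < r)
    (ht : ∀ ε : ℝ≥0∞, ε ≠ 0 → ∃ Y : ℝ, 0 < Y ∧ ∀ᶠ j in Filter.atTop,
      circ (fun x => tsq k (Q j) x Y ^ r) ≤ ε) {ε : ℝ≥0∞} (hε : ε ≠ 0) :
    ∀ᶠ j in Filter.atTop, circ (fun x => sqfn (k + 1) (Q j) x 0 ^ r) ≤ ε := by
  have hcont : Filter.Tendsto (fun n : ℕ => (8 : ℝ≥0∞) ^ r * (((n : ℝ≥0∞)⁻¹) +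
      ENNReal.ofReal (2 * Real.pi) * ((n : ℝ≥0∞)⁻¹) ^ r)) Filter.atTop
      (nhds (8 ^ r * (0 + ENNReal.ofReal (2 * Real.pi) * 0 ^ r))) := by
    refine ENNReal.Tendsto.const_mul (ENNReal.tendsto_inv_nat_nhds_zero.add ?_)
      (Or.inr (by finiteness))
    exact ENNReal.Tendsto.const_mul ((ENNReal.continuous_rpow_const.tendsto 0).comp
      ENNReal.tendsto_inv_nat_nhds_zero) (Or.inr (by finiteness))
  rw [ENNReal.zero_rpow_of_pos hr, mul_zero, add_zero, mul_zero] at hcont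
  obtain ⟨n, hn⟩ := (hcont.eventually_le_const (pos_iff_ne_zero.2 hε)).exists
  have hδ : (n : ℝ≥0∞)⁻¹ ≠ 0 := by simp
  obtain ⟨Y, hY, htail⟩ := ht _ hδ
  obtain ⟨η, hη, h1⟩ := exists_ofReal_sq_mul_le
    (K := (2 * k + 1).factorial / 2 ^ (2 * k + 2)) (by positivity) hδ
  filter_upwards [htail, (h.iterate_Dz hQ (k + 1)).le_mul_norm (fun j => (hQ j).iterate_Dz _)
      (fun j => iterate_Dz_apply_zero _ _ (h0 j)) (by simpa using hY : Real.exp (-Y) < 1) hη]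
    with j hj1 hj2
  refine (circ_rpow_le_of_le (v := fun x => tsq k (Q j) x Y) (δ := (n : ℝ≥0∞)⁻¹) hr.le
    fun x => ?_).trans (le_trans (by gcongr) hn)
  have hsplit : Set.Ioi (0 : ℝ) = Set.Ioo 0 Y ∪ Set.Ici Y := (Set.Ioo_union_Ici_eq_Ioi hY).symm
  calc sqfn (k + 1) (Q j) x 0 ≤ tsq k (Q j) x Y + (n : ℝ≥0∞)⁻¹ := by
        rw [sqfn, hsplit]
        refine (lintegral_union_le _ _ _).trans (add_le_add (by simp only [zero_add]; rfl) ?_)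
        exact (setLIntegral_pow_mul_le k le_rfl hj2 x
          (fun c (hc : Y ≤ c) => hY.trans_le hc) measurableSet_Ici
          (fun c (hc : Y ≤ c) => by simpa using hc)).trans h1
    _ ≤ 4 * (tsq k (Q j) x Y + (n : ℝ≥0∞)⁻¹) := le_mul_of_one_le_left' (by norm_num)

/-- Near-boundary parts of a square function in `L^r` tend to zero. -/
theorem exists_circ_tsq_le (k : ℕ) (f : ℂ → ℂ) {r : ℝ} (hr : 0 < r)
    (hfin : circ (fun x => sqfn (k + 1) f x 0 ^ r) ≠ ∞) {ε : ℝ≥0∞} (hε : ε ≠ 0) :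
    ∃ Y : ℝ, 0 < Y ∧ circ (fun x => tsq k f x Y ^ r) ≤ ε := by
  have hY : ∀ n : ℕ, 0 < 1 / ((n : ℝ) + 1) := fun n => by positivity
  suffices h : Filter.Tendsto (fun n : ℕ => circ fun x => tsq k f x (1 / ((n : ℝ) + 1)) ^ r)
      Filter.atTop (nhds (∫⁻ x in Set.Ioc 0 (2 * Real.pi), 0)) by
    rw [lintegral_zero] at h
    obtain ⟨n, hn⟩ := (h.eventually_le_const (pos_iff_ne_zero.2 hε)).exists
    exact ⟨_, hY n, hn⟩
  refine tendsto_lintegral_of_dominated_convergence (fun x => sqfn (k + 1) f x 0 ^ r)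
    (fun n => (measurable_tsq k f _).pow_const r)
    (fun n => Filter.Eventually.of_forall fun x =>
      ENNReal.rpow_le_rpow (tsq_le_sqfn k f x _) hr.le) hfin ?_
  filter_upwards [ae_lt_top ((measurable_sqfn_succ f k 0).pow_const r) hfin] with x hx
  have hx' : sqfn (k + 1) f x 0 ≠ ∞ := fun h => by
    rw [h, ENNReal.top_rpow_of_pos hr] at hx; exact lt_irrefl _ hx
  rw [← ENNReal.zero_rpow_of_pos hr]
  refine (ENNReal.continuous_rpow_const.tendsto _).comp ?_
  have h1 := tendsto_setLIntegral_zero (μ := volume.restrict (Set.Ioi (0 : ℝ)))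
    (f := fun c => ENNReal.ofReal (c ^ (2 * k + 1)) * ‖Dz^[k + 1] f (pt x (0 + c))‖ₑ ^ (2 : ℝ))
    (s := fun n : ℕ => Set.Ioo (0 : ℝ) (1 / ((n : ℝ) + 1))) (l := Filter.atTop) hx' ?_
  · refine h1.congr fun n => ?_
    rw [Measure.restrict_restrict measurableSet_Ioo,
      Set.inter_eq_left.2 Set.Ioo_subset_Ioi_self]
    simp only [tsq, zero_add]
  · refine tendsto_of_tendsto_of_tendsto_of_le_of_le tendsto_const_nhds
      (h := fun n : ℕ => ENNReal.ofReal (1 / ((n : ℝ) + 1))) ?_ (fun n => bot_le) fun n => ?_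
    · have := (ENNReal.continuous_ofReal.tendsto 0).comp
        (tendsto_one_div_add_atTop_nhds_zero_nat (𝕜 := ℝ))
      simpa [Function.comp_def] using this
    · refine (Measure.restrict_apply_le _ _).trans ?_
      simp

theorem ENNReal.exists_mul_le {C ε : ℝ≥0∞} (hC : C ≠ ∞) (hε : ε ≠ 0) :
    ∃ η : ℝ≥0∞, η ≠ 0 ∧ C * η ≤ ε := by
  refine ⟨ε / (C + 1), ENNReal.div_ne_zero.2 ⟨hε, by finiteness⟩, ?_⟩
  exact (mul_le_mul_left le_self_add _).trans ENNReal.mul_div_le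

theorem ENNReal.mul_rpow_le_add {p s q : ℝ} (hp : 0 < p) (hs : 0 < s) (hq : 0 < q)
    (hpsq : 1 / q = 1 / p + 1 / s) (x y : ℝ≥0∞) : (x * y) ^ q ≤ x ^ p + y ^ s := by
  have e1 : q / p + q / s = 1 := by
    have : q * (1 / q) = 1 := by field_simp
    rw [hpsq] at this
    rw [← this]; ring
  have hx : x ^ q = (x ^ p) ^ (q / p) := by rw [← ENNReal.rpow_mul, mul_div_cancel₀ _ hp.ne']
  have hy : y ^ q = (y ^ s) ^ (q / s) := by rw [← ENNReal.rpow_mul, mul_div_cancel₀ _ hs.ne']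
  rw [ENNReal.mul_rpow_of_nonneg _ _ hq.le, hx, hy]
  calc (x ^ p) ^ (q / p) * (y ^ s) ^ (q / s)
      ≤ (max (x ^ p) (y ^ s)) ^ (q / p) * (max (x ^ p) (y ^ s)) ^ (q / s) := by
        gcongr
        · exact le_max_left _ _
        · exact le_max_right _ _
    _ = max (x ^ p) (y ^ s) := by
        rw [← ENNReal.rpow_add_of_nonneg _ _ (by positivity) (by positivity), e1, ENNReal.rpow_one]
    _ ≤ _ := max_le le_self_add le_add_self

theorem ENNReal.exists_scale {p : ℝ} (s : ℝ) (hp : 0 < p) {C B ε : ℝ≥0∞} (hC : C ≠ ∞)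
    (hB : B ≠ ∞) (hε : ε ≠ 0) : ∃ l : ℝ, 0 < l ∧ ∃ η : ℝ≥0∞, η ≠ 0 ∧ ∀ X ≤ B, ∀ Z ≤ η,
      C * (ENNReal.ofReal l ^ p * X + ENNReal.ofReal l⁻¹ ^ s * Z) ≤ ε := by
  have h2 : ε / 2 ≠ 0 := ENNReal.div_ne_zero.2 ⟨hε, by simp⟩
  have h1 : Filter.Tendsto (fun n : ℕ => ENNReal.ofReal (1 / ((n : ℝ) + 1)) ^ p * (C * B))
      Filter.atTop (nhds (0 ^ p * (C * B))) := by
    refine ENNReal.Tendsto.mul_const ((ENNReal.continuous_rpow_const.tendsto 0).comp ?_)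
      (Or.inr (by finiteness))
    simpa [Function.comp_def] using (ENNReal.continuous_ofReal.tendsto 0).comp
        (tendsto_one_div_add_atTop_nhds_zero_nat (𝕜 := ℝ))
  rw [ENNReal.zero_rpow_of_pos hp, zero_mul] at h1
  obtain ⟨n, hn⟩ := (h1.eventually_le_const (pos_iff_ne_zero.2 h2)).exists
  obtain ⟨η, hη, hη1⟩ := ENNReal.exists_mul_le
    (C := C * ENNReal.ofReal (1 / ((n : ℝ) + 1))⁻¹ ^ s) (by finiteness) h2
  refine ⟨1 / ((n : ℝ) + 1), by positivity, η, hη, fun X hX Z hZ => ?_⟩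
  rw [← ENNReal.add_halves ε, mul_add]
  refine add_le_add (le_trans ?_ hn) (le_trans ?_ hη1)
  · rw [mul_left_comm]; gcongr
  · rw [← mul_assoc]; gcongr

theorem Bd.mono {p : ℝ} {f : ℂ → ℂ} {A B : ℝ≥0∞} (h : Bd p f A) (hAB : A ≤ B) : Bd p f B :=
  fun t ht => (h t ht).trans hAB

theorem circ_add_rpow_le {u v : ℝ → ℝ≥0∞} (hu : Measurable u) {p : ℝ} (hp : 0 ≤ p) :
    circ (fun x => (u x + v x) ^ p) ≤
      2 ^ p * (circ (fun x => u x ^ p) + circ (fun x => v x ^ p)) := by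
  unfold circ
  rw [← lintegral_add_left (hu.pow_const p), ← lintegral_const_mul' _ _ (by finiteness)]
  exact lintegral_mono fun x => ENNReal.add_rpow_le_two_rpow_mul _ _ hp

theorem Bd.of_le_add {p : ℝ} (hp : 0 ≤ p) {f g h : ℂ → ℂ}
    (hf : DifferentiableOn ℂ f (Metric.ball 0 1)) {A B : ℝ≥0∞} (hA : Bd p f A) (hB : Bd p g B)
    (hh : ∀ z ∈ Metric.ball (0 : ℂ) 1, ‖h z‖ ≤ ‖f z‖ + ‖g z‖) : Bd p h (2 ^ p * (A + B)) := by
  intro t ht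
  calc circ (fun x => ‖h (pt x t)‖ₑ ^ p)
      ≤ circ fun x => (‖f (pt x t)‖ₑ + ‖g (pt x t)‖ₑ) ^ p := by
        refine circ_mono fun x => ENNReal.rpow_le_rpow ?_ hp
        rw [← ofReal_norm, ← ofReal_norm, ← ofReal_norm,
          ← ENNReal.ofReal_add (norm_nonneg _) (norm_nonneg _)]
        exact ENNReal.ofReal_le_ofReal (hh _ (pt_mem_ball x ht))
    _ ≤ _ := circ_add_rpow_le (continuous_comp_pt hf ht).measurable.enorm hp
    _ ≤ _ := by gcongr; exacts [hA t ht, hB t ht]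

theorem Bd.of_forall_le {p : ℝ} (hp : 0 ≤ p) {f : ℂ → ℂ} {a : ℝ≥0∞}
    (h : ∀ z ∈ Metric.ball (0 : ℂ) 1, ‖f z‖ₑ ≤ a) :
    Bd p f (ENNReal.ofReal (2 * Real.pi) * a ^ p) := by
  intro t ht
  rw [← circ_const]
  exact circ_mono fun x => ENNReal.rpow_le_rpow (h _ (pt_mem_ball x ht)) hp

theorem HSmall.of_le_add {p : ℝ} (hp : 0 ≤ p) {F G H : ℕ → ℂ → ℂ}
    (hFd : ∀ j, DifferentiableOn ℂ (F j) (Metric.ball 0 1)) (hF : HSmall p F) (hG : HSmall p G)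
    (hH : ∀ j, ∀ z ∈ Metric.ball (0 : ℂ) 1, ‖H j z‖ ≤ ‖F j z‖ + ‖G j z‖) : HSmall p H := by
  intro ε hε
  obtain ⟨η, hη, h⟩ := ENNReal.exists_mul_le (C := 2 ^ p * 2) (by finiteness) hε
  filter_upwards [hF η hη, hG η hη] with j h1 h2
  refine (Bd.of_le_add hp (hFd j) h1 h2 (hH j)).mono (le_trans (le_of_eq ?_) h)
  ring

theorem HSmall.of_exponent_lt {p q : ℝ} (hq : 0 < q) (hqp : q < p) {F : ℕ → ℂ → ℂ}
    (hF : HSmall p F) : HSmall q F := by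
  intro ε hε
  have h2 : ε / 2 ≠ 0 := ENNReal.div_ne_zero.2 ⟨hε, by simp⟩
  obtain ⟨a, ha, h⟩ := ENNReal.exists_mul_le (C := ENNReal.ofReal (2 * Real.pi)) (by finiteness) h2
  set b := min a 1 with hb
  have hb0 : b ≠ 0 := by simp [hb, ha]
  have hbt : b ≠ ∞ := ne_top_of_le_ne_top one_ne_top (min_le_right _ _)
  obtain ⟨η, hη, h'⟩ := ENNReal.exists_mul_le (C := (b ^ (1 / q)) ^ (q - p)) (by
    rw [← ENNReal.rpow_mul]
    exact ENNReal.rpow_ne_top_of_ne_zero hb0 hbt) h2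
  filter_upwards [hF η hη] with j hj t ht
  have hkey : ∀ y : ℝ≥0∞, y ^ q ≤ (b ^ (1 / q)) ^ (q - p) * y ^ p + b := by
    intro y
    rcases le_total y (b ^ (1 / q)) with hy | hy
    · refine (ENNReal.rpow_le_rpow hy hq.le).trans ?_
      rw [← ENNReal.rpow_mul, one_div_mul_cancel hq.ne', ENNReal.rpow_one]
      exact le_add_self
    · refine le_trans ?_ le_self_add
      rcases eq_or_ne y ∞ with rfl | hyt
      · rw [ENNReal.top_rpow_of_pos (hq.trans hqp), ENNReal.mul_top]
        · exact le_top
        · rw [← ENNReal.rpow_mul]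
          exact (ENNReal.rpow_pos (pos_iff_ne_zero.2 hb0) hbt).ne'
      · have hb1 : 0 < b ^ (1 / q) := ENNReal.rpow_pos (pos_iff_ne_zero.2 hb0) hbt
        have hy0 : y ≠ 0 := (hb1.trans_le hy).ne'
        calc y ^ q = y ^ (q - p) * y ^ p := by
              rw [← ENNReal.rpow_add _ _ hy0 hyt, sub_add_cancel]
          _ ≤ _ := by
              gcongr ?_ * _
              rw [← neg_sub p q, ENNReal.rpow_neg, ENNReal.rpow_neg, ENNReal.inv_le_inv]
              exact ENNReal.rpow_le_rpow hy (by linarith)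
  calc circ (fun x => ‖F j (pt x t)‖ₑ ^ q)
      ≤ circ fun x => (b ^ (1 / q)) ^ (q - p) * ‖F j (pt x t)‖ₑ ^ p + b :=
        circ_mono fun x => hkey _
    _ = (b ^ (1 / q)) ^ (q - p) * circ (fun x => ‖F j (pt x t)‖ₑ ^ p) +
          ENNReal.ofReal (2 * Real.pi) * b := by
        rw [← circ_const, ← circ_const_mul]
        · exact lintegral_add_right _ measurable_const
        · rw [← ENNReal.rpow_mul]
          exact ENNReal.rpow_ne_top_of_ne_zero hb0 hbt
    _ ≤ ε / 2 + ε / 2 := by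
        gcongr
        · exact (mul_le_mul_right (hj t ht) _).trans h'
        · exact (mul_le_mul_right (min_le_left _ _) _).trans h
    _ = ε := ENNReal.add_halves ε

theorem hsmall_of_circ_sqfn {p : ℝ} (hp : 0 < p) {Q : ℕ → ℂ → ℂ}
    (hQ : ∀ j, DifferentiableOn ℂ (Q j) (Metric.ball 0 1)) (h0 : ∀ j, Q j 0 = 0)
    (h : ∀ ε : ℝ≥0∞, ε ≠ 0 → ∀ᶠ j in Filter.atTop,
      circ (fun x => sqfn 1 (Q j) x 0 ^ (p / 2)) ≤ ε) : HSmall p Q := by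
  intro ε hε
  have hr : 0 < p / 2 := by positivity
  obtain ⟨C, hC, hcomp⟩ := circ_sqfn_comparable 0 hr
  obtain ⟨η, hη, h1⟩ := ENNReal.exists_mul_le hC hε
  filter_upwards [h η hη] with j hj t ht
  have h2 := (hcomp (Q j) (hQ j) (h0 j) t ht).2
  rw [circ_sqfn_zero_index, mul_div_cancel₀ _ two_ne_zero] at h2
  refine h2.trans (le_trans ?_ h1)
  gcongr
  exact (circ_mono fun x => ENNReal.rpow_le_rpow (sqfn_succ_le_zero 0 _ x ht.le) hr.le).trans hj

/-- Dilations. -/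
noncomputable def dil (d : ℝ) (f : ℂ → ℂ) (z : ℂ) : ℂ := f (Real.exp (-d) * z)

theorem dil_pt (d : ℝ) (f : ℂ → ℂ) (x c : ℝ) : dil d f (pt x c) = f (pt x (c + d)) := by
  rw [dil, pt_add, mul_comm]

theorem Dz_dil (d : ℝ) (f : ℂ → ℂ) : Dz (dil d f) = dil d (Dz f) := by
  ext z
  unfold Dz dil
  rw [deriv_comp_mul_left (Real.exp (-d) : ℂ) f z, smul_eq_mul]
  ring

theorem norm_exp_neg_mul_le {d : ℝ} (hd : 0 ≤ d) (z : ℂ) : ‖(Real.exp (-d) : ℂ) * z‖ ≤ ‖z‖ := by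
  rw [norm_mul, Complex.norm_real, Real.norm_eq_abs, Real.abs_exp]
  exact mul_le_of_le_one_left (norm_nonneg _) (by simpa using hd)

theorem DifferentiableOn.dil {f : ℂ → ℂ} (hf : DifferentiableOn ℂ f (Metric.ball 0 1)) {d : ℝ}
    (hd : 0 ≤ d) : DifferentiableOn ℂ (_root_.dil d f) (Metric.ball 0 1) := by
  refine hf.comp (by fun_prop) fun z hz => ?_
  rw [mem_ball_zero_iff] at hz ⊢
  exact (norm_exp_neg_mul_le hd z).trans_lt hz

theorem lu_sub_dil {f : ℂ → ℂ} (hf : DifferentiableOn ℂ f (Metric.ball 0 1)) :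
    LU fun n z => f z - dil (1 / ((n : ℝ) + 1)) f z := by
  intro ρ hρ ε hε
  have hu := (isCompact_closedBall (0 : ℂ) ρ).uniformContinuousOn_of_continuous
    (hf.continuousOn.mono (Metric.closedBall_subset_ball hρ))
  obtain ⟨δ, hδ, h⟩ := Metric.uniformContinuousOn_iff.1 hu ε hε
  filter_upwards [(tendsto_one_div_add_atTop_nhds_zero_nat (𝕜 := ℝ)).eventually_lt_const hδ]
    with n hn z hz
  have hd : (0 : ℝ) ≤ 1 / ((n : ℝ) + 1) := by positivity
  rw [← dist_eq_norm]
  refine (h z (by simpa using hz) _ (by simpa using (norm_exp_neg_mul_le hd z).trans hz) ?_).le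
  refine lt_of_le_of_lt ?_ hn
  set d := 1 / ((n : ℝ) + 1)
  have h1 : 0 ≤ 1 - Real.exp (-d) := by simpa using hd
  rw [dist_eq_norm, show z - (Real.exp (-d) : ℂ) * z = ((1 - Real.exp (-d) : ℝ) : ℂ) * z by
    push_cast; ring, norm_mul, Complex.norm_real, Real.norm_eq_abs, abs_of_nonneg h1]
  calc (1 - Real.exp (-d)) * ‖z‖ ≤ d * 1 := by
        gcongr
        · have := Real.add_one_le_exp (-d); linarith
        · linarith
    _ = d := mul_one d

theorem tsq_zero_dil_le (f : ℂ → ℂ) (x Y : ℝ) {d : ℝ} (hd : 0 ≤ d) :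
    tsq 0 (dil d f) x Y ≤ tsq 0 f x (Y + d) := by
  let H : ℝ → ℝ≥0∞ := fun c => ENNReal.ofReal (c ^ (2 * 0 + 1)) *
    ‖Dz^[0 + 1] f (pt x c)‖ₑ ^ (2 : ℝ)
  have h1 := (measurePreserving_add_right volume d).setLIntegral_comp_preimage_emb
      (MeasurableEquiv.addRight d).measurableEmbedding H (Set.Ioo d (Y + d))
  rw [show (· + d) ⁻¹' Set.Ioo d (Y + d) = Set.Ioo 0 Y by ext c; simp] at h1
  calc tsq 0 (dil d f) x Y ≤ ∫⁻ c in Set.Ioo 0 Y, H (c + d) := by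
        refine setLIntegral_mono' measurableSet_Ioo fun c hc => ?_
        simp only [H, Function.iterate_one, zero_add, mul_zero, pow_one, Dz_dil, dil_pt]
        gcongr
        linarith
    _ = ∫⁻ c in Set.Ioo d (Y + d), H c := h1
    _ ≤ _ := lintegral_mono_set (Set.Ioo_subset_Ioo_left hd)

theorem tsq_zero_sub_le {f g : ℂ → ℂ} (hf : DifferentiableOn ℂ f (Metric.ball 0 1))
    (hg : DifferentiableOn ℂ g (Metric.ball 0 1)) (x Y : ℝ) :
    tsq 0 (fun z => f z - g z) x Y ≤ 4 * (tsq 0 f x Y + tsq 0 g x Y) := by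
  have hm : ∀ f, Measurable fun c => ENNReal.ofReal (c ^ (2 * 0 + 1)) *
      ‖Dz^[0 + 1] f (pt x c)‖ₑ ^ (2 : ℝ) := fun f => by
    simpa [Function.comp_def] using (measurable_sqfn_integrand f 0 0).comp (measurable_prodMk_left (x := x))
  rw [tsq, tsq, tsq, ← lintegral_add_left (hm f), ← lintegral_const_mul' _ _ (by finiteness)]
  refine setLIntegral_mono' measurableSet_Ioo fun c hc => ?_
  rw [iterate_Dz_sub hf hg (0 + 1) (pt_mem_ball x hc.1)]
  have := enorm_sq_le_add (Dz^[0 + 1] f (pt x c) - Dz^[0 + 1] g (pt x c)) (Dz^[0 + 1] f (pt x c))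
  rw [sub_sub_cancel_left, enorm_neg] at this
  calc _ ≤ ENNReal.ofReal (c ^ (2 * 0 + 1)) * (4 * _) := by gcongr
    _ = _ := by ring

/-- Dilations approximate in Hardy spaces. -/
theorem hsmall_sub_dil {s : ℝ} (hs : 0 < s) {f : ℂ → ℂ}
    (hf : DifferentiableOn ℂ f (Metric.ball 0 1)) (h0 : f 0 = 0) {B : ℝ≥0∞} (hB : B ≠ ∞)
    (hfB : Bd s f B) : HSmall s fun n z => f z - dil (1 / ((n : ℝ) + 1)) f z := by
  have hr : 0 < s / 2 := by positivity
  have hd : ∀ n : ℕ, (0 : ℝ) ≤ 1 / ((n : ℝ) + 1) := fun n => by positivity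
  obtain ⟨C, hC, h1⟩ := circ_sqfn_succ_zero_le_of_bd 0 hs
  refine hsmall_of_circ_sqfn hs (fun n => hf.sub (hf.dil (hd n))) (by simp [dil, h0])
    fun ε hε => (lu_sub_dil hf).circ_sqfn_small (fun n => hf.sub (hf.dil (hd n)))
      (by simp [dil, h0]) 0 hr (fun ε hε => ?_) hε
  obtain ⟨η, hη, h2⟩ := ENNReal.exists_mul_le (C := 8 ^ (s / 2)) (by finiteness) hε
  obtain ⟨Y, hY, h3⟩ := exists_circ_tsq_le 0 f hr
    (ne_top_of_le_ne_top (by finiteness) (h1 f hf h0 B hfB)) hη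
  refine ⟨Y / 2, by positivity, ?_⟩
  filter_upwards [(tendsto_one_div_add_atTop_nhds_zero_nat (𝕜 := ℝ)).eventually_lt_const
    (half_pos hY)] with n hn
  refine le_trans ?_ ((mul_le_mul_right h3 _).trans h2)
  rw [← circ_const_mul (by finiteness)]
  refine circ_mono fun x => ?_
  rw [← ENNReal.mul_rpow_of_nonneg _ _ hr.le]
  refine ENNReal.rpow_le_rpow ?_ hr.le
  calc _ ≤ 4 * (tsq 0 f x (Y / 2) + tsq 0 (dil (1 / ((n : ℝ) + 1)) f) x (Y / 2)) :=
        tsq_zero_sub_le hf (hf.dil (hd n)) x _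
    _ ≤ 4 * (tsq 0 f x Y + tsq 0 f x Y) := by
        gcongr
        · exact tsq_mono _ _ _ (by linarith)
        · exact (tsq_zero_dil_le f x _ (hd n)).trans (tsq_mono _ _ _ (by linarith))
    _ = 8 * tsq 0 f x Y := by ring

theorem Iop_zero (h : ℂ → ℂ) : Iop h 0 = 0 := by simp [Iop]

theorem smul_mem_unitBall {z : ℂ} (hz : z ∈ Metric.ball (0 : ℂ) 1) {t : ℝ}
    (ht : t ∈ Set.Icc (0 : ℝ) 1) : t • z ∈ Metric.ball (0 : ℂ) 1 := by
  rw [mem_ball_zero_iff] at hz ⊢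
  rw [norm_smul, Real.norm_eq_abs, abs_of_nonneg ht.1]
  exact (mul_le_of_le_one_left (norm_nonneg _) ht.2).trans_lt hz

theorem Iop_eq_of_hasDerivAt {G h : ℂ → ℂ} (hh : DifferentiableOn ℂ h (Metric.ball 0 1))
    (hG : ∀ z ∈ Metric.ball (0 : ℂ) 1, HasDerivAt G (h z) z) {z : ℂ}
    (hz : z ∈ Metric.ball (0 : ℂ) 1) : Iop h z = G z - G 0 := by
  have h1 : ∀ t ∈ Set.uIcc (0 : ℝ) 1, HasDerivAt (fun t : ℝ => G (t • z)) (z * h (t • z)) t := by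
    intro t ht
    rw [Set.uIcc_of_le zero_le_one] at ht
    have := (hG _ (smul_mem_unitBall hz ht)).comp t ((hasDerivAt_id t).smul_const z)
    exact this.congr_deriv (by simp [mul_comm])
  have h2 : ContinuousOn (fun t : ℝ => z * h (t • z)) (Set.uIcc 0 1) := by
    rw [Set.uIcc_of_le zero_le_one]
    refine continuousOn_const.mul (hh.continuousOn.comp (by fun_prop) fun t ht => ?_)
    exact smul_mem_unitBall hz ht
  have := intervalIntegral.integral_eq_sub_of_hasDerivAt h1 h2.intervalIntegrable
  rw [intervalIntegral.integral_const_mul, one_smul, zero_smul] at this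
  rw [Iop, this]

theorem hasDerivAt_Iop {h : ℂ → ℂ} (hh : DifferentiableOn ℂ h (Metric.ball 0 1)) {z : ℂ}
    (hz : z ∈ Metric.ball (0 : ℂ) 1) : HasDerivAt (Iop h) (h z) z := by
  obtain ⟨G, hG⟩ := hh.isExactOn_ball
  refine ((hG z hz).sub_const (G 0)).congr_of_eventuallyEq ?_
  filter_upwards [Metric.isOpen_ball.mem_nhds hz] with w hw
  exact Iop_eq_of_hasDerivAt hh hG hw

theorem DifferentiableOn.Iop {h : ℂ → ℂ} (hh : DifferentiableOn ℂ h (Metric.ball 0 1)) :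
    DifferentiableOn ℂ (_root_.Iop h) (Metric.ball 0 1) := fun _ hz =>
  (hasDerivAt_Iop hh hz).differentiableAt.differentiableWithinAt

theorem DifferentiableOn.iterate_Iop {h : ℂ → ℂ} (hh : DifferentiableOn ℂ h (Metric.ball 0 1))
    (n : ℕ) : DifferentiableOn ℂ (_root_.Iop^[n] h) (Metric.ball 0 1) := by
  induction n with
  | zero => exact hh
  | succ n ih => rw [Function.iterate_succ_apply']; exact ih.Iop

theorem Iop_congr {h h' : ℂ → ℂ} (e : Set.EqOn h h' (Metric.ball 0 1)) :
    Set.EqOn (Iop h) (Iop h') (Metric.ball 0 1) := by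
  intro z hz
  rw [Iop, Iop]
  congr 1
  refine intervalIntegral.integral_congr fun t ht => ?_
  rw [Set.uIcc_of_le zero_le_one] at ht
  exact e (smul_mem_unitBall hz ht)

theorem iterate_Iop_congr {h h' : ℂ → ℂ} (e : Set.EqOn h h' (Metric.ball 0 1)) (n : ℕ) :
    Set.EqOn (Iop^[n] h) (Iop^[n] h') (Metric.ball 0 1) := by
  induction n with
  | zero => exact e
  | succ n ih => simp only [Function.iterate_succ_apply']; exact Iop_congr ih

theorem Iop_add {h h' : ℂ → ℂ} (hh : DifferentiableOn ℂ h (Metric.ball 0 1))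
    (hh' : DifferentiableOn ℂ h' (Metric.ball 0 1)) :
    Set.EqOn (Iop fun z => h z + h' z) (fun z => Iop h z + Iop h' z) (Metric.ball 0 1) := by
  intro z hz
  have := Iop_eq_of_hasDerivAt (h := fun z => h z + h' z) (G := fun z => Iop h z + Iop h' z)
    (hh.fun_add hh') (fun z hz => (hasDerivAt_Iop hh hz).fun_add (hasDerivAt_Iop hh' hz)) hz
  simpa [Iop_zero] using this

theorem iterate_Iop_add {h h' : ℂ → ℂ} (hh : DifferentiableOn ℂ h (Metric.ball 0 1))
    (hh' : DifferentiableOn ℂ h' (Metric.ball 0 1)) (n : ℕ) :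
    Set.EqOn (Iop^[n] fun z => h z + h' z) (fun z => Iop^[n] h z + Iop^[n] h' z)
      (Metric.ball 0 1) := by
  induction n with
  | zero => exact fun z _ => rfl
  | succ n ih =>
    simp only [Function.iterate_succ_apply']
    exact (Iop_congr ih).trans (Iop_add (hh.iterate_Iop n) (hh'.iterate_Iop n))

theorem Iop_deriv {h : ℂ → ℂ} (hh : DifferentiableOn ℂ h (Metric.ball 0 1)) (h0 : h 0 = 0) :
    Set.EqOn (Iop (deriv h)) h (Metric.ball 0 1) := by
  intro z hz
  rw [Iop_eq_of_hasDerivAt (G := h) (hh.deriv Metric.isOpen_ball)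
    (fun z hz => (hh.differentiableAt (Metric.isOpen_ball.mem_nhds hz)).hasDerivAt) hz, h0, sub_zero]

theorem LU.Iop {F : ℕ → ℂ → ℂ} (h : LU F) : LU fun j => _root_.Iop (F j) := by
  intro ρ hρ ε hε
  filter_upwards [h ρ hρ ε hε] with j hj z hz
  rw [_root_.Iop, norm_mul]
  have h1 : ‖∫ t in (0 : ℝ)..1, F j (t • z)‖ ≤ ε * |1 - 0| := by
    refine intervalIntegral.norm_integral_le_of_norm_le_const fun t ht => hj _ ?_
    rw [Set.uIoc_of_le zero_le_one] at ht
    rw [norm_smul, Real.norm_eq_abs, abs_of_nonneg ht.1.le]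
    exact (mul_le_of_le_one_left (norm_nonneg _) ht.2).trans hz
  calc ‖z‖ * ‖∫ t in (0 : ℝ)..1, F j (t • z)‖ ≤ 1 * (ε * |1 - 0|) := by
        gcongr; linarith
    _ = ε := by simp

theorem LU.iterate_Iop {F : ℕ → ℂ → ℂ} (h : LU F) (n : ℕ) :
    LU fun j => _root_.Iop^[n] (F j) := by
  induction n with
  | zero => exact h
  | succ n ih => simp only [Function.iterate_succ_apply']; exact ih.Iop

theorem DifferentiableOn.iteratedDeriv_ball {f : ℂ → ℂ}
    (hf : DifferentiableOn ℂ f (Metric.ball 0 1)) (k : ℕ) :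
    DifferentiableOn ℂ (iteratedDeriv k f) (Metric.ball 0 1) := by
  induction k with
  | zero => simpa using hf
  | succ k ih => rw [iteratedDeriv_succ]; exact ih.deriv Metric.isOpen_ball

theorem LU.iteratedDeriv {F : ℕ → ℂ → ℂ} (h : LU F)
    (hF : ∀ j, DifferentiableOn ℂ (F j) (Metric.ball 0 1)) (k : ℕ) :
    LU fun j => _root_.iteratedDeriv k (F j) := by
  induction k with
  | zero => simpa using h
  | succ k ih => simp only [iteratedDeriv_succ]; exact ih.deriv fun j => (hF j).iteratedDeriv_ball k

theorem enorm_le_add_lintegral_deriv {G g : ℂ → ℂ}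
    (hG : ∀ z ∈ Metric.ball (0 : ℂ) 1, HasDerivAt G (g z) z) (x : ℝ) {t Y : ℝ} (ht : 0 < t)
    (hY : t ≤ Y) :
    ‖G (pt x t)‖ₑ ≤ ‖G (pt x Y)‖ₑ + ∫⁻ c in Set.Ioo t Y, ‖g (pt x c)‖ₑ := by
  have hGd : DifferentiableOn ℂ G (Metric.ball 0 1) := fun z hz =>
    (hG z hz).differentiableAt.differentiableWithinAt
  have hsub : Set.uIcc t Y ⊆ Set.Ioi 0 := fun c hc => by
    rw [Set.uIcc_of_le hY] at hc; exact ht.trans_le hc.1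
  have hc : ContinuousOn (fun c => -Dz G (pt x c)) (Set.uIcc t Y) := by
    refine ContinuousOn.neg ?_
    exact hGd.Dz.continuousOn.comp
      (continuous_pt.comp (by fun_prop : Continuous fun c : ℝ => (x, c))).continuousOn
      fun c hc => pt_mem_ball x (hsub hc)
  have h1 := intervalIntegral.integral_eq_sub_of_hasDerivAt
    (fun c hc => hasDerivAt_comp_pt_right hGd x (hsub hc)) hc.intervalIntegrable
  have h2 : G (pt x t) = G (pt x Y) - ∫ c in t..Y, -Dz G (pt x c) := by rw [h1]; ring
  rw [h2]
  refine (enorm_sub_le).trans (add_le_add_right ?_ _)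
  rw [intervalIntegral.integral_of_le hY, integral_Ioc_eq_integral_Ioo]
  refine (enorm_integral_le_lintegral_enorm _).trans
    (setLIntegral_mono' measurableSet_Ioo fun c hc => ?_)
  have hc' := pt_mem_ball x (ht.trans hc.1)
  rw [enorm_neg, Dz, (hG _ hc').deriv, enorm_mul]
  refine mul_le_of_le_one_left' ?_
  rw [← ofReal_norm]
  rw [mem_ball_zero_iff] at hc'
  exact ENNReal.ofReal_le_one.2 hc'.le

theorem lintegral_lintegral_Ioo_le {W : ℝ → ℝ≥0∞} (hW : Measurable W) {t : ℝ} (ht : 0 ≤ t)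
    (Y : ℝ) : ∫⁻ c in Set.Ioo t Y, ∫⁻ u in Set.Ioo c Y, W u ≤
      ∫⁻ u in Set.Ioo t Y, ENNReal.ofReal u * W u := by
  have hm : Measurable (Function.uncurry fun c u : ℝ => (Set.Ioi c).indicator W u) := by
    have : (Function.uncurry fun c u : ℝ => (Set.Ioi c).indicator W u) =
        {y : ℝ × ℝ | y.1 < y.2}.indicator fun y => W y.2 := by
      ext y; simp [Function.uncurry, Set.indicator]
    rw [this]
    exact (hW.comp measurable_snd).indicator (measurableSet_lt measurable_fst measurable_snd)
  calc ∫⁻ c in Set.Ioo t Y, ∫⁻ u in Set.Ioo c Y, W u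
      = ∫⁻ c in Set.Ioo t Y, ∫⁻ u in Set.Ioo t Y, (Set.Ioi c).indicator W u := by
        refine setLIntegral_congr_fun measurableSet_Ioo fun c hc => ?_
        rw [lintegral_indicator measurableSet_Ioi, Measure.restrict_restrict measurableSet_Ioi]
        congr 2
        ext u
        simp only [Set.mem_Ioo, Set.mem_inter_iff, Set.mem_Ioi]
        exact ⟨fun h => ⟨h.1, hc.1.trans h.1, h.2⟩, fun h => ⟨h.1, h.2.2⟩⟩
    _ = ∫⁻ u in Set.Ioo t Y, ∫⁻ c in Set.Ioo t Y, (Set.Ioi c).indicator W u :=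
        lintegral_lintegral_swap hm.aemeasurable
    _ ≤ ∫⁻ u in Set.Ioo t Y, ENNReal.ofReal u * W u := by
        refine setLIntegral_mono' measurableSet_Ioo fun u hu => ?_
        calc ∫⁻ c in Set.Ioo t Y, (Set.Ioi c).indicator W u
            = ∫⁻ c in Set.Ioo t Y, (Set.Iio u).indicator (fun _ => W u) c := by
              rfl
          _ = W u * volume (Set.Iio u ∩ Set.Ioo t Y) := by
              rw [lintegral_indicator measurableSet_Iio,
                Measure.restrict_restrict measurableSet_Iio, setLIntegral_const]
          _ ≤ W u * volume (Set.Ioo t u) := by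
              gcongr
              exact fun c hc => ⟨hc.2.1, hc.1⟩
          _ ≤ ENNReal.ofReal u * W u := by
              rw [Real.volume_Ioo, mul_comm]
              gcongr
              linarith

theorem enorm_iterate_Iop_le {h : ℂ → ℂ} (hh : DifferentiableOn ℂ h (Metric.ball 0 1))
    (hm : Measurable h) (n : ℕ) (x : ℝ) {Y : ℝ} (hY1 : Y ≤ 1) {t : ℝ} (ht : 0 < t)
    (htY : t ≤ Y) :
    ‖Iop^[n + 1] h (pt x t)‖ₑ ≤ ∑ i ∈ Finset.range (n + 1), ‖Iop^[i + 1] h (pt x Y)‖ₑ +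
      ∫⁻ c in Set.Ioo t Y, ENNReal.ofReal (c ^ n) * ‖h (pt x c)‖ₑ := by
  induction n generalizing t with
  | zero =>
    simpa using enorm_le_add_lintegral_deriv (fun z hz => hasDerivAt_Iop hh hz) x ht htY
  | succ n ih =>
    have h1 := enorm_le_add_lintegral_deriv
      (fun z hz => hasDerivAt_Iop (hh.iterate_Iop (n + 1)) hz) x ht htY
    rw [← Function.iterate_succ_apply' Iop (n + 1) h] at h1
    refine h1.trans ?_
    rw [Finset.sum_range_succ, add_comm (∑ i ∈ Finset.range (n + 1), _), add_assoc]
    refine add_le_add_right ?_ _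
    have hW : Measurable fun c => ENNReal.ofReal (c ^ n) * ‖h (pt x c)‖ₑ := by
      have := (hm.comp (continuous_pt.comp
        (by fun_prop : Continuous fun c : ℝ => (x, c))).measurable).enorm
      exact (by fun_prop : Measurable fun c : ℝ => ENNReal.ofReal (c ^ n)).mul this
    calc ∫⁻ c in Set.Ioo t Y, ‖Iop^[n + 1] h (pt x c)‖ₑ
        ≤ ∫⁻ c in Set.Ioo t Y, (∑ i ∈ Finset.range (n + 1), ‖Iop^[i + 1] h (pt x Y)‖ₑ +
            ∫⁻ u in Set.Ioo c Y, ENNReal.ofReal (u ^ n) * ‖h (pt x u)‖ₑ) :=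
          setLIntegral_mono' measurableSet_Ioo fun c hc => ih (ht.trans hc.1) hc.2.le
      _ = (∑ i ∈ Finset.range (n + 1), ‖Iop^[i + 1] h (pt x Y)‖ₑ) * volume (Set.Ioo t Y) +
            ∫⁻ c in Set.Ioo t Y, ∫⁻ u in Set.Ioo c Y, ENNReal.ofReal (u ^ n) * ‖h (pt x u)‖ₑ := by
          rw [lintegral_add_left measurable_const, setLIntegral_const]
      _ ≤ _ := by
          refine add_le_add (mul_le_of_le_one_right' ?_) ?_
          · rw [Real.volume_Ioo, ENNReal.ofReal_le_one]; linarith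
          · refine (lintegral_lintegral_Ioo_le hW ht.le Y).trans
              (setLIntegral_mono' measurableSet_Ioo fun c hc => le_of_eq ?_)
            have hc0 : 0 ≤ c := (ht.trans hc.1).le
            rw [← mul_assoc, ← ENNReal.ofReal_mul hc0, pow_succ']

theorem iteratedDeriv_Dz {f : ℂ → ℂ} (hf : DifferentiableOn ℂ f (Metric.ball 0 1)) (j : ℕ) :
    Set.EqOn (iteratedDeriv j (Dz f))
      (fun z => z * iteratedDeriv (j + 1) f z + j * iteratedDeriv j f z) (Metric.ball 0 1) := by
  induction j with
  | zero => intro z _; simp [Dz]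
  | succ j ih =>
    intro z hz
    have hd : ∀ i, HasDerivAt (iteratedDeriv i f) (iteratedDeriv (i + 1) f z) z := fun i => by
      rw [iteratedDeriv_succ]
      exact ((hf.iteratedDeriv_ball i).differentiableAt
        (Metric.isOpen_ball.mem_nhds hz)).hasDerivAt
    rw [iteratedDeriv_succ,
      (ih.eventuallyEq_of_mem (Metric.isOpen_ball.mem_nhds hz)).deriv_eq]
    have h1 := ((hasDerivAt_id z).mul (hd (j + 1))).add ((hd j).const_mul (j : ℂ))
    refine (h1.congr_deriv (f' := _) ?_).deriv
    push_cast
    simp only [id]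
    ring

theorem exists_norm_iteratedDeriv_le (k : ℕ) : ∃ C : ℝ, 0 ≤ C ∧
    ∀ f : ℂ → ℂ, DifferentiableOn ℂ f (Metric.ball 0 1) → ∀ z ∈ Metric.ball (0 : ℂ) 1,
      ‖z ^ (k + 1) * iteratedDeriv (k + 1) f z‖ ≤
        C * ∑ i ∈ Finset.range (k + 1), ‖Dz^[i + 1] f z‖ := by
  induction k with
  | zero => exact ⟨1, zero_le_one, fun f hf z hz => by simp [Dz]⟩
  | succ k ih =>
    obtain ⟨C, hC, h⟩ := ih
    refine ⟨C * (k + 2), by positivity, fun f hf z hz => ?_⟩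
    set S := ∑ i ∈ Finset.range (k + 1 + 1), ‖Dz^[i + 1] f z‖ with hS
    have h1 : ∑ i ∈ Finset.range (k + 1), ‖Dz^[i + 1] (Dz f) z‖ ≤ S := by
      rw [hS, Finset.sum_range_succ' _ (k + 1)]
      simp only [← Function.iterate_succ_apply]
      exact le_add_of_nonneg_right (norm_nonneg _)
    have h2 : ∑ i ∈ Finset.range (k + 1), ‖Dz^[i + 1] f z‖ ≤ S := by
      rw [hS, Finset.sum_range_succ _ (k + 1)]
      exact le_add_of_nonneg_right (norm_nonneg _)
    have e : z ^ (k + 1 + 1) * iteratedDeriv (k + 1 + 1) f z =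
        z ^ (k + 1) * iteratedDeriv (k + 1) (Dz f) z -
          ((k + 1 : ℕ) : ℂ) * (z ^ (k + 1) * iteratedDeriv (k + 1) f z) := by
      rw [iteratedDeriv_Dz hf (k + 1) hz]; ring
    rw [e]
    refine (norm_sub_le _ _).trans ?_
    rw [norm_mul ((k + 1 : ℕ) : ℂ), Complex.norm_natCast]
    have h3 := (h (Dz f) hf.Dz z hz).trans (mul_le_mul_of_nonneg_left h1 hC)
    have h4 := (h f hf z hz).trans (mul_le_mul_of_nonneg_left h2 hC)
    calc _ ≤ C * S + ((k + 1 : ℕ) : ℝ) * (C * S) := by gcongr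
      _ = _ := by push_cast; ring

theorem ENNReal.rpow_sum_le_card_rpow_mul {ι : Type*} {t : Finset ι} (u : ι → ℝ≥0∞)
    {r : ℝ} (hr : 0 < r) : (∑ i ∈ t, u i) ^ r ≤ (t.card : ℝ≥0∞) ^ r * ∑ i ∈ t, u i ^ r := by
  rcases t.eq_empty_or_nonempty with rfl | ht
  · simp [hr]
  obtain ⟨j, hj, hmax⟩ := t.exists_max_image u ht
  calc (∑ i ∈ t, u i) ^ r ≤ (t.card * u j) ^ r := by
        refine ENNReal.rpow_le_rpow ?_ hr.le
        simpa using Finset.sum_le_card_nsmul t u (u j) hmax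
    _ = (t.card : ℝ≥0∞) ^ r * u j ^ r := ENNReal.mul_rpow_of_nonneg _ _ hr.le
    _ ≤ _ := by
        gcongr
        exact Finset.single_le_sum (f := fun i => u i ^ r) (fun _ _ => bot_le) hj

/-- Truncated square function built from ordinary derivatives. -/
noncomputable def asq (k : ℕ) (f : ℂ → ℂ) (x Y : ℝ) : ℝ≥0∞ :=
  ∫⁻ c in Set.Ioo 0 Y, ENNReal.ofReal (c ^ (2 * k + 1)) *
    ‖iteratedDeriv (k + 1) f (pt x c)‖ₑ ^ (2 : ℝ)

theorem exists_enorm_iteratedDeriv_le (k : ℕ) : ∃ C : ℝ≥0∞, C ≠ ∞ ∧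
    ∀ f : ℂ → ℂ, DifferentiableOn ℂ f (Metric.ball 0 1) → ∀ x c : ℝ, 0 < c → c ≤ 1 →
      ‖iteratedDeriv (k + 1) f (pt x c)‖ₑ ≤
        C * ∑ i ∈ Finset.range (k + 1), ‖Dz^[i + 1] f (pt x c)‖ₑ := by
  obtain ⟨C, hC, h⟩ := exists_norm_iteratedDeriv_le k
  refine ⟨ENNReal.ofReal (Real.exp 1 ^ (k + 1) * C), ENNReal.ofReal_ne_top, fun f hf x c hc hc1 => ?_⟩
  have h1 := h f hf (pt x c) (pt_mem_ball x hc)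
  rw [norm_mul, norm_pow, norm_pt, ← Real.exp_nat_mul] at h1
  have h2 : ‖iteratedDeriv (k + 1) f (pt x c)‖ ≤ Real.exp 1 ^ (k + 1) *
      (Real.exp (((k + 1 : ℕ) : ℝ) * -c) * ‖iteratedDeriv (k + 1) f (pt x c)‖) := by
    rw [← mul_assoc, ← Real.exp_nat_mul, ← Real.exp_add]
    refine le_mul_of_one_le_left (norm_nonneg _) (Real.one_le_exp ?_)
    nlinarith [Nat.cast_nonneg (α := ℝ) (k + 1)]
  have h3 := h2.trans (mul_le_mul_of_nonneg_left h1 (by positivity))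
  rw [← mul_assoc] at h3
  simp_rw [← ofReal_norm]
  rw [← ENNReal.ofReal_sum_of_nonneg (fun _ _ => norm_nonneg _), ← ENNReal.ofReal_mul (by positivity)]
  exact ENNReal.ofReal_le_ofReal h3

theorem exists_asq_le (k : ℕ) : ∃ C : ℝ≥0∞, C ≠ ∞ ∧
    ∀ f : ℂ → ℂ, DifferentiableOn ℂ f (Metric.ball 0 1) → ∀ x Y : ℝ, Y ≤ 1 →
      asq k f x Y ≤ C * ∑ i ∈ Finset.range (k + 1), tsq i f x Y := by
  obtain ⟨C, hC, h⟩ := exists_enorm_iteratedDeriv_le k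
  refine ⟨C ^ (2 : ℝ) * ((k + 1 : ℕ) : ℝ≥0∞) ^ (2 : ℝ), by finiteness, fun f hf x Y hY => ?_⟩
  have hm : ∀ i, Measurable fun c => ENNReal.ofReal (c ^ (2 * i + 1)) *
      ‖Dz^[i + 1] f (pt x c)‖ₑ ^ (2 : ℝ) := fun i => by
    simpa [Function.comp_def] using
      (measurable_sqfn_integrand f i 0).comp (measurable_prodMk_left (x := x))
  simp only [asq, tsq]
  rw [← lintegral_finsetSum _ fun i _ => hm i, ← lintegral_const_mul' _ _ (by finiteness)]
  refine setLIntegral_mono' measurableSet_Ioo fun c hc => ?_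
  have hc1 : c ≤ 1 := hc.2.le.trans hY
  calc ENNReal.ofReal (c ^ (2 * k + 1)) * ‖iteratedDeriv (k + 1) f (pt x c)‖ₑ ^ (2 : ℝ)
      ≤ ENNReal.ofReal (c ^ (2 * k + 1)) *
          (C * ∑ i ∈ Finset.range (k + 1), ‖Dz^[i + 1] f (pt x c)‖ₑ) ^ (2 : ℝ) := by
        gcongr
        exact h f hf x c hc.1 hc1
    _ ≤ ENNReal.ofReal (c ^ (2 * k + 1)) * (C ^ (2 : ℝ) * (((k + 1 : ℕ) : ℝ≥0∞) ^ (2 : ℝ) *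
          ∑ i ∈ Finset.range (k + 1), ‖Dz^[i + 1] f (pt x c)‖ₑ ^ (2 : ℝ))) := by
        rw [ENNReal.mul_rpow_of_nonneg _ _ zero_le_two]
        gcongr
        simpa using ENNReal.rpow_sum_le_card_rpow_mul (t := Finset.range (k + 1))
          (fun i => ‖Dz^[i + 1] f (pt x c)‖ₑ) (zero_lt_two (α := ℝ))
    _ = C ^ (2 : ℝ) * ((k + 1 : ℕ) : ℝ≥0∞) ^ (2 : ℝ) * ∑ i ∈ Finset.range (k + 1),
          ENNReal.ofReal (c ^ (2 * k + 1)) * ‖Dz^[i + 1] f (pt x c)‖ₑ ^ (2 : ℝ) := by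
        rw [← Finset.mul_sum]; ring
    _ ≤ _ := by
        refine mul_le_mul_right (Finset.sum_le_sum fun i hi => mul_le_mul_left ?_ _) _
        have hi := Finset.mem_range.1 hi
        exact ENNReal.ofReal_le_ofReal (pow_le_pow_of_le_one hc.1.le hc1 (by omega))

theorem exists_circ_asq_le (k : ℕ) {r : ℝ} (hr : 0 < r) : ∃ C : ℝ≥0∞, C ≠ ∞ ∧
    ∀ f : ℂ → ℂ, DifferentiableOn ℂ f (Metric.ball 0 1) → ∀ Y : ℝ, Y ≤ 1 →
      circ (fun x => asq k f x Y ^ r) ≤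
        C * ∑ i ∈ Finset.range (k + 1), circ (fun x => tsq i f x Y ^ r) := by
  obtain ⟨C, hC, h⟩ := exists_asq_le k
  refine ⟨C ^ r * ((k + 1 : ℕ) : ℝ≥0∞) ^ r, by finiteness, fun f hf Y hY => ?_⟩
  simp only [circ]
  rw [← lintegral_finsetSum _ fun i _ => (measurable_tsq i f Y).pow_const r,
    ← lintegral_const_mul' _ _ (by finiteness)]
  refine lintegral_mono fun x => ?_
  calc asq k f x Y ^ r ≤ (C * ∑ i ∈ Finset.range (k + 1), tsq i f x Y) ^ r :=
        ENNReal.rpow_le_rpow (h f hf x Y hY) hr.le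
    _ ≤ C ^ r * (((k + 1 : ℕ) : ℝ≥0∞) ^ r * ∑ i ∈ Finset.range (k + 1), tsq i f x Y ^ r) := by
        rw [ENNReal.mul_rpow_of_nonneg _ _ hr.le]
        gcongr
        simpa using ENNReal.rpow_sum_le_card_rpow_mul (t := Finset.range (k + 1))
          (fun i => tsq i f x Y) hr
    _ = _ := by rw [mul_assoc]

theorem circ_asq_le_of_bd (k : ℕ) {p : ℝ} (hp : 0 < p) : ∃ C : ℝ≥0∞, C ≠ ∞ ∧
    ∀ f : ℂ → ℂ, DifferentiableOn ℂ f (Metric.ball 0 1) → f 0 = 0 → ∀ B, Bd p f B →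
      ∀ Y : ℝ, Y ≤ 1 → circ (fun x => asq k f x Y ^ (p / 2)) ≤ C * B := by
  obtain ⟨C, hC, h⟩ := exists_circ_asq_le k (half_pos hp)
  choose D hD hD' using fun i => circ_sqfn_succ_zero_le_of_bd i hp
  refine ⟨C * ∑ i ∈ Finset.range (k + 1), D i,
    ENNReal.mul_ne_top hC (ENNReal.sum_ne_top.2 fun i _ => hD i), fun f hf h0 B hB Y hY => ?_⟩
  refine (h f hf Y hY).trans ?_
  rw [mul_assoc, Finset.sum_mul]
  gcongr with i
  refine (circ_mono fun x => ?_).trans (hD' i f hf h0 B hB)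
  exact ENNReal.rpow_le_rpow (tsq_le_sqfn i f x Y) (half_pos hp).le

theorem exists_circ_asq_small (k : ℕ) {p : ℝ} (hp : 0 < p) {f : ℂ → ℂ}
    (hf : DifferentiableOn ℂ f (Metric.ball 0 1)) (h0 : f 0 = 0) {B : ℝ≥0∞} (hB : B ≠ ∞)
    (hfB : Bd p f B) {ε : ℝ≥0∞} (hε : ε ≠ 0) :
    ∃ Y : ℝ, 0 < Y ∧ Y ≤ 1 ∧ circ (fun x => asq k f x Y ^ (p / 2)) ≤ ε := by
  obtain ⟨C, hC, h⟩ := exists_circ_asq_le k (half_pos hp)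
  obtain ⟨η, hη, hη'⟩ := ENNReal.exists_mul_le (C := C * ((k + 1 : ℕ) : ℝ≥0∞)) (by finiteness) hε
  have h1 : ∀ i, ∃ Y : ℝ, 0 < Y ∧ circ (fun x => tsq i f x Y ^ (p / 2)) ≤ η := fun i => by
    obtain ⟨D, hD, hD'⟩ := circ_sqfn_succ_zero_le_of_bd i hp
    have := hD' f hf h0 B hfB
    exact exists_circ_tsq_le i f (half_pos hp) (ne_top_of_le_ne_top (by finiteness) this) hη
  choose Y hY hY' using h1
  have hne : (Finset.range (k + 1)).Nonempty := ⟨0, by simp⟩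
  set Z := min 1 ((Finset.range (k + 1)).inf' hne Y) with hZ
  refine ⟨Z, lt_min one_pos ((Finset.lt_inf'_iff hne).2 fun i _ => hY i), min_le_left _ _, ?_⟩
  refine (h f hf Z (min_le_left _ _)).trans (le_trans ?_ hη')
  rw [mul_assoc]
  gcongr
  refine (Finset.sum_le_card_nsmul _ _ η fun i hi => ?_).trans (by simp)
  refine (circ_mono fun x => ENNReal.rpow_le_rpow (tsq_mono i f x ?_) (half_pos hp).le).trans (hY' i)
  exact (min_le_right _ _).trans (Finset.inf'_le _ hi)

theorem LU.enorm_le {F : ℕ → ℂ → ℂ} (h : LU F) {ρ : ℝ} (hρ : ρ < 1) {δ : ℝ≥0∞} (hδ : δ ≠ 0) :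
    ∀ᶠ j in Filter.atTop, ∀ z : ℂ, ‖z‖ ≤ ρ → ‖F j z‖ₑ ≤ δ := by
  have h1 : 0 < min δ 1 := lt_min (pos_iff_ne_zero.2 hδ) one_pos
  have h2 : min δ 1 ≠ ∞ := (min_lt_of_right_lt one_lt_top).ne
  filter_upwards [h ρ hρ _ (ENNReal.toReal_pos h1.ne' h2)] with j hj z hz
  rw [← ofReal_norm]
  exact (ENNReal.ofReal_le_of_le_toReal (hj z hz)).trans (min_le_left _ _)

theorem lintegral_pow_mul_le_asq {f g : ℂ → ℂ} (k m : ℕ) (x : ℝ) {t Y : ℝ} (ht : 0 ≤ t) :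
    ∫⁻ c in Set.Ioo t Y, ENNReal.ofReal (c ^ (k + m + 1)) *
        ‖iteratedDeriv (k + 1) f (pt x c) * iteratedDeriv (m + 1) g (pt x c)‖ₑ ≤
      asq k f x Y ^ (1 / 2 : ℝ) * asq m g x Y ^ (1 / 2 : ℝ) := by
  have hm : ∀ (i : ℕ) (f : ℂ → ℂ), Measurable fun c =>
      ENNReal.ofReal (c ^ (2 * i + 1)) ^ (1 / 2 : ℝ) * ‖iteratedDeriv (i + 1) f (pt x c)‖ₑ := by
    intro i f
    have h1 : Measurable (iteratedDeriv (i + 1) f) := by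
      rw [iteratedDeriv_succ]; exact measurable_deriv _
    have h2 : Measurable fun c => pt x c := measurable_pt.comp measurable_prodMk_left
    exact (Measurable.pow_const (by fun_prop) _).mul (h1.comp h2).enorm
  have hsq : ∀ (i : ℕ) (f : ℂ → ℂ) (c : ℝ),
      (ENNReal.ofReal (c ^ (2 * i + 1)) ^ (1 / 2 : ℝ) *
        ‖iteratedDeriv (i + 1) f (pt x c)‖ₑ) ^ (2 : ℝ) =
      ENNReal.ofReal (c ^ (2 * i + 1)) * ‖iteratedDeriv (i + 1) f (pt x c)‖ₑ ^ (2 : ℝ) := by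
    intro i f c
    rw [ENNReal.mul_rpow_of_nonneg _ _ zero_le_two, ← ENNReal.rpow_mul]
    norm_num
  have hcs := ENNReal.lintegral_mul_le_Lp_mul_Lq (volume.restrict (Set.Ioo 0 Y))
    Real.HolderConjugate.two_two (hm k f).aemeasurable (hm m g).aemeasurable
  simp only [hsq, Pi.mul_apply] at hcs
  refine le_trans ?_ hcs
  refine (lintegral_mono_set (Set.Ioo_subset_Ioo_left ht)).trans
    (setLIntegral_mono' measurableSet_Ioo fun c hc => le_of_eq ?_)
  have hc0 := hc.1.le
  have e : ENNReal.ofReal (c ^ (2 * k + 1)) ^ (1 / 2 : ℝ) *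
      ENNReal.ofReal (c ^ (2 * m + 1)) ^ (1 / 2 : ℝ) = ENNReal.ofReal (c ^ (k + m + 1)) := by
    rw [← ENNReal.mul_rpow_of_nonneg _ _ (by norm_num), ← ENNReal.ofReal_mul (by positivity),
      ENNReal.ofReal_rpow_of_nonneg (by positivity) (by norm_num), ← Real.sqrt_eq_rpow,
      show c ^ (2 * k + 1) * c ^ (2 * m + 1) = (c ^ (k + m + 1)) ^ 2 by ring,
      Real.sqrt_sq (by positivity)]
  rw [← e, enorm_mul]
  ring

theorem enorm_iterate_Iop_mul_le {f g : ℂ → ℂ} (hf : DifferentiableOn ℂ f (Metric.ball 0 1))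
    (hg : DifferentiableOn ℂ g (Metric.ball 0 1)) (k m : ℕ) {Y : ℝ} (hY1 : Y ≤ 1) {η : ℝ≥0∞}
    (h : ∀ i ≤ k + m + 2, ∀ z : ℂ, ‖z‖ ≤ Real.exp (-Y) → ‖Iop^[i] (fun z =>
      iteratedDeriv (k + 1) f z * iteratedDeriv (m + 1) g z) z‖ₑ ≤ η) (x : ℝ) {t : ℝ}
    (ht : 0 < t) :
    ‖Iop^[k + m + 2] (fun z => iteratedDeriv (k + 1) f z * iteratedDeriv (m + 1) g z)
      (pt x t)‖ₑ ≤
      ((k + m + 2 : ℕ) : ℝ≥0∞) * η + asq k f x Y ^ (1 / 2 : ℝ) * asq m g x Y ^ (1 / 2 : ℝ) := by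
  rcases le_total t Y with htY | htY
  · have hm : Measurable fun z => iteratedDeriv (k + 1) f z * iteratedDeriv (m + 1) g z := by
      simp only [iteratedDeriv_succ]
      exact (measurable_deriv _).mul (measurable_deriv _)
    refine (enorm_iterate_Iop_le ((hf.iteratedDeriv_ball _).mul (hg.iteratedDeriv_ball _)) hm
      (k + m + 1) x hY1 ht htY).trans ?_
    refine add_le_add ?_ (lintegral_pow_mul_le_asq k m x ht.le)
    refine (Finset.sum_le_card_nsmul _ _ η fun i hi => ?_).trans (by simp [add_assoc, one_add_one_eq_two])
    have := Finset.mem_range.1 hi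
    exact h _ (by omega) _ (norm_pt_le x le_rfl)
  · refine (h _ le_rfl _ (norm_pt_le x htY)).trans (le_trans ?_ le_self_add)
    refine le_mul_of_one_le_left' ?_
    exact_mod_cast Nat.le_add_left 1 (k + m + 1)

theorem hsmall_iterate_Iop_mul {p q s : ℝ} (hp : 0 < p) (hs : 0 < s) (hq : 0 < q)
    (hpsq : 1 / q = 1 / p + 1 / s) {φ : ℕ → ℂ → ℂ} {γ : ℂ → ℂ}
    (hφ : ∀ j, DifferentiableOn ℂ (φ j) (Metric.ball 0 1)) (hφ0 : ∀ j, φ j 0 = 0) (hL : LU φ)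
    {B : ℝ≥0∞} (hB : B ≠ ∞) (hφB : ∀ j, Bd p (φ j) B)
    (hγ : DifferentiableOn ℂ γ (Metric.ball 0 1)) (hγ0 : γ 0 = 0) {A : ℝ≥0∞} (hA : A ≠ ∞)
    (hγA : Bd s γ A) (k m : ℕ) :
    HSmall q fun j => Iop^[k + m + 2] fun z =>
      iteratedDeriv (k + 1) (φ j) z * iteratedDeriv (m + 1) γ z := by
  intro ε hε
  have h2 : ε / 2 ≠ 0 := ENNReal.div_ne_zero.2 ⟨hε, by simp⟩
  obtain ⟨D, hD, hasq⟩ := circ_asq_le_of_bd k hp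
  obtain ⟨l, hl, η, hη, hscale⟩ := ENNReal.exists_scale (p := p) s hp (C := 2 ^ q) (by finiteness)
    (ENNReal.mul_ne_top hD hB) h2
  obtain ⟨Y, hY, hY1, hsmall⟩ := exists_circ_asq_small m hs hγ hγ0 hA hγA hη
  obtain ⟨δ, hδ, hδ'⟩ := ENNReal.exists_mul_le
    (C := 2 ^ q * ENNReal.ofReal (2 * Real.pi)) (by finiteness) h2
  obtain ⟨ν, hν, hν'⟩ := ENNReal.exists_mul_le
    (C := ((k + m + 2 : ℕ) : ℝ≥0∞)) (by finiteness) (ε := min δ 1 ^ (1 / q)) (by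
      have : min δ 1 ≠ 0 := by simp [hδ]
      have h' : min δ 1 ≠ ∞ := (min_lt_of_right_lt one_lt_top).ne
      simp [ENNReal.rpow_eq_zero_iff, this, h'])
  have hLU : ∀ i, LU fun j => Iop^[i] fun z =>
      iteratedDeriv (k + 1) (φ j) z * iteratedDeriv (m + 1) γ z := fun i => by
    refine LU.iterate_Iop ?_ i
    simpa only [mul_comm] using
      (hL.iteratedDeriv hφ (k + 1)).mul_left (hγ.iteratedDeriv_ball (m + 1)).continuousOn
  have hev : ∀ᶠ j in Filter.atTop, ∀ i ∈ Finset.range (k + m + 3), ∀ z : ℂ,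
      ‖z‖ ≤ Real.exp (-Y) → ‖Iop^[i] (fun z =>
        iteratedDeriv (k + 1) (φ j) z * iteratedDeriv (m + 1) γ z) z‖ₑ ≤ ν :=
    (Filter.eventually_all_finset _).2 fun i _ => (hLU i).enorm_le (by simpa using hY) hν
  filter_upwards [hev] with j hj t ht
  have hl1 : ENNReal.ofReal l * ENNReal.ofReal l⁻¹ = 1 := by
    rw [← ENNReal.ofReal_mul hl.le, mul_inv_cancel₀ hl.ne', ENNReal.ofReal_one]
  have hpt : ∀ x, ‖Iop^[k + m + 2] (fun z => iteratedDeriv (k + 1) (φ j) z *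
      iteratedDeriv (m + 1) γ z) (pt x t)‖ₑ ^ q ≤
      2 ^ q * (δ + (ENNReal.ofReal l ^ p * asq k (φ j) x Y ^ (p / 2) +
        ENNReal.ofReal l⁻¹ ^ s * asq m γ x Y ^ (s / 2))) := by
    intro x
    have h1 := enorm_iterate_Iop_mul_le (hφ j) hγ k m hY1
      (fun i hi => hj i (Finset.mem_range.2 (by omega))) x ht
    refine (ENNReal.rpow_le_rpow (h1.trans (add_le_add_left hν' _)) hq.le).trans ?_
    refine (ENNReal.add_rpow_le_two_rpow_mul _ _ hq.le).trans ?_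
    gcongr
    · rw [← ENNReal.rpow_mul, one_div_mul_cancel hq.ne', ENNReal.rpow_one]
      exact min_le_left _ _
    · have h3 := ENNReal.mul_rpow_le_add hp hs hq hpsq
        (ENNReal.ofReal l * asq k (φ j) x Y ^ (1 / 2 : ℝ))
        (ENNReal.ofReal l⁻¹ * asq m γ x Y ^ (1 / 2 : ℝ))
      rw [mul_mul_mul_comm, hl1, one_mul, ENNReal.mul_rpow_of_nonneg _ _ hp.le,
        ENNReal.mul_rpow_of_nonneg _ _ hs.le, ← ENNReal.rpow_mul, ← ENNReal.rpow_mul] at h3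
      simpa only [one_div_mul_eq_div] using h3
  have hma : ∀ (i : ℕ) (f : ℂ → ℂ), Measurable fun x => asq i f x Y := by
    intro i f
    have h1 : Measurable (iteratedDeriv (i + 1) f) := by
      rw [iteratedDeriv_succ]; exact measurable_deriv _
    have h2 : Measurable fun y : ℝ × ℝ => ENNReal.ofReal (y.2 ^ (2 * i + 1)) *
        ‖iteratedDeriv (i + 1) f (pt y.1 y.2)‖ₑ ^ (2 : ℝ) :=
      (Measurable.ennreal_ofReal (by fun_prop)).mul ((h1.comp measurable_pt).enorm.pow_const _)
    exact h2.lintegral_prod_right'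
  calc circ _ ≤ circ _ := circ_mono hpt
    _ = 2 ^ q * ENNReal.ofReal (2 * Real.pi) * δ + 2 ^ q * (ENNReal.ofReal l ^ p *
          circ (fun x => asq k (φ j) x Y ^ (p / 2)) + ENNReal.ofReal l⁻¹ ^ s *
          circ (fun x => asq m γ x Y ^ (s / 2))) := by
        unfold circ
        rw [lintegral_const_mul' _ _ (by finiteness), lintegral_add_left measurable_const,
          lintegral_add_left (((hma k _).pow_const _).const_mul _),
          lintegral_const_mul' _ _ (by finiteness), lintegral_const_mul' _ _ (by finiteness),
          setLIntegral_const, Real.volume_Ioc, sub_zero]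
        ring
    _ ≤ ε / 2 + ε / 2 :=
        add_le_add hδ' (hscale _ (hasq (φ j) (hφ j) (hφ0 j) B (hφB j) Y hY1) _ hsmall)
    _ = ε := ENNReal.add_halves ε

theorem Dz_congr {f g : ℂ → ℂ} (h : Set.EqOn f g (Metric.ball 0 1)) :
    Set.EqOn (Dz f) (Dz g) (Metric.ball 0 1) := fun z hz => by
  rw [Dz, Dz, (h.eventuallyEq_of_mem (Metric.isOpen_ball.mem_nhds hz)).deriv_eq]

theorem Dz_Iop_dslope {f : ℂ → ℂ} (hf : DifferentiableOn ℂ f (Metric.ball 0 1)) (h0 : f 0 = 0) :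
    Set.EqOn (Dz (Iop (dslope f 0))) f (Metric.ball 0 1) := fun z hz => by
  have hd : DifferentiableOn ℂ (dslope f 0) (Metric.ball 0 1) :=
    (Complex.differentiableOn_dslope (Metric.ball_mem_nhds 0 one_pos)).2 hf
  rw [Dz, (hasDerivAt_Iop hd hz).deriv]
  simpa [h0] using sub_smul_dslope f 0 z

theorem LU.dslope {F : ℕ → ℂ → ℂ} (h : LU F)
    (hF : ∀ j, DifferentiableOn ℂ (F j) (Metric.ball 0 1)) (h0 : ∀ j, F j 0 = 0) :
    LU fun j => _root_.dslope (F j) 0 := by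
  intro ρ hρ ε hε
  filter_upwards [h.le_mul_norm hF h0 hρ hε, h.deriv hF ρ hρ ε hε] with j h1 h2 z hz
  rcases eq_or_ne z 0 with rfl | hz0
  · simpa using h2 0 hz
  · have := h1 z hz
    rw [dslope_of_ne _ hz0, slope_def_field, h0, sub_zero, sub_zero, norm_div,
      div_le_iff₀ (norm_pos_iff.2 hz0)]
    exact this

theorem tsq_one_le {f h : ℂ → ℂ} (hh : Set.EqOn (Dz h) f (Metric.ball 0 1)) (x Y : ℝ) :
    tsq 1 h x Y ≤ ENNReal.ofReal (Y ^ 2) * sqfn 1 f x 0 := by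
  refine le_trans ?_ (mul_le_mul_right (tsq_le_sqfn 0 f x Y) _)
  rw [tsq, tsq, ← lintegral_const_mul' _ _ (by finiteness)]
  refine setLIntegral_mono' measurableSet_Ioo fun c hc => ?_
  have e : Dz^[1 + 1] h (pt x c) = Dz^[0 + 1] f (pt x c) :=
    Dz_congr hh (pt_mem_ball x hc.1)
  rw [e, ← mul_assoc, ← ENNReal.ofReal_mul (by positivity)]
  gcongr
  have h1 := hc.1
  have h2 : c ^ 2 ≤ Y ^ 2 := by gcongr; exact hc.2.le
  calc c ^ (2 * 1 + 1) = c ^ 2 * c ^ (2 * 0 + 1) := by ring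
    _ ≤ _ := by gcongr

theorem hsmall_Iop_mul_of_bounded {p : ℝ} (hp : 0 < p) {φ : ℕ → ℂ → ℂ}
    (hφ : ∀ j, DifferentiableOn ℂ (φ j) (Metric.ball 0 1)) (hφ0 : ∀ j, φ j 0 = 0) (hL : LU φ)
    {B : ℝ≥0∞} (hB : B ≠ ∞) (hφB : ∀ j, Bd p (φ j) B) {w : ℂ → ℂ}
    (hw : DifferentiableOn ℂ w (Metric.ball 0 1)) {W : ℝ}
    (hW : ∀ z ∈ Metric.ball (0 : ℂ) 1, ‖w z‖ ≤ W) :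
    HSmall p fun j => Iop fun z => φ j z * w z := by
  have hr : 0 < p / 2 := half_pos hp
  have hd : ∀ j, DifferentiableOn ℂ (dslope (φ j) 0) (Metric.ball 0 1) := fun j =>
    (Complex.differentiableOn_dslope (Metric.ball_mem_nhds 0 one_pos)).2 (hφ j)
  set h : ℕ → ℂ → ℂ := fun j => Iop (dslope (φ j) 0) with hh
  have hhd : ∀ j, DifferentiableOn ℂ (h j) (Metric.ball 0 1) := fun j => (hd j).Iop
  have hh0 : ∀ j, h j 0 = 0 := fun j => Iop_zero _
  have hDz : ∀ j, Set.EqOn (Dz (h j)) (φ j) (Metric.ball 0 1) := fun j =>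
    Dz_Iop_dslope (hφ j) (hφ0 j)
  obtain ⟨C, hC, h1⟩ := circ_sqfn_succ_zero_le_of_bd 0 hp
  obtain ⟨C', hC', h2⟩ := circ_sqfn_comparable 1 hr
  have htail : ∀ ε : ℝ≥0∞, ε ≠ 0 → ∃ Y > 0, ∀ᶠ j in Filter.atTop,
      circ (fun x => tsq 1 (h j) x Y ^ (p / 2)) ≤ ε := by
    intro ε hε
    obtain ⟨Y, hY, _, -, hY'⟩ := ENNReal.exists_scale (p := p) 1 hp (C := 1) (by finiteness)
      (ENNReal.mul_ne_top hC hB) hε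
    refine ⟨Y, hY, Filter.Eventually.of_forall fun j => ?_⟩
    refine le_trans (b := circ fun x => (ENNReal.ofReal (Y ^ 2) * sqfn 1 (φ j) x 0) ^ (p / 2)) ?_
      (le_trans ?_ (hY' _ (h1 (φ j) (hφ j) (hφ0 j) B (hφB j)) 0 bot_le))
    · exact circ_mono fun x => ENNReal.rpow_le_rpow (tsq_one_le (hDz j) x Y) hr.le
    · rw [one_mul, mul_zero, add_zero, ← circ_const_mul (by finiteness)]
      refine circ_mono fun x => le_of_eq ?_
      rw [ENNReal.mul_rpow_of_nonneg _ _ hr.le, ENNReal.ofReal_pow hY.le,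
        ← ENNReal.rpow_natCast, ← ENNReal.rpow_mul]
      congr 2
      push_cast
      ring
  have hsm := fun ε hε => LU.circ_sqfn_small ((hL.dslope hφ hφ0).Iop) hhd hh0 1 hr htail (ε := ε) hε
  refine hsmall_of_circ_sqfn hp (fun j => ((hφ j).fun_mul hw).Iop) (fun j => Iop_zero _) fun ε hε => ?_
  obtain ⟨η, hη, hη'⟩ := ENNReal.exists_mul_le
    (C := (ENNReal.ofReal W ^ (2 : ℝ)) ^ (p / 2) * C') (by finiteness) hε
  filter_upwards [hsm η hη] with j hj
  have h3 : circ (fun x => sqfn 1 (h j) x 0 ^ (p / 2)) ≤ C' * η := by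
    refine circ_sqfn_succ_zero_le 0 hr (hhd j) fun t ht => ?_
    refine ((h2 (h j) (hhd j) (hh0 j) t ht).2).trans ?_
    gcongr
    refine (circ_mono fun x => ?_).trans hj
    exact ENNReal.rpow_le_rpow (sqfn_succ_le_zero 1 (h j) x ht.le) hr.le
  refine le_trans ?_ hη'
  rw [mul_assoc]
  refine le_trans ?_ (mul_le_mul_right h3 _)
  rw [← circ_const_mul (by finiteness)]
  refine circ_mono fun x => ?_
  rw [← ENNReal.mul_rpow_of_nonneg _ _ hr.le]
  refine ENNReal.rpow_le_rpow ?_ hr.le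
  rw [sqfn, sqfn, ← lintegral_const_mul' _ _ (by finiteness)]
  refine setLIntegral_mono' measurableSet_Ioi fun c hc => ?_
  have hz : pt x (0 + c) ∈ Metric.ball (0 : ℂ) 1 := by
    rw [zero_add]; exact pt_mem_ball x hc
  rw [mul_left_comm, ← ENNReal.mul_rpow_of_nonneg _ _ zero_le_two]
  gcongr
  simp only [zero_add, Function.iterate_one] at hz ⊢
  rw [hDz j hz, Dz, (hasDerivAt_Iop ((hφ j).fun_mul hw) hz).deriv, enorm_mul, enorm_mul]
  rw [mem_ball_zero_iff] at hz
  have e1 : ‖pt x c‖ₑ ≤ 1 := by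
    rw [← ofReal_norm]; exact ENNReal.ofReal_le_one.2 hz.le
  have e2 : ‖w (pt x c)‖ₑ ≤ ENNReal.ofReal W := by
    rw [← ofReal_norm]; exact ENNReal.ofReal_le_ofReal (hW _ (mem_ball_zero_iff.2 hz))
  calc _ ≤ 1 * (‖φ j (pt x c)‖ₑ * ENNReal.ofReal W) := by gcongr
    _ = _ := by rw [one_mul, mul_comm]

theorem exists_norm_deriv_dil_le {f : ℂ → ℂ} (hf : DifferentiableOn ℂ f (Metric.ball 0 1)) {d : ℝ}
    (hd : 0 < d) : ∃ W : ℝ, ∀ z ∈ Metric.ball (0 : ℂ) 1, ‖deriv (dil d f) z‖ ≤ W := by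
  have hd' : Real.exp (-d) < 1 := by simpa using hd
  obtain ⟨W, hW⟩ := (isCompact_closedBall (0 : ℂ) (Real.exp (-d))).exists_bound_of_continuousOn
    ((hf.deriv Metric.isOpen_ball).continuousOn.mono (Metric.closedBall_subset_ball hd'))
  refine ⟨1 * W, fun z hz => ?_⟩
  rw [mem_ball_zero_iff] at hz
  unfold dil
  have e : ‖(Real.exp (-d) : ℂ)‖ = Real.exp (-d) := by
    rw [Complex.norm_real, Real.norm_eq_abs, Real.abs_exp]
  rw [deriv_comp_mul_left (Real.exp (-d) : ℂ) f z, norm_smul, e]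
  gcongr
  refine hW _ ?_
  rw [mem_closedBall_zero_iff, norm_mul, e]
  exact mul_le_of_le_one_right (Real.exp_pos _).le hz.le

theorem hsmall_Iop_mul_deriv {p q s : ℝ} (hp : 0 < p) (hs : 0 < s) (hq : 0 < q) (hqp : q < p)
    (hpsq : 1 / q = 1 / p + 1 / s) {φ : ℕ → ℂ → ℂ} {γ : ℂ → ℂ}
    (hφ : ∀ j, DifferentiableOn ℂ (φ j) (Metric.ball 0 1)) (hφ0 : ∀ j, φ j 0 = 0) (hL : LU φ)
    {B : ℝ≥0∞} (hB : B ≠ ∞) (hφB : ∀ j, Bd p (φ j) B)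
    (hγ : DifferentiableOn ℂ γ (Metric.ball 0 1)) (hγ0 : γ 0 = 0) {A : ℝ≥0∞} (hA : A ≠ ∞)
    (hγA : Bd s γ A) : HSmall q fun j => Iop fun z => φ j z * deriv γ z := by
  intro ε hε
  obtain ⟨C, hC, hprim⟩ := circ_primitive_le hp hs hq hpsq
  obtain ⟨ν, hν, hν'⟩ := ENNReal.exists_mul_le (C := 2 ^ q * 2) (by finiteness) hε
  obtain ⟨l, hl, η, hη, hscale⟩ := ENNReal.exists_scale (p := p) s hp hC hB hν
  obtain ⟨N, hN⟩ := (hsmall_sub_dil hs hγ hγ0 hA hγA η hη).exists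
  have hd : (0 : ℝ) < 1 / ((N : ℝ) + 1) := by positivity
  set γ' := dil (1 / ((N : ℝ) + 1)) γ with hγ'
  have hdil : DifferentiableOn ℂ γ' (Metric.ball 0 1) := hγ.dil hd.le
  obtain ⟨W, hW⟩ := exists_norm_deriv_dil_le hγ hd
  have hsub : DifferentiableOn ℂ (fun z => γ z - γ' z) (Metric.ball 0 1) := hγ.fun_sub hdil
  have hsub' := hsub.deriv Metric.isOpen_ball
  have hdil_deriv := hdil.deriv Metric.isOpen_ball
  have h1 : ∀ j, Bd q (Iop fun z => φ j z * deriv (fun z => γ z - γ' z) z) ν := by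
    intro j t ht
    have := hprim (fun z => l * φ j z) (fun z => (l⁻¹ : ℝ) * (γ z - γ' z)) _
      ((hφ j).const_mul _) (hsub.const_mul _) ((hφ j).fun_mul hsub').Iop (by simp [hφ0])
      (by simp [hγ', dil, hγ0]) (Iop_zero _) (fun z hz => by
        rw [(hasDerivAt_Iop ((hφ j).fun_mul hsub') hz).deriv]
        have hdz := hsub.differentiableAt (Metric.isOpen_ball.mem_nhds hz)
        rw [deriv_const_mul _ hdz]
        have : (l : ℂ) ≠ 0 := by exact_mod_cast hl.ne'
        push_cast
        field_simp) t ht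
    refine this.trans (le_trans (mul_le_mul_right (add_le_add (le_of_eq ?_) (le_of_eq ?_)) _)
      (hscale _ (hφB j t ht) _ (hN t ht)))
    · rw [← circ_const_mul (by finiteness)]
      congr 1
      ext x
      rw [enorm_mul, ENNReal.mul_rpow_of_nonneg _ _ hp.le, ← ofReal_norm (l : ℂ),
        Complex.norm_of_nonneg hl.le]
    · rw [← circ_const_mul (by finiteness)]
      congr 1
      ext x
      rw [enorm_mul, ENNReal.mul_rpow_of_nonneg _ _ hs.le, ← ofReal_norm ((l⁻¹ : ℝ) : ℂ),
        Complex.norm_of_nonneg (inv_pos.2 hl).le]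
  have h2 := HSmall.of_exponent_lt hq hqp
    (hsmall_Iop_mul_of_bounded hp hφ hφ0 hL hB hφB hdil_deriv hW)
  filter_upwards [h2 ν hν] with j hj
  refine (Bd.of_le_add hq.le ((hφ j).fun_mul hsub').Iop (h1 j) hj fun z hz => ?_).mono
    (le_trans (le_of_eq (by ring)) hν')
  have e : Set.EqOn (fun z => φ j z * deriv γ z) (fun z => φ j z * deriv (fun z => γ z - γ' z) z +
      φ j z * deriv γ' z) (Metric.ball 0 1) := fun z hz => by
    simp only
    rw [deriv_fun_sub (hγ.differentiableAt (Metric.isOpen_ball.mem_nhds hz))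
      (hdil.differentiableAt (Metric.isOpen_ball.mem_nhds hz))]
    ring
  rw [Iop_congr e hz, Iop_add ((hφ j).fun_mul hsub') ((hφ j).fun_mul hdil_deriv) hz]
  exact norm_add_le _ _

theorem hsmall_iterate_Iop_mul_iteratedDeriv {p q s : ℝ} (hp : 0 < p) (hs : 0 < s) (hq : 0 < q)
    (hqp : q < p) (hpsq : 1 / q = 1 / p + 1 / s) {φ : ℕ → ℂ → ℂ} {γ : ℂ → ℂ}
    (hφ : ∀ j, DifferentiableOn ℂ (φ j) (Metric.ball 0 1)) (hφ0 : ∀ j, φ j 0 = 0) (hL : LU φ)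
    {B : ℝ≥0∞} (hB : B ≠ ∞) (hφB : ∀ j, Bd p (φ j) B)
    (hγ : DifferentiableOn ℂ γ (Metric.ball 0 1)) (hγ0 : γ 0 = 0) {A : ℝ≥0∞} (hA : A ≠ ∞)
    (hγA : Bd s γ A) (n : ℕ) :
    HSmall q fun j => Iop^[n + 1] fun z => φ j z * iteratedDeriv (n + 1) γ z := by
  induction n with
  | zero =>
    simpa only [zero_add, iteratedDeriv_one, Function.iterate_one] using
      hsmall_Iop_mul_deriv hp hs hq hqp hpsq hφ hφ0 hL hB hφB hγ hγ0 hA hγA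
  | succ n ih =>
    have h1 := hsmall_iterate_Iop_mul hp hs hq hpsq hφ hφ0 hL hB hφB hγ hγ0 hA hγA 0 n
    simp only [zero_add, iteratedDeriv_one] at h1
    refine HSmall.of_le_add hq.le
      (fun j => ((hφ j).fun_mul (hγ.iteratedDeriv_ball _)).iterate_Iop _) ih h1 fun j z hz => ?_
    have d1 : DifferentiableOn ℂ (fun z => φ j z * iteratedDeriv (n + 1) γ z) (Metric.ball 0 1) :=
      (hφ j).fun_mul (hγ.iteratedDeriv_ball _)
    have d2 : DifferentiableOn ℂ (fun z => deriv (φ j) z * iteratedDeriv (n + 1) γ z)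
        (Metric.ball 0 1) := ((hφ j).deriv Metric.isOpen_ball).fun_mul (hγ.iteratedDeriv_ball _)
    have d3 : DifferentiableOn ℂ (fun z => φ j z * iteratedDeriv (n + 2) γ z) (Metric.ball 0 1) :=
      (hφ j).fun_mul (hγ.iteratedDeriv_ball _)
    have e1 : Set.EqOn (deriv fun z => φ j z * iteratedDeriv (n + 1) γ z)
        (fun z => deriv (φ j) z * iteratedDeriv (n + 1) γ z + φ j z * iteratedDeriv (n + 2) γ z)
        (Metric.ball 0 1) := fun z hz => by
      have hn := Metric.isOpen_ball.mem_nhds hz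
      rw [deriv_fun_mul ((hφ j).differentiableAt hn)
        ((hγ.iteratedDeriv_ball _).differentiableAt hn), iteratedDeriv_succ (n := n + 1)]
    have e2 := iterate_Iop_congr (Iop_deriv d1 (by simp [hφ0])) (n + 1) hz
    rw [← Function.iterate_succ_apply, iterate_Iop_congr e1 (n + 2) hz,
      iterate_Iop_add d2 d3 (n + 2) hz] at e2
    rw [← e2]
    calc _ = ‖(Iop^[n + 2] (fun z => deriv (φ j) z * iteratedDeriv (n + 1) γ z) z +
          Iop^[n + 2] (fun z => φ j z * iteratedDeriv (n + 2) γ z) z) -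
          Iop^[n + 2] (fun z => deriv (φ j) z * iteratedDeriv (n + 1) γ z) z‖ := by
            rw [add_sub_cancel_left]
      _ ≤ _ := norm_sub_le _ _

theorem norm_iterate_Iop_le {h : ℂ → ℂ} {K : ℝ} (hK : ∀ z ∈ Metric.ball (0 : ℂ) 1, ‖h z‖ ≤ K)
    (n : ℕ) : ∀ z ∈ Metric.ball (0 : ℂ) 1, ‖Iop^[n] h z‖ ≤ K := by
  induction n with
  | zero => exact hK
  | succ n ih =>
    intro z hz
    rw [Function.iterate_succ_apply', Iop, norm_mul]
    have h1 : ‖∫ t in (0 : ℝ)..1, Iop^[n] h (t • z)‖ ≤ K * |1 - 0| := by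
      refine intervalIntegral.norm_integral_le_of_norm_le_const fun t ht => ih _ ?_
      rw [Set.uIoc_of_le zero_le_one] at ht
      exact smul_mem_unitBall hz (Set.Ioc_subset_Icc_self ht)
    rw [sub_zero, abs_one, mul_one] at h1
    exact (mul_le_of_le_one_left (norm_nonneg _) (mem_ball_zero_iff.1 hz).le).trans h1

theorem iterate_Iop_const_mul (c : ℂ) (h : ℂ → ℂ) (n : ℕ) :
    Iop^[n] (fun z => c * h z) = fun z => c * Iop^[n] h z := by
  induction n with
  | zero => rfl
  | succ n ih =>
    rw [Function.iterate_succ_apply', ih]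
    ext z
    rw [Iop, Function.iterate_succ_apply', Iop, intervalIntegral.integral_const_mul]
    ring

theorem exists_norm_iterate_Iop_iteratedDeriv_le {g : ℂ → ℂ}
    (hg : DifferentiableOn ℂ g (Metric.ball 0 1)) (n : ℕ) :
    ∃ K : ℝ, ∀ z ∈ Metric.ball (0 : ℂ) 1, ‖Iop^[n] (iteratedDeriv n g) z‖ ≤ ‖g z‖ + K := by
  induction n with
  | zero => exact ⟨0, fun z _ => by simp⟩
  | succ n ih =>
    obtain ⟨K, hK⟩ := ih
    set c := iteratedDeriv n g 0
    refine ⟨K + ‖-c‖, fun z hz => ?_⟩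
    have hd := hg.iteratedDeriv_ball n
    have e : Set.EqOn (Iop (iteratedDeriv (n + 1) g)) (fun z => iteratedDeriv n g z + -c)
        (Metric.ball 0 1) := fun z hz => by
      rw [iteratedDeriv_succ, Iop_eq_of_hasDerivAt (G := iteratedDeriv n g)
        (hd.deriv Metric.isOpen_ball)
        (fun z hz => (hd.differentiableAt (Metric.isOpen_ball.mem_nhds hz)).hasDerivAt) hz,
        sub_eq_add_neg]
    rw [Function.iterate_succ_apply, iterate_Iop_congr e n hz,
      iterate_Iop_add hd (differentiableOn_const _) n hz, ← add_assoc]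
    exact (norm_add_le _ _).trans
      (add_le_add (hK z hz) (norm_iterate_Iop_le (fun _ _ => le_rfl) n z hz))

theorem iteratedDeriv_succ_sub_const (f : ℂ → ℂ) (c : ℂ) (k : ℕ) :
    iteratedDeriv (k + 1) (fun z => f z - c) = iteratedDeriv (k + 1) f := by
  rw [iteratedDeriv_succ', iteratedDeriv_succ']
  congr 1
  ext z
  exact deriv_sub_const c

theorem Bd.sub_const {p : ℝ} (hp : 0 ≤ p) {f : ℂ → ℂ}
    (hf : DifferentiableOn ℂ f (Metric.ball 0 1)) {B M : ℝ≥0∞} (hB : Bd p f B) {c : ℂ}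
    (hc : ‖c‖ₑ ≤ M) :
    Bd p (fun z => f z - c) (2 ^ p * (B + ENNReal.ofReal (2 * Real.pi) * M ^ p)) :=
  Bd.of_le_add hp hf hB (Bd.of_forall_le (f := fun _ => c) hp fun _ _ => hc)
    fun _ _ => norm_sub_le _ _

theorem LU.sub_apply_zero {F : ℕ → ℂ → ℂ} (h : LU F) : LU fun j z => F j z - F j 0 := by
  intro ρ hρ ε hε
  filter_upwards [h ρ hρ (ε / 2) (half_pos hε)] with j hj z hz
  have h0 := hj 0 (by rw [norm_zero]; exact (norm_nonneg z).trans hz)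
  linarith [norm_sub_le (F j z) (F j 0), hj z hz]

theorem LU.hsmall_const_mul {F : ℕ → ℂ → ℂ} (h : LU F) {s : ℝ} (hs : 0 < s) {Γ : ℂ → ℂ}
    {A : ℝ≥0∞} (hA : A ≠ ∞) (hΓ : Bd s Γ A) : HSmall s fun j z => F j 0 * Γ z := by
  intro ε hε
  obtain ⟨l, hl, _, -, h1⟩ := ENNReal.exists_scale (p := s) 1 hs (C := 1) (by finiteness) hA hε
  have hl' : ENNReal.ofReal l ≠ 0 := by simpa using hl
  filter_upwards [h.enorm_le zero_lt_one hl'] with j hj t ht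
  have h2 := h1 _ (hΓ t ht) 0 bot_le
  rw [one_mul, mul_zero, add_zero, ← circ_const_mul (by finiteness)] at h2
  refine (circ_mono fun x => ?_).trans h2
  rw [enorm_mul, ENNReal.mul_rpow_of_nonneg _ _ hs.le]
  gcongr
  exact hj 0 norm_zero.le

theorem hsmall_Tgnk {p q s : ℝ} (hp : 0 < p) (hs : 0 < s) (hq : 0 < q) (hqp : q < p)
    (hqs : q < s) (hpsq : 1 / q = 1 / p + 1 / s) {f : ℕ → ℂ → ℂ} {g : ℂ → ℂ}
    (hf : ∀ j, DifferentiableOn ℂ (f j) (Metric.ball 0 1)) (hL : LU f)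
    {B M : ℝ≥0∞} (hB : B ≠ ∞) (hM : M ≠ ∞) (hfB : ∀ j, Bd p (f j) B) (hfM : ∀ j, ‖f j 0‖ₑ ≤ M)
    (hg : DifferentiableOn ℂ g (Metric.ball 0 1)) {A : ℝ≥0∞} (hA : A ≠ ∞)
    (hgA : Bd s g A) {n k : ℕ} (hk : k < n) : HSmall q fun j => Tgnk g n k (f j) := by
  have hφ : ∀ j, DifferentiableOn ℂ (fun z => f j z - f j 0) (Metric.ball 0 1) := fun j =>
    (hf j).sub_const _
  have hφ0 : ∀ j, f j 0 - f j 0 = 0 := fun j => sub_self _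
  have hφB := fun j => (hfB j).sub_const hp.le (hf j) (hfM j)
  have hγ : DifferentiableOn ℂ (fun z => g z - g 0) (Metric.ball 0 1) := hg.sub_const _
  have hγA := hgA.sub_const hs.le hg (le_refl ‖g 0‖ₑ)
  have hBt : 2 ^ p * (B + ENNReal.ofReal (2 * Real.pi) * M ^ p) ≠ ∞ := by finiteness
  have hAt : 2 ^ s * (A + ENNReal.ofReal (2 * Real.pi) * ‖g 0‖ₑ ^ s) ≠ ∞ := by finiteness
  rcases k with _ | k
  · obtain ⟨n, rfl⟩ := Nat.exists_eq_succ_of_ne_zero hk.ne'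
    have h1 := hsmall_iterate_Iop_mul_iteratedDeriv hp hs hq hqp hpsq hφ hφ0 hL.sub_apply_zero hBt
      hφB hγ (sub_self _) hAt hγA n
    simp only [iteratedDeriv_succ_sub_const] at h1
    obtain ⟨K, hK⟩ := exists_norm_iterate_Iop_iteratedDeriv_le hg (n + 1)
    have hΓ := Bd.of_le_add hs.le hg hgA (Bd.of_forall_le (f := fun _ => (K : ℂ)) hs.le
      fun _ _ => le_refl ‖(K : ℂ)‖ₑ) fun z hz => (hK z hz).trans
        (add_le_add_right ((le_abs_self K).trans_eq (Complex.norm_real K).symm) _)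
    have h2 := (hL.hsmall_const_mul hs (by finiteness) hΓ).of_exponent_lt hq hqs
    refine HSmall.of_le_add hq.le (fun j => ?_) h1 h2 fun j z hz => ?_
    · exact ((hφ j).fun_mul (hg.iteratedDeriv_ball _)).iterate_Iop _
    have hd := hg.iteratedDeriv_ball (n + 1)
    have e : Set.EqOn (fun z => iteratedDeriv 0 (f j) z * iteratedDeriv (n.succ - 0) g z)
        (fun z => (f j z - f j 0) * iteratedDeriv (n + 1) g z + f j 0 * iteratedDeriv (n + 1) g z)
        (Metric.ball 0 1) := fun z _ => by simp; ring
    rw [Tgnk, iterate_Iop_congr e _ hz,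
      iterate_Iop_add ((hφ j).fun_mul hd) (hd.const_mul _) _ hz, iterate_Iop_const_mul]
    exact norm_add_le _ _
  · obtain ⟨m, rfl⟩ := Nat.exists_eq_add_of_lt hk
    have h1 := hsmall_iterate_Iop_mul hp hs hq hpsq hφ hφ0 hL.sub_apply_zero hBt hφB hγ
      (sub_self _) hAt hγA k m
    simp only [iteratedDeriv_succ_sub_const] at h1
    have e : k + 1 + m + 1 - (k + 1) = m + 1 := by omega
    simp only [Tgnk, e]
    rwa [show k + 1 + m + 1 = k + m + 2 by omega]

theorem pt_eq (x t : ℝ) : pt x t = Real.exp (-t) * circlePt x := by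
  rw [pt, circlePt, Complex.exp_add]
  push_cast
  rfl

theorem lintegral_le_of_hardyNorm_le {p : ℝ} (hp : 0 < p) {f : ℂ → ℂ} {M : ℝ≥0∞}
    (h : hardyNorm p f ≤ M) {r : ℝ} (hr : r ∈ Set.Ico (0 : ℝ) 1) :
    circ (fun θ => ‖f (r * circlePt θ)‖ₑ ^ p) ≤ ENNReal.ofReal (2 * Real.pi) * M ^ p := by
  have h1 := ENNReal.rpow_le_rpow h hp.le
  rw [hardyNorm, ← ENNReal.rpow_mul, one_div_mul_cancel hp.ne', ENNReal.rpow_one] at h1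
  have h2 := (le_iSup₂ (f := fun (r : ℝ) (_ : r ∈ Set.Ico (0 : ℝ) 1) =>
    (∫⁻ θ in Set.Ioc (0 : ℝ) (2 * Real.pi), (‖f (r * circlePt θ)‖₊ : ℝ≥0∞) ^ p) /
      ENNReal.ofReal (2 * Real.pi)) r hr).trans h1
  have hpi : ENNReal.ofReal (2 * Real.pi) ≠ 0 := by simp [Real.pi_pos]
  rwa [ENNReal.div_le_iff' hpi ENNReal.ofReal_ne_top] at h2

theorem bd_of_hardyNorm_le {p : ℝ} (hp : 0 < p) {f : ℂ → ℂ} {M : ℝ≥0∞} (h : hardyNorm p f ≤ M) :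
    Bd p f (ENNReal.ofReal (2 * Real.pi) * M ^ p) := by
  intro t ht
  simp only [pt_eq]
  exact lintegral_le_of_hardyNorm_le hp h ⟨(Real.exp_pos _).le, by simpa using ht⟩

theorem enorm_apply_zero_le_of_hardyNorm_le {p : ℝ} (hp : 0 < p) {f : ℂ → ℂ} {M : ℝ≥0∞}
    (h : hardyNorm p f ≤ M) : ‖f 0‖ₑ ≤ M := by
  have h1 := lintegral_le_of_hardyNorm_le hp h (r := 0) ⟨le_rfl, zero_lt_one⟩
  simp only [Complex.ofReal_zero, zero_mul, circ_const] at h1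
  have hpi : ENNReal.ofReal (2 * Real.pi) ≠ 0 := by simp [Real.pi_pos]
  rwa [ENNReal.mul_le_mul_iff_right hpi ENNReal.ofReal_ne_top, ENNReal.rpow_le_rpow_iff hp] at h1

theorem HSmall.tendsto_hardyNorm {q : ℝ} (hq : 0 < q) {F : ℕ → ℂ → ℂ} (h : HSmall q F)
    (h0 : ∀ j, F j 0 = 0) :
    Filter.Tendsto (fun j => hardyNorm q (F j)) Filter.atTop (nhds 0) := by
  rw [ENNReal.tendsto_nhds_zero]
  intro ε hε
  have hpi : ENNReal.ofReal (2 * Real.pi) ≠ 0 := by simp [Real.pi_pos]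
  have hm : min ε 1 ≠ 0 := (lt_min hε one_pos).ne'
  have hη : ENNReal.ofReal (2 * Real.pi) * min ε 1 ^ q ≠ 0 := by
    simp [Real.pi_pos, ENNReal.rpow_eq_zero_iff, hm, hq]
  filter_upwards [h _ hη] with j hj
  refine le_trans (ENNReal.rpow_le_rpow (z := 1 / q) (iSup₂_le fun r hr => ?_)
    (by positivity)) (b := (min ε 1 ^ q) ^ (1 / q)) ?_
  · rw [ENNReal.div_le_iff' hpi ENNReal.ofReal_ne_top]
    rcases hr.1.eq_or_lt with rfl | hr0
    · simp [h0, hq]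
    · have h1 := hj (-Real.log r) (by simpa using Real.log_neg hr0 hr.2)
      simp only [pt_eq, neg_neg, Real.exp_log hr0] at h1
      exact h1
  · rw [← ENNReal.rpow_mul, mul_one_div_cancel hq.ne', ENNReal.rpow_one]
    exact min_le_left _ _

theorem LU.of_tendstoUniformlyOn {F : ℕ → ℂ → ℂ}
    (h : ∀ K ⊆ Metric.ball (0 : ℂ) 1, IsCompact K → TendstoUniformlyOn F 0 Filter.atTop K) :
    LU F := by
  intro ρ hρ ε hε
  filter_upwards [Metric.tendstoUniformlyOn_iff.1 (h _ (Metric.closedBall_subset_ball hρ)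
    (isCompact_closedBall 0 ρ)) ε hε] with j hj z hz
  have := hj z (mem_closedBall_zero_iff.2 hz)
  rw [Pi.zero_apply, dist_zero_left] at this
  exact this.le

theorem stmt9 (p q s : ℝ) (hq : 0 < q) (hqp : q < p) (hs : 1 / s = 1 / q - 1 / p)
    (n k : ℕ) (hk : k < n) (g : ℂ → ℂ) (hg : AnalyticOn ℂ g (Metric.ball 0 1))
    (hgs : hardyNorm s g ≠ ∞) :
    ∀ f : ℕ → ℂ → ℂ, (∀ j, AnalyticOn ℂ (f j) (Metric.ball 0 1)) →
      (∃ M : ℝ≥0∞, M ≠ ∞ ∧ ∀ j, hardyNorm p (f j) ≤ M) →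
      (∀ K ⊆ Metric.ball (0 : ℂ) 1, IsCompact K → TendstoUniformlyOn f 0 Filter.atTop K) →
      Filter.Tendsto (fun j => hardyNorm q (Tgnk g n k (f j))) Filter.atTop (nhds 0) := by
  rintro f hf ⟨M, hM, hfM⟩ hconv
  have hp : 0 < p := hq.trans hqp
  have hs1 : 0 < 1 / s := by rw [hs]; exact sub_pos.2 (one_div_lt_one_div_of_lt hq hqp)
  have hs0 : 0 < s := one_div_pos.1 hs1
  have hqs : q < s := by
    rw [← one_div_lt_one_div hs0 hq, hs]
    exact sub_lt_self _ (one_div_pos.2 hp)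
  have hpsq : 1 / q = 1 / p + 1 / s := by rw [hs]; ring
  have h := hsmall_Tgnk hp hs0 hq hqp hqs hpsq (fun j => (hf j).differentiableOn)
    (LU.of_tendstoUniformlyOn hconv) (by finiteness) hM (fun j => bd_of_hardyNorm_le hp (hfM j))
    (fun j => enorm_apply_zero_le_of_hardyNorm_le hp (hfM j)) hg.differentiableOn (by finiteness)
    (bd_of_hardyNorm_le hs0 le_rfl) hk
  refine h.tendsto_hardyNorm hq fun j => ?_
  obtain ⟨n, rfl⟩ := Nat.exists_eq_succ_of_ne_zero (Nat.ne_zero_of_lt hk)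
  rw [Tgnk, Function.iterate_succ_apply', Iop_zero]
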